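/- arXiv:1705.01594 — 3 statements merged into one kernel-verified Lean document; each statement's English description precedes it below -/
import Mathlib

section
/- Let R be a commutative Noetherian ring and I = Ra₁ + Ra₂ an ideal generated by two elements. Then cd(I, R) = 2 if and only if there exists an R-module M with Tor_0^R(R/I, M) = Tor_1^R(R/I, M) = 0 and Tor_2^R(R/I, M) ≠ 0. -/
open CategoryTheory

noncomputable section

universe u

/-- `Tor_i^R(A, B)` as an object of `ModuleCat R`. -/
def TorMod (R : Type u) [CommRing R] (i : ℕ) (A B : ModuleCat.{u} R) : ModuleCat.{u} R :=
  ((Tor (ModuleCat.{u} R) i).obj A).obj B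

/-- `Ext^i_R(A, B)` as an object of `ModuleCat R`. -/
def ExtMod (R : Type u) [CommRing R] (i : ℕ) (A B : ModuleCat.{u} R) : ModuleCat.{u} R :=
  ((Ext R (ModuleCat.{u} R) i).obj (Opposite.op A)).obj B

/-- `H^i_I(M)`, the `i`-th local cohomology of `M` with support in `I`. -/
def LC (R : Type u) [CommRing R] (I : Ideal R) (i : ℕ) (M : ModuleCat.{u} R) : ModuleCat.{u} R :=
  (localCohomology I i).obj M

/-- `M` is `I`-cofinite: `Supp M ⊆ V(I)` and all `Ext^i_R(R/I, M)` are finitely generated. -/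
def IsCofinite (R : Type u) [CommRing R] (I : Ideal R) (M : ModuleCat.{u} R) : Prop :=
  Module.support R M ⊆ PrimeSpectrum.zeroLocus (I : Set R) ∧
    ∀ i : ℕ, Module.Finite R (ExtMod R i (ModuleCat.of R (R ⧸ I)) M)

/-- `Γ_I(M) = ⋃ₙ (0 :_M Iⁿ)`, the `I`-torsion submodule of `M`. -/
def torsionGamma (R : Type u) [CommRing R] (I : Ideal R) (M : Type u) [AddCommGroup M]
    [Module R M] : Submodule R M :=
  ⨆ n : ℕ, Submodule.torsionBySet R M ((I ^ n : Ideal R) : Set R)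


/-- The map `(x, y) ↦ a x + b y`. -/
def s13d {R : Type u} [CommRing R] (a b : R) : R × R →ₗ[R] R :=
  LinearMap.coprod (LinearMap.toSpanSingleton R R a) (LinearMap.toSpanSingleton R R b)

theorem s13d_apply {R : Type u} [CommRing R] (a b : R) (z : R × R) :
    s13d a b z = a * z.1 + b * z.2 := by
  simp [s13d, mul_comm]

/-- Key linear map from (Koszul) syzygies. -/
theorem s13_key {R : Type u} [CommRing R] [IsNoetherianRing R] (a b : R) (n : ℕ) :
    ∃ (q : ℕ) (h : LinearMap.ker (s13d (a ^ (n + q)) (b ^ (n + q))) →ₗ[R] R),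
      (∀ z, a ^ q * z.1.1 = - (b ^ n * h z)) ∧ (∀ z, b ^ q * z.1.2 = a ^ n * h z) ∧
      (∀ z, z.1.1 = - b ^ (n + q) → z.1.2 = a ^ (n + q) → h z = (a * b) ^ q) := by
  -- stabilisation of annihilators
  have hstab : ∀ (c d : R), ∃ N, ∀ k x, d ∣ c ^ k * x → d ∣ c ^ N * x := by
    intro c d
    let f : ℕ →o Ideal R := ⟨fun k => (Ideal.span {d}).colon {c ^ k}, by
      intro i j hij x hx
      rw [Submodule.mem_colon_singleton, smul_eq_mul] at hx ⊢
      obtain ⟨t, rfl⟩ := Nat.exists_eq_add_of_le hij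
      rw [pow_add, ← mul_assoc]
      exact Ideal.mul_mem_right _ _ hx⟩
    obtain ⟨N, hN⟩ := monotone_stabilizes_iff_noetherian.mpr ‹IsNoetherianRing R› f
    refine ⟨N, fun k x hx => ?_⟩
    have h1 : x ∈ f (N + k) := by
      change x ∈ (Ideal.span {d}).colon {c ^ (N + k)}
      rw [Submodule.mem_colon_singleton, smul_eq_mul, Ideal.mem_span_singleton, mul_comm, pow_add, mul_assoc]
      exact Dvd.dvd.mul_left hx _
    rw [← hN (N + k) (by omega)] at h1
    change x ∈ (Ideal.span {d}).colon {c ^ N} at h1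
    rwa [Submodule.mem_colon_singleton, smul_eq_mul, Ideal.mem_span_singleton, mul_comm] at h1
  obtain ⟨N, hN⟩ := hstab b 0
  obtain ⟨s, hs⟩ := hstab a (b ^ (n + N))
  have hN' : ∀ k x, b ^ k * x = 0 → b ^ N * x = 0 := fun k x hx =>
    zero_dvd_iff.mp (hN k x (zero_dvd_iff.mpr hx))
  let q := N + s
  have hmem : ∀ x y : R, a ^ (n + q) * x + b ^ (n + q) * y = 0 →
      ∃ t, a ^ s * x = b ^ (n + N) * t := by
    intro x y hxy
    apply hs (n + q)
    refine ⟨- (b ^ s * y), ?_⟩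
    have : b ^ (n + q) = b ^ (n + N) * b ^ s := by rw [← pow_add]; congr 1; omega
    rw [this] at hxy
    linear_combination hxy
  have hz : ∀ z : LinearMap.ker (s13d (a ^ (n + q)) (b ^ (n + q))), 
        a ^ (n + q) * z.1.1 + b ^ (n + q) * z.1.2 = 0 := by
    intro z
    have := LinearMap.mem_ker.mp z.2
    rwa [s13d_apply] at this
  choose t ht using fun z : LinearMap.ker (s13d (a ^ (n + q)) (b ^ (n + q))) => hmem z.1.1 z.1.2 (hz z)
  have huniq : ∀ u v : R, b ^ (n + N) * u = b ^ (n + N) * v → b ^ N * u = b ^ N * v := by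
    intro u v huv
    have := hN' (n + N) (u - v) (by linear_combination huv)
    linear_combination this
  refine ⟨q, { toFun := fun z => - (a ^ N * (b ^ N * t z)), map_add' := ?_, map_smul' := ?_ },
    ?_, ?_, ?_⟩
  · intro z w
    have := huniq (t (z + w)) (t z + t w) (by
      rw [mul_add, ← ht, ← ht, ← ht]; simp; ring)
    rw [this]; ring
  · intro r z
    have := huniq (t (r • z)) (r * t z) (by
      have := ht z
      rw [← ht]; simp; linear_combination r * this)
    rw [this]; simp; ring
  · intro z
    have := ht z
    simp only [LinearMap.coe_mk, AddHom.coe_mk, q]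
    rw [pow_add, pow_add] at *
    linear_combination a ^ N * this
  · intro z
    have h1 := ht z
    have h2 := hz z
    simp only [LinearMap.coe_mk, AddHom.coe_mk, q] at *
    have h3 := hN' (n + N) (b ^ s * z.1.2 + a ^ (n + N) * t z) (by
      rw [pow_add, pow_add, pow_add] at *
      simp only [pow_add] at *
      linear_combination h2 - (a ^ n * a ^ N) * h1)
    simp only [pow_add] at *
    linear_combination h3
  · intro z hz1 hz2
    have h1 := ht z
    rw [hz1] at h1
    have := huniq (t z) (- (a ^ s * b ^ s)) (by
      rw [← h1]; simp only [q, pow_add]; ring)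
    simp only [LinearMap.coe_mk, AddHom.coe_mk, q]
    rw [this, mul_pow]; simp only [pow_add]; ring

theorem s13_K1pow {R : Type u} [CommRing R] {M : Type u} [AddCommGroup M] [Module R M] (a b : R)
    (hK : ∀ x y : M, a • x + b • y = 0 → ∃ m : M, x = - (b • m) ∧ y = a • m) (k : ℕ) :
    ∀ x y : M, a ^ k • x + b • y = 0 → ∃ m : M, x = - (b • m) ∧ y = a ^ k • m := by
  induction k with
  | zero =>
    intro x y h
    refine ⟨y, ?_, by simp⟩
    simpa [eq_neg_iff_add_eq_zero] using h
  | succ k ih =>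
    intro x y h
    obtain ⟨m, h1, h2⟩ := ih (a • x) y (by rw [smul_smul, ← pow_succ]; exact h)
    obtain ⟨m', h3, h4⟩ := hK x m (by rw [h1]; simp)
    exact ⟨m', h3, by rw [h2, h4, smul_smul, ← pow_succ]⟩

theorem s13_K1pow2 {R : Type u} [CommRing R] {M : Type u} [AddCommGroup M] [Module R M] (a b : R)
    (hK : ∀ x y : M, a • x + b • y = 0 → ∃ m : M, x = - (b • m) ∧ y = a • m) (k l : ℕ) :
    ∀ x y : M, a ^ k • x + b ^ l • y = 0 → ∃ m : M, x = - (b ^ l • m) ∧ y = a ^ k • m := by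
  have h1 := s13_K1pow a b hK k
  have h2 := s13_K1pow (M := M) b (a ^ k) (by
    intro x y h
    obtain ⟨m, e1, e2⟩ := h1 y x (by rw [add_comm]; exact h)
    exact ⟨-m, by rw [e2]; simp, by rw [e1]; simp⟩) l
  intro x y h
  obtain ⟨m, e1, e2⟩ := h2 y x (by rw [add_comm]; exact h)
  exact ⟨-m, by rw [e2]; simp, by rw [e1]; simp⟩

theorem s13_chain {R : Type u} [CommRing R] {M : Type u} [AddCommGroup M] [Module R M] (a b : R)
    (hK : ∀ x y : M, a • x + b • y = 0 → ∃ m : M, x = - (b • m) ∧ y = a • m)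
    (m : M) (hm : m ≠ 0) (ha : a • m = 0) (hb : b • m = 0) (n : ℕ) (r s : R)
    (h : (a * b) ^ n = r * a ^ (n + 1) + s * b ^ (n + 1)) : False := by
  obtain ⟨m1, e1, e2⟩ := s13_K1pow2 a b hK n 1 0 m (by simpa using hb)
  obtain ⟨m2, e3, e4⟩ := s13_K1pow2 a b hK (n + 1) n m1 0 (by
    rw [pow_succ', mul_smul, ← e2]; simpa using ha)
  apply hm
  have e5 : b • m1 = 0 := by simpa using e1.symm
  have e6 : b ^ (n + 1) • m2 = 0 := by
    have : b • m1 = - (b ^ (n + 1) • m2) := by rw [e3, smul_neg, smul_smul, ← pow_succ']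
    rw [e5] at this
    simpa using this.symm
  have : m = - ((a * b) ^ n • m2) := by
    rw [e2, e3, smul_neg, smul_smul, mul_pow]
  rw [this, h, add_smul, mul_smul, mul_smul, ← e4, e6]
  simp

/-- The elements of `L` which become integral after multiplying by a power of `a`. -/
def s13N {R : Type u} [CommRing R] (L : Type u) [CommRing L] [Algebra R L] (a : R) :
    Submodule R L where
  carrier := {x | ∃ (n : ℕ) (r : R), a ^ n • x = algebraMap R L r}
  zero_mem' := ⟨0, 0, by simp⟩
  add_mem' := by
    rintro x y ⟨n, r, hx⟩ ⟨m, s, hy⟩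
    refine ⟨n + m, a ^ m * r + a ^ n * s, ?_⟩
    rw [smul_add, map_add, map_mul, map_mul, ← hx, ← hy, pow_add]
    simp only [Algebra.smul_def, map_mul]
    ring
  smul_mem' := by
    rintro c x ⟨n, r, hx⟩
    refine ⟨n, c * r, ?_⟩
    rw [map_mul, ← hx]
    simp only [Algebra.smul_def]
    ring

theorem s13N_mul {R : Type u} [CommRing R] {L : Type u} [CommRing L] [Algebra R L] (a : R)
    (α x : L) (hα : algebraMap R L a * α = 1) (hx : x ∈ s13N L a) : α * x ∈ s13N L a := by
  obtain ⟨n, r, h⟩ := hx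
  refine ⟨n + 1, r, ?_⟩
  rw [← h]
  simp only [Algebra.smul_def, map_pow, pow_succ, map_mul]
  linear_combination (algebraMap R L a ^ n * x) * hα

theorem s13_exM {R : Type u} [CommRing R] (a b : R) (k : ℕ)
    (hk : ∀ n r s, (a * b) ^ n ≠ r * a ^ (n + k) + s * b ^ (n + k)) :
    ∃ (M : Type u) (_ : AddCommGroup M) (_ : Module R M),
      (∀ m : M, ∃ x y : M, m = a • x + b • y) ∧
      (∀ x y : M, a • x + b • y = 0 → ∃ m : M, x = - (b • m) ∧ y = a • m) ∧
      ∃ m : M, m ≠ 0 ∧ a • m = 0 ∧ b • m = 0 ∧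
        ∃ β : LinearMap.ker (s13d a b) →ₗ[R] M →ₗ[R] M,
          ∀ z, z.1.1 = - b → z.1.2 = a → β z m = m := by
  let L := Localization.Away (a * b)
  let N : Submodule R L := s13N L a ⊔ s13N L b
  obtain ⟨γ, hγ⟩ : ∃ γ : L, algebraMap R L (a * b) * γ = 1 :=
    ⟨_, IsLocalization.Away.mul_invSelf (a * b)⟩
  rw [map_mul] at hγ
  set A := algebraMap R L a with hA
  set B := algebraMap R L b with hB
  obtain ⟨α, hα⟩ : ∃ α : L, A * α = 1 := ⟨B * γ, by rw [← hγ]; ring⟩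
  obtain ⟨β, hβ⟩ : ∃ β : L, B * β = 1 := ⟨A * γ, by rw [← hγ]; ring⟩
  -- elements are torsion
  have htor : ∀ l : L, ∃ n : ℕ, a ^ n • l ∈ N ∧ b ^ n • l ∈ N := by
    intro l
    obtain ⟨⟨r, ⟨s, n, rfl⟩⟩, h⟩ := IsLocalization.surj (Submonoid.powers (a * b)) l
    refine ⟨n, Submodule.mem_sup_right ⟨n, r, ?_⟩, Submodule.mem_sup_left ⟨n, r, ?_⟩⟩
    all_goals
      rw [← h]
      simp only [Algebra.smul_def, map_pow, map_mul]
      ring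
  have hne : β ^ k * α ^ k ∉ N := by
    intro hmem
    obtain ⟨f, ⟨s, r, hf⟩, g, ⟨t, r', hg⟩, hfg⟩ := Submodule.mem_sup.mp hmem
    have h1 : algebraMap R L ((a * b) ^ (s + t)) =
        algebraMap R L (b ^ (s + t + k) * (a ^ (t + k) * r) + a ^ (s + t + k) * (b ^ (s + k) * r')) := by
      have hAk : A ^ k * α ^ k = 1 := by rw [← mul_pow, hα, one_pow]
      have hBk : B ^ k * β ^ k = 1 := by rw [← mul_pow, hβ, one_pow]
      have : (A * B) ^ (s + t) = (A * B) ^ (s + t + k) * (f + g) := by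
        rw [hfg, pow_add _ (s + t) k, mul_pow A B k]
        linear_combination (-(A * B) ^ (s + t)) * hAk * (B ^ k * β ^ k) - (A * B) ^ (s + t) * hBk
      simp only [Algebra.smul_def, map_pow, map_mul, map_add, ← hA, ← hB] at *
      rw [this, ← hf, ← hg]
      simp only [pow_add, mul_pow]
      ring
    obtain ⟨⟨c, p, rfl⟩, hc⟩ := (IsLocalization.eq_iff_exists (Submonoid.powers (a * b)) L).mp h1
    refine hk (s + t + p) (b ^ (s + k) * r' * b ^ p) (a ^ (t + k) * r * a ^ p) ?_
    dsimp only at hc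
    rw [pow_add _ (s + t) p, mul_comm, hc]
    simp only [pow_add, mul_pow]
    ring
  have key : ∀ z : LinearMap.ker (s13d a b), algebraMap R L z.1.2 * α = - (algebraMap R L z.1.1 * β) := by
    intro z
    have := LinearMap.mem_ker.mp z.2
    rw [s13d_apply] at this
    have := congrArg (algebraMap R L) this
    simp only [map_add, map_mul, map_zero, ← hA, ← hB] at this
    linear_combination α * β * this - algebraMap R L z.1.1 * β * hα - algebraMap R L z.1.2 * α * hβ
  have hpres : ∀ z : LinearMap.ker (s13d a b),
      N ≤ N.comap (LinearMap.mulLeft R (algebraMap R L z.1.2 * α)) := by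
    intro z
    refine sup_le ?_ ?_
    · intro x hx
      refine Submodule.mem_sup_left ?_
      have := (s13N L a).smul_mem z.1.2 (s13N_mul a α x hα hx)
      rwa [Algebra.smul_def, ← mul_assoc] at this
    · intro x hx
      refine Submodule.mem_sup_right ?_
      have := (s13N L b).smul_mem (- z.1.1) (s13N_mul b β x hβ hx)
      rw [Algebra.smul_def, ← mul_assoc] at this
      rw [LinearMap.mulLeft_apply, key]
      rwa [map_neg, neg_mul] at this
  have hK2 : ∃ m : L ⧸ N, m ≠ 0 ∧ a • m = 0 ∧ b • m = 0 := by
    classical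
    have step : ∀ (c : R) (m : L ⧸ N), m ≠ 0 → (∃ n : ℕ, c ^ n • m = 0) →
        ∃ n : ℕ, c ^ n • m ≠ 0 ∧ c • c ^ n • m = 0 := by
      intro c m hm hex
      have h0 : Nat.find hex ≠ 0 := by
        intro h
        have := Nat.find_spec hex
        rw [h] at this
        exact hm (by simpa using this)
      obtain ⟨j, hj⟩ := Nat.exists_eq_succ_of_ne_zero h0
      refine ⟨j, Nat.find_min hex (by omega), ?_⟩
      have := Nat.find_spec hex
      rwa [hj, pow_succ', mul_smul] at this
    have htor' : ∀ m : L ⧸ N, ∃ n : ℕ, a ^ n • m = 0 ∧ b ^ n • m = 0 := by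
      intro m
      obtain ⟨l, rfl⟩ := Submodule.Quotient.mk_surjective N m
      obtain ⟨n, h1, h2⟩ := htor l
      refine ⟨n, ?_, ?_⟩
      · rw [← Submodule.Quotient.mk_smul]; exact (Submodule.Quotient.mk_eq_zero N).mpr h1
      · rw [← Submodule.Quotient.mk_smul]; exact (Submodule.Quotient.mk_eq_zero N).mpr h2
    have hm0 : (Submodule.Quotient.mk (β ^ k * α ^ k) : L ⧸ N) ≠ 0 := by
      rwa [Ne, Submodule.Quotient.mk_eq_zero]
    obtain ⟨n, h1, -⟩ := htor' (Submodule.Quotient.mk (β ^ k * α ^ k))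
    obtain ⟨i, hi, hi'⟩ := step a _ hm0 ⟨n, h1⟩
    obtain ⟨n', -, h2⟩ := htor' (a ^ i • Submodule.Quotient.mk (β ^ k * α ^ k))
    obtain ⟨j, hj, hj'⟩ := step b _ hi ⟨n', h2⟩
    refine ⟨_, hj, ?_, hj'⟩
    rw [smul_comm, hi', smul_zero]
  obtain ⟨m, hm, hma, hmb⟩ := hK2
  refine ⟨L ⧸ N, inferInstance, inferInstance, ?_, ?_, m, hm, hma, hmb, ?_, ?_⟩
  · intro m
    obtain ⟨l, rfl⟩ := Submodule.Quotient.mk_surjective N m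
    refine ⟨Submodule.Quotient.mk (α * l), 0, ?_⟩
    rw [smul_zero, add_zero, ← Submodule.Quotient.mk_smul, Algebra.smul_def, ← mul_assoc, ← hA, hα,
      one_mul]
  · intro x y h
    obtain ⟨x, rfl⟩ := Submodule.Quotient.mk_surjective N x
    obtain ⟨y, rfl⟩ := Submodule.Quotient.mk_surjective N y
    rw [← Submodule.Quotient.mk_smul, ← Submodule.Quotient.mk_smul, ← Submodule.Quotient.mk_add,
      Submodule.Quotient.mk_eq_zero] at h
    obtain ⟨f, hf, g, hg, hfg⟩ := Submodule.mem_sup.mp h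
    simp only [Algebra.smul_def, ← hA, ← hB] at hfg
    refine ⟨Submodule.Quotient.mk (α * (y - β * g)), ?_, ?_⟩
    · rw [← Submodule.Quotient.mk_smul, ← Submodule.Quotient.mk_neg, Submodule.Quotient.eq]
      refine Submodule.mem_sup_left ?_
      convert s13N_mul a α f hα hf using 1
      simp only [Algebra.smul_def, ← hB]
      linear_combination (- x) * hα - α * hfg - α * g * hβ
    · rw [← Submodule.Quotient.mk_smul, Submodule.Quotient.eq]
      refine Submodule.mem_sup_right ?_
      convert s13N_mul b β g hβ hg using 1
      simp only [Algebra.smul_def, ← hA]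
      linear_combination (- (y - β * g)) * hα
  · exact
      { toFun := fun z => N.mapQ N _ (hpres z)
        map_add' := by
          intro z w
          ext l
          simp [← Submodule.Quotient.mk_add, add_mul, mul_assoc]
        map_smul' := by
          intro r z
          ext l
          simp [← Submodule.Quotient.mk_smul, Algebra.smul_def, mul_assoc] }
  · intro z h1 h2
    obtain ⟨l, rfl⟩ := Submodule.Quotient.mk_surjective N m
    simp [h2, ← hA, ← mul_assoc, hα]

open TensorProduct in
theorem s13_tensor_M {R : Type u} [CommRing R] {M : Type u} [AddCommGroup M] [Module R M]
    (a b : R) (I : Ideal R) (hI : I = Ideal.span {a, b})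
    (hK0 : ∀ m : M, ∃ x y : M, m = a • x + b • y)
    (hK1 : ∀ x y : M, a • x + b • y = 0 → ∃ m : M, x = - (b • m) ∧ y = a • m) :
    Subsingleton ((R ⧸ I) ⊗[R] M) ∧ Function.Injective (LinearMap.rTensor M I.subtype) := by
  have haI : a ∈ I := by rw [hI]; exact Ideal.subset_span (by simp)
  have hbI : b ∈ I := by rw [hI]; exact Ideal.subset_span (by simp)
  constructor
  · refine subsingleton_of_forall_eq 0 fun t => ?_
    induction t with
    | zero => rfl
    | add x y hx hy => rw [hx, hy, add_zero]
    | tmul r m =>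
      obtain ⟨x, y, rfl⟩ := hK0 m
      have h : ∀ c ∈ I, c • r = 0 := by
        intro c hc
        obtain ⟨r, rfl⟩ := Ideal.Quotient.mk_surjective r
        rw [Algebra.smul_def, Ideal.Quotient.algebraMap_eq, Ideal.Quotient.eq_zero_iff_mem.mpr hc,
          zero_mul]
      rw [tmul_add, ← smul_tmul, ← smul_tmul, h a haI, h b hbI]
      simp
  · rw [← LinearMap.ker_eq_bot, LinearMap.ker_eq_bot']
    have hrep : ∀ t : I ⊗[R] M, ∃ x y : M, t = (⟨a, haI⟩ : I) ⊗ₜ x + (⟨b, hbI⟩ : I) ⊗ₜ y := by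
      intro t
      induction t with
      | zero => exact ⟨0, 0, by simp⟩
      | add s t hs ht =>
        obtain ⟨x, y, rfl⟩ := hs
        obtain ⟨x', y', rfl⟩ := ht
        exact ⟨x + x', y + y', by simp only [tmul_add]; abel⟩
      | tmul r m =>
        obtain ⟨r, hr⟩ := r
        obtain ⟨c, d, h⟩ := Ideal.mem_span_pair.mp (hI ▸ hr)
        refine ⟨c • m, d • m, ?_⟩
        rw [← smul_tmul, ← smul_tmul, ← add_tmul]
        congr 1
        ext
        simp [h]
    intro t ht
    obtain ⟨x, y, rfl⟩ := hrep t
    have h0 : a • x + b • y = 0 := by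
      have := congrArg (TensorProduct.lid R M) ht
      simpa using this
    obtain ⟨m, rfl, rfl⟩ := hK1 x y h0
    rw [tmul_neg, ← smul_tmul, ← smul_tmul]
    have : b • (⟨a, haI⟩ : I) = a • (⟨b, hbI⟩ : I) := by ext; simp [mul_comm]
    rw [this]; simp

open TensorProduct in
theorem s13_tensor_M2 {R : Type u} [CommRing R] {M : Type u} [AddCommGroup M] [Module R M]
    (a b : R) (m : M) (hm : m ≠ 0) (ha : a • m = 0) (hb : b • m = 0)
    (β : LinearMap.ker (s13d a b) →ₗ[R] M →ₗ[R] M)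
    (hβ : ∀ z, z.1.1 = - b → z.1.2 = a → β z m = m) :
    ¬ Function.Injective (LinearMap.rTensor M (LinearMap.ker (s13d a b)).subtype) := by
  intro hinj
  let z : LinearMap.ker (s13d a b) := ⟨(-b, a), by rw [LinearMap.mem_ker, s13d_apply]; ring⟩
  have h0 : z ⊗ₜ[R] m = 0 := by
    apply hinj
    rw [map_zero, LinearMap.rTensor_tmul]
    have : (LinearMap.ker (s13d a b)).subtype z = b • (-1, (0 : R)) + a • ((0 : R), 1) := by
      simp [z]
    rw [this, add_tmul, smul_tmul, smul_tmul, ha, hb]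
    simp
  have := congrArg (TensorProduct.lift β) h0
  rw [TensorProduct.lift.tmul, hβ z rfl rfl, map_zero] at this
  exact hm this

open TensorProduct in
theorem s13_tensor_back {R : Type u} [CommRing R] {M : Type u} [AddCommGroup M] [Module R M]
    (a b : R) (I : Ideal R) (hI : I = Ideal.span {a, b}) (p : R × R →ₗ[R] I)
    (hp : ∀ z, (p z : R) = s13d a b z)
    (h0 : Subsingleton ((R ⧸ I) ⊗[R] M)) (h1 : Function.Injective (LinearMap.rTensor M I.subtype))
    (h2 : ¬ Function.Injective (LinearMap.rTensor M (LinearMap.ker (s13d a b)).subtype)) :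
    (∀ x y : M, a • x + b • y = 0 → ∃ m : M, x = - (b • m) ∧ y = a • m) ∧
      ∃ m : M, m ≠ 0 ∧ a • m = 0 ∧ b • m = 0 := by
  have hK0 : ∀ m : M, ∃ x y : M, m = a • x + b • y := by
    have e := (TensorProduct.quotTensorEquivQuotSMul M I).symm.subsingleton
    have ht : I • (⊤ : Submodule R M) = ⊤ := Submodule.Quotient.subsingleton_iff.mp e
    intro m
    have hm : m ∈ I • (⊤ : Submodule R M) := by rw [ht]; exact Submodule.mem_top
    refine Submodule.smul_induction_on hm ?_ ?_
    · intro r hr n _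
      obtain ⟨c, d, rfl⟩ := Ideal.mem_span_pair.mp (hI ▸ hr)
      exact ⟨c • n, d • n, by rw [add_smul, smul_smul, smul_smul, mul_comm a, mul_comm b]⟩
    · rintro _ _ ⟨x, y, rfl⟩ ⟨x', y', rfl⟩
      exact ⟨x + x', y + y', by simp only [smul_add]; abel⟩
  let z0 : LinearMap.ker (s13d a b) := ⟨(-b, a), by rw [LinearMap.mem_ker, s13d_apply]; ring⟩
  have hrep : ∀ t : LinearMap.ker (s13d a b) ⊗[R] M, ∃ m, t = z0 ⊗ₜ m := by
    intro t
    induction t with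
    | zero => exact ⟨0, by simp⟩
    | add s t hs ht =>
      obtain ⟨x, rfl⟩ := hs
      obtain ⟨y, rfl⟩ := ht
      exact ⟨x + y, by rw [tmul_add]⟩
    | tmul z m =>
      obtain ⟨x, y, rfl⟩ := hK0 m
      have hz := LinearMap.mem_ker.mp z.2
      rw [s13d_apply] at hz
      have e1 : a • z = z.1.2 • z0 := by
        ext
        · simp [z0]; linear_combination hz
        · simp [z0, mul_comm]
      have e2 : b • z = (- z.1.1) • z0 := by
        ext
        · simp [z0, mul_comm]
        · simp [z0]; linear_combination hz
      refine ⟨z.1.2 • x + (- z.1.1) • y, ?_⟩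
      rw [tmul_add, tmul_add, ← smul_tmul, ← smul_tmul, ← smul_tmul, ← smul_tmul, e1, e2]
  have himg : ∀ m : M, LinearMap.rTensor M (LinearMap.ker (s13d a b)).subtype (z0 ⊗ₜ m)
      = (1, (0 : R)) ⊗ₜ (- (b • m)) + ((0 : R), (1 : R)) ⊗ₜ (a • m) := by
    intro m
    rw [LinearMap.rTensor_tmul, tmul_neg, ← smul_tmul, ← smul_tmul, ← neg_tmul, ← add_tmul]
    congr 1
    simp [z0]
  let fst : (R × R) ⊗[R] M →ₗ[R] M := TensorProduct.lid R M ∘ₗ LinearMap.rTensor M (LinearMap.fst R R R)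
  let snd : (R × R) ⊗[R] M →ₗ[R] M := TensorProduct.lid R M ∘ₗ LinearMap.rTensor M (LinearMap.snd R R R)
  constructor
  · intro x y h
    have hps : Function.Surjective p := by
      rintro ⟨r, hr⟩
      obtain ⟨c, d, rfl⟩ := Ideal.mem_span_pair.mp (hI ▸ hr)
      exact ⟨(c, d), by ext; rw [hp, s13d_apply]; ring⟩
    have hex : Function.Exact (LinearMap.ker (s13d a b)).subtype p := by
      intro z
      rw [Submodule.coe_subtype, Subtype.range_coe]
      change _ ↔ z ∈ LinearMap.ker _
      rw [LinearMap.mem_ker, ← hp]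
      simp
    have hex' := rTensor_exact M hex hps
    have h3 : LinearMap.rTensor M p ((1, (0 : R)) ⊗ₜ x + ((0 : R), (1 : R)) ⊗ₜ y) = 0 := by
      apply h1
      apply (TensorProduct.lid R M).injective
      simp [hp, s13d_apply, h]
    obtain ⟨t, ht⟩ := (hex' _).mp h3
    obtain ⟨m, rfl⟩ := hrep t
    rw [himg] at ht
    refine ⟨m, ?_, ?_⟩
    · simpa [fst] using (congrArg fst ht).symm
    · simpa [snd] using (congrArg snd ht).symm
  · by_contra hcon
    push Not at hcon
    apply h2
    refine (injective_iff_map_eq_zero _).mpr ?_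
    intro t ht
    obtain ⟨m, rfl⟩ := hrep t
    rw [himg] at ht
    by_cases hm : m = 0
    · simp [hm]
    · exfalso
      refine hcon m hm ?_ ?_
      · simpa [snd] using (congrArg snd ht)
      · simpa [fst] using (congrArg fst ht)

open TensorProduct in
theorem s13_chase {R : Type u} [CommRing R] {A F B P2 P1 P0 P' : Type u}
    [AddCommGroup A] [AddCommGroup F] [AddCommGroup B] [AddCommGroup P2] [AddCommGroup P1]
    [AddCommGroup P0] [AddCommGroup P'] [Module R A] [Module R F] [Module R B] [Module R P2]
    [Module R P1] [Module R P0] [Module R P'] (ι : A →ₗ[R] F) (π : F →ₗ[R] B)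
    (hι : Function.Injective ι) (hπ : Function.Surjective π) (hex : Function.Exact ι π)
    [Module.Flat R F] [Module.Flat R P0] (d2 : P2 →ₗ[R] P1) (d1 : P1 →ₗ[R] P0) (d0 : P0 →ₗ[R] P')
    (h21 : Function.Exact d2 d1) (h10 : Function.Exact d1 d0) :
    Function.Exact (d2.lTensor B) (d1.lTensor B) ↔
      ∀ t : A ⊗[R] P0, (d0.lTensor F) (ι.rTensor P0 t) = 0 → t ∈ Set.range (d1.lTensor A) := by
  have comm : ∀ {X Y S T : Type u} [AddCommGroup X] [AddCommGroup Y] [AddCommGroup S]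
      [AddCommGroup T] [Module R X] [Module R Y] [Module R S] [Module R T]
      (f : X →ₗ[R] Y) (g : S →ₗ[R] T) (t : X ⊗[R] S),
      f.rTensor T (g.lTensor X t) = g.lTensor Y (f.rTensor S t) := by
    intro X Y S T _ _ _ _ _ _ _ _ f g t
    rw [← LinearMap.comp_apply, ← LinearMap.comp_apply, LinearMap.rTensor_comp_lTensor,
      LinearMap.lTensor_comp_rTensor]
  have F21 := Module.Flat.lTensor_exact F h21
  have F10 := Module.Flat.lTensor_exact F h10
  have E1 := rTensor_exact P1 hex hπ
  have E0 := rTensor_exact P0 hex hπ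
  have S1 := LinearMap.rTensor_surjective P1 hπ
  have S2 := LinearMap.rTensor_surjective P2 hπ
  have i0 := Module.Flat.rTensor_preserves_injective_linearMap (M := P0) ι hι
  constructor
  · intro hB t ht
    obtain ⟨f1, hf1⟩ := (F10 _).mp ht
    have h1 : d1.lTensor B (π.rTensor P1 f1) = 0 := by
      rw [← comm, hf1]; exact E0.apply_apply_eq_zero t
    obtain ⟨b2, hb2⟩ := (hB _).mp h1
    obtain ⟨f2, rfl⟩ := S2 b2
    have h2 : π.rTensor P1 (f1 - d2.lTensor F f2) = 0 := by
      rw [map_sub, comm, hb2, sub_self]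
    obtain ⟨a1, ha1⟩ := (E1 _).mp h2
    refine ⟨a1, i0 ?_⟩
    rw [comm, ha1, map_sub, hf1, F21.apply_apply_eq_zero, sub_zero]
  · intro hA b1
    constructor
    · intro hb1
      obtain ⟨f1, rfl⟩ := S1 b1
      rw [← comm] at hb1
      obtain ⟨t, ht⟩ := (E0 _).mp hb1
      obtain ⟨a1, rfl⟩ := hA t (by rw [ht]; exact F10.apply_apply_eq_zero f1)
      rw [comm] at ht
      obtain ⟨f2, hf2⟩ := (F21 (f1 - ι.rTensor P1 a1)).mp (by rw [map_sub, ht, sub_self])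
      refine ⟨π.rTensor P2 f2, ?_⟩
      rw [← comm, hf2, map_sub, E1.apply_apply_eq_zero, sub_zero]
    · rintro ⟨b2, rfl⟩
      rw [← LinearMap.comp_apply, ← LinearMap.lTensor_comp, h21.linearMap_comp_eq_zero]
      simp

open TensorProduct in
theorem s13_chaseM {R : Type u} [CommRing R] {A F B P2 P1 P0 P' : Type u}
    [AddCommGroup A] [AddCommGroup F] [AddCommGroup B] [AddCommGroup P2] [AddCommGroup P1]
    [AddCommGroup P0] [AddCommGroup P'] [Module R A] [Module R F] [Module R B] [Module R P2]
    [Module R P1] [Module R P0] [Module R P'] (ι : A →ₗ[R] F) (π : F →ₗ[R] B)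
    (hι : Function.Injective ι) (hπ : Function.Surjective π) (hex : Function.Exact ι π)
    [Module.Flat R F] [Module.Flat R P0] (d2 : P2 →ₗ[R] P1) (d1 : P1 →ₗ[R] P0) (d0 : P0 →ₗ[R] P')
    (h21 : Function.Exact d2 d1) (h10 : Function.Exact d1 d0) (hs : Function.Surjective d0) :
    Function.Exact (d2.lTensor B) (d1.lTensor B) ↔ Function.Injective (ι.rTensor P') := by
  rw [s13_chase ι π hι hπ hex d2 d1 d0 h21 h10]
  have comm : ∀ t : A ⊗[R] P0, d0.lTensor F (ι.rTensor P0 t) = ι.rTensor P' (d0.lTensor A t) := by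
    intro t
    rw [← LinearMap.comp_apply, ← LinearMap.comp_apply, LinearMap.rTensor_comp_lTensor,
      LinearMap.lTensor_comp_rTensor]
  have E := lTensor_exact A h10 hs
  have S := LinearMap.lTensor_surjective A hs
  constructor
  · intro h
    refine (injective_iff_map_eq_zero _).mpr ?_
    intro x hx
    obtain ⟨t, rfl⟩ := S x
    exact (E _).mpr (h t (by rw [comm, hx]))
  · intro h t ht
    rw [comm] at ht
    exact (E t).mp (h (by rw [ht, map_zero]))

open TensorProduct in
theorem s13_chaseF {R : Type u} [CommRing R] {A F B P2 P1 P0 P' : Type u}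
    [AddCommGroup A] [AddCommGroup F] [AddCommGroup B] [AddCommGroup P2] [AddCommGroup P1]
    [AddCommGroup P0] [AddCommGroup P'] [Module R A] [Module R F] [Module R B] [Module R P2]
    [Module R P1] [Module R P0] [Module R P'] (ι : A →ₗ[R] F) (π : F →ₗ[R] B)
    (hι : Function.Injective ι) (hπ : Function.Surjective π) (hex : Function.Exact ι π)
    [Module.Flat R F] [Module.Flat R P0] [Module.Flat R P']
    (d2 : P2 →ₗ[R] P1) (d1 : P1 →ₗ[R] P0) (d0 : P0 →ₗ[R] P')
    (h21 : Function.Exact d2 d1) (h10 : Function.Exact d1 d0) :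
    Function.Exact (d2.lTensor B) (d1.lTensor B) ↔
      Function.Exact (d1.lTensor A) (d0.lTensor A) := by
  rw [s13_chase ι π hι hπ hex d2 d1 d0 h21 h10]
  have comm : ∀ t : A ⊗[R] P0, d0.lTensor F (ι.rTensor P0 t) = ι.rTensor P' (d0.lTensor A t) := by
    intro t
    rw [← LinearMap.comp_apply, ← LinearMap.comp_apply, LinearMap.rTensor_comp_lTensor,
      LinearMap.lTensor_comp_rTensor]
  have i0 := Module.Flat.rTensor_preserves_injective_linearMap (M := P') ι hι
  constructor
  · intro h t
    refine ⟨fun ht => h t (by rw [comm, ht, map_zero]), ?_⟩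
    rintro ⟨s, rfl⟩
    rw [← LinearMap.comp_apply, ← LinearMap.lTensor_comp, h10.linearMap_comp_eq_zero]
    simp
  · intro h t ht
    rw [comm] at ht
    exact (h t).mp (i0 (by rw [ht, map_zero]))

theorem s13_res_exact {R : Type u} [CommRing R] {M : ModuleCat.{u} R} (P : ProjectiveResolution M)
    (i : ℕ) : Function.Exact (P.complex.d (i + 2) (i + 1)).hom (P.complex.d (i + 1) i).hom := by
  have := P.exact_succ i
  exact (ShortComplex.ShortExact.moduleCat_exact_iff_function_exact _).mp this

theorem s13_res_exact0 {R : Type u} [CommRing R] {M : ModuleCat.{u} R} (P : ProjectiveResolution M) :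
    Function.Exact (P.complex.d 1 0).hom (P.π.f 0).hom := by
  have := P.exact₀
  exact (ShortComplex.ShortExact.moduleCat_exact_iff_function_exact _).mp this

theorem s13_res_surj {R : Type u} [CommRing R] {M : ModuleCat.{u} R} (P : ProjectiveResolution M) :
    Function.Surjective (P.π.f 0).hom := by
  have : Epi (P.π.f 0) := inferInstance
  exact (ModuleCat.epi_iff_surjective _).mp this

instance s13_res_proj {R : Type u} [CommRing R] {M : ModuleCat.{u} R} (P : ProjectiveResolution M)
    (i : ℕ) : Module.Projective R (P.complex.X i) :=
  (IsProjective.iff_projective _).mpr (P.projective i)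

theorem s13_tor_iff {R : Type u} [CommRing R] {M : ModuleCat.{u} R} (P : ProjectiveResolution M)
    (A : ModuleCat.{u} R) (i : ℕ) : Subsingleton (TorMod R (i + 1) A M) ↔
      Function.Exact ((P.complex.d (i + 2) (i + 1)).hom.lTensor A)
        ((P.complex.d (i + 1) i).hom.lTensor A) := by
  rw [← ModuleCat.isZero_iff_subsingleton]
  let F := (MonoidalCategory.tensoringLeft (ModuleCat.{u} R)).obj A
  let K := (F.mapHomologicalComplex (ComplexShape.down ℕ)).obj P.complex
  have h1 : Limits.IsZero (TorMod R (i + 1) A M) ↔ Limits.IsZero (K.homology (i + 1)) :=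
    (P.isoLeftDerivedObj F (i + 1)).isZero_iff
  rw [h1, ← HomologicalComplex.exactAt_iff_isZero_homology,
    HomologicalComplex.exactAt_iff' K (i + 2) (i + 1) i (by simp) (by simp)]
  exact ShortComplex.ShortExact.moduleCat_exact_iff_function_exact _

theorem s13_tor0 {R : Type u} [CommRing R] (A M : ModuleCat.{u} R) :
    Subsingleton (TorMod R 0 A M) ↔ Subsingleton (TensorProduct R A M) := by
  let F := (MonoidalCategory.tensoringLeft (ModuleCat.{u} R)).obj A
  have : (F.leftDerived 0).obj M ≅ F.obj M := F.leftDerivedZeroIsoSelf.app M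
  exact this.toLinearEquiv.toEquiv.subsingleton_congr

theorem s13_tor12 {R : Type u} [CommRing R] (a b : R) (I : Ideal R) (hI : I = Ideal.span {a, b})
    (M : ModuleCat.{u} R) (p : R × R →ₗ[R] I) (hp : ∀ z, (p z : R) = s13d a b z) :
    (Subsingleton (TorMod R 1 (ModuleCat.of R (R ⧸ I)) M) ↔
      Function.Injective (LinearMap.rTensor M I.subtype)) ∧
    (Subsingleton (TorMod R 2 (ModuleCat.of R (R ⧸ I)) M) ↔
      Function.Injective (LinearMap.rTensor M (LinearMap.ker (s13d a b)).subtype)) := by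
  let P := projectiveResolution M
  have hps : Function.Surjective p := by
    rintro ⟨r, hr⟩
    obtain ⟨c, d, rfl⟩ := Ideal.mem_span_pair.mp (hI ▸ hr)
    exact ⟨(c, d), by ext; rw [hp, s13d_apply]; ring⟩
  have hex : Function.Exact (LinearMap.ker (s13d a b)).subtype p := by
    intro z
    rw [Submodule.coe_subtype, Subtype.range_coe]
    change _ ↔ z ∈ LinearMap.ker _
    rw [LinearMap.mem_ker, ← hp]
    simp
  have hexI : Function.Exact I.subtype (Submodule.mkQ I) := LinearMap.exact_subtype_mkQ I
  have hsI : Function.Surjective (Submodule.mkQ I) := Submodule.mkQ_surjective I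
  constructor
  · rw [s13_tor_iff P]
    exact s13_chaseM I.subtype (Submodule.mkQ I) (Submodule.injective_subtype I) hsI hexI _ _ _
      (s13_res_exact P 0) (s13_res_exact0 P) (s13_res_surj P)
  · rw [s13_tor_iff P]
    refine (s13_chaseF I.subtype (Submodule.mkQ I) (Submodule.injective_subtype I) hsI hexI _ _ _
      (s13_res_exact P 1) (s13_res_exact P 0)).trans ?_
    exact s13_chaseM _ p (Submodule.injective_subtype _) hps hex _ _ _
      (s13_res_exact P 0) (s13_res_exact0 P) (s13_res_surj P)

def s13tr {R : Type u} [CommRing R] (I : Ideal R) {n m : ℕ} (h : n ≤ m) :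
    ModuleCat.of R (R ⧸ I ^ m) ⟶ ModuleCat.of R (R ⧸ I ^ n) :=
  ModuleCat.ofHom (Submodule.mapQ _ _ LinearMap.id (Ideal.pow_le_pow_right h))

theorem s13_colim {R : Type u} [CommRing R] {J : Type} [SmallCategory J] [IsFiltered J]
    (G : J ⥤ ModuleCat.{u} R) (c : Limits.Cocone G) (hc : Limits.IsColimit c) :
    Subsingleton c.pt ↔ ∀ (j : J) (x : G.obj j), ∃ (k : J) (f : j ⟶ k), (G.map f).hom x = 0 := by
  have := Limits.preservesFilteredColimitsOfSize_shrink.{0, u, 0, u} (forget (ModuleCat.{u} R))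
  constructor
  · intro hs n x
    have h1 : (c.ι.app n).hom x = (c.ι.app n).hom 0 := hs.elim _ _
    obtain ⟨k, f, g, hfg⟩ := Limits.Concrete.isColimit_exists_of_rep_eq G hc x 0 h1
    refine ⟨k, f, ?_⟩
    rw [map_zero] at hfg
    exact hfg
  · intro h
    refine subsingleton_of_forall_eq 0 ?_
    intro y
    obtain ⟨j, x, rfl⟩ := Limits.Concrete.isColimit_exists_rep G hc y
    obtain ⟨k, f, hx⟩ := h j x
    have h2 : (c.ι.app k).hom ((G.map f).hom x) = (c.ι.app j).hom x := by
      rw [← c.w f]; rfl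
    have h3 := h2.symm
    rw [hx, map_zero] at h3
    exact h3

theorem s13_LC_iff {R : Type u} [CommRing R] (I : Ideal R) (i : ℕ) (M : ModuleCat.{u} R) :
    Subsingleton (LC R I i M) ↔
      ∀ (n : ℕ) (x : ((Ext R (ModuleCat.{u} R) i).obj
        (Opposite.op (ModuleCat.of R (R ⧸ I ^ n)))).obj M),
        ∃ (m : ℕ) (h : n ≤ m),
          (((Ext R (ModuleCat.{u} R) i).map (s13tr I h).op).app M).hom x = 0 := by
  have : Limits.HasColimit (localCohomology.diagram (localCohomology.idealPowersDiagram I) i) :=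
    localCohomology.hasColimitDiagram.{u, 0} _ i
  have key := s13_colim _ _ (Limits.isColimitOfPreserves
    ((evaluation (ModuleCat.{u} R) (ModuleCat.{u} R)).obj M)
    (Limits.colimit.isColimit (localCohomology.diagram (localCohomology.idealPowersDiagram I) i)))
  refine Iff.trans key ?_
  constructor
  · intro h n x
    obtain ⟨k, f, hf⟩ := h (Opposite.op (Opposite.op n)) x
    exact ⟨k.unop.unop, f.unop.unop.down.down, hf⟩
  · intro h j x
    obtain ⟨m, hm, hx⟩ := h j.unop.unop x
    exact ⟨Opposite.op (Opposite.op m), (homOfLE hm).op.op, hx⟩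

def s13ym {R : Type u} [CommRing R] {K L : ChainComplex (ModuleCat.{u} R) ℕ} (g : K ⟶ L)
    (Y : ModuleCat.{u} R) : L.linearYonedaObj R Y ⟶ K.linearYonedaObj R Y :=
  (HomologicalComplex.unopFunctor _ _).map
    (((((linearYoneda R (ModuleCat.{u} R)).obj Y).rightOp.mapHomologicalComplex _).map g).op)

theorem s13_sq {C : Type*} [Category C] {UP UQ EP EQ HP HQ : C} (p : UP ≅ EP) (q : UQ ≅ EQ)
    (r : HP ≅ UP) (s : HQ ≅ UQ) (e : EP ⟶ EQ) (H : UP ⟶ UQ) (hm : HP ⟶ HQ)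
    (h1 : p.hom ≫ e = H ≫ q.hom) (h2 : hm ≫ s.hom = r.hom ≫ H) :
    e ≫ (q.symm ≪≫ s.symm).hom = (p.symm ≪≫ r.symm).hom ≫ hm := by
  have h3 : H = r.inv ≫ hm ≫ s.hom := by rw [h2]; simp
  have h4 : e = p.inv ≫ H ≫ q.hom := by rw [← h1]; simp
  rw [h4, h3]
  simp

theorem s13_ext_nat {R : Type u} [CommRing R] {X X' : ModuleCat.{u} R} (P : ProjectiveResolution X)
    (Q : ProjectiveResolution X') (f : X' ⟶ X) (g : Q.complex ⟶ P.complex)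
    (comm : g.f 0 ≫ P.π.f 0 = Q.π.f 0 ≫ f) (Y : ModuleCat.{u} R) (n : ℕ) :
    ((Ext R (ModuleCat.{u} R) n).map f.op).app Y ≫ (Q.isoExt n Y).hom =
      (P.isoExt n Y).hom ≫ HomologicalComplex.homologyMap (s13ym g Y) n := by
  have h1 := congrArg Quiver.Hom.unop (ProjectiveResolution.isoLeftDerivedObj_hom_naturality f Q P g comm
    (((linearYoneda R (ModuleCat.{u} R)).obj Y).rightOp) n)
  have h2 := congrArg Quiver.Hom.unop
    (HomologicalComplex.homologyOp_hom_naturality (s13ym g Y) n)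
  exact s13_sq (P.isoLeftDerivedObj (((linearYoneda R (ModuleCat.{u} R)).obj Y).rightOp) n).unop
    (Q.isoLeftDerivedObj (((linearYoneda R (ModuleCat.{u} R)).obj Y).rightOp) n).unop
    (HomologicalComplex.homologyUnop _ _) (HomologicalComplex.homologyUnop _ _) _ _ _ h1 h2.symm

theorem s13_hπ {R : Type u} [CommRing R] (K : CochainComplex (ModuleCat.{u} R) ℕ) (j : ℕ) :
    (∀ x : K.homology (j+1), ∃ z : K.cycles (j+1), (K.homologyπ (j+1)).hom z = x) ∧
    (∀ z : K.cycles (j+1), (K.homologyπ (j+1)).hom z = 0 →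
      ∃ w : K.X j, (K.d j (j+1)).hom w = (K.iCycles (j+1)).hom z) ∧
    (∀ (z : K.cycles (j+1)) (w : K.X j), (K.d j (j+1)).hom w = (K.iCycles (j+1)).hom z →
      (K.homologyπ (j+1)).hom z = 0) ∧
    (∀ y : K.X (j+1), (K.d (j+1) (j+2)).hom y = 0 → ∃ z : K.cycles (j+1),
      (K.iCycles (j+1)).hom z = y) ∧
    (∀ z : K.cycles (j+1), (K.d (j+1) (j+2)).hom ((K.iCycles (j+1)).hom z) = 0) := by
  have e1 := (ShortComplex.ShortExact.moduleCat_exact_iff_function_exact _).mp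
    (ShortComplex.exact_of_g_is_cokernel
      (ShortComplex.mk (K.toCycles j (j+1)) (K.homologyπ (j+1)) (by simp))
      (K.homologyIsCokernel j (j+1) (by simp)))
  have e2 := (ShortComplex.ShortExact.moduleCat_exact_iff_function_exact _).mp
    (ShortComplex.exact_of_f_is_kernel
      (ShortComplex.mk (K.iCycles (j+1)) (K.d (j+1) (j+2)) (by simp))
      (K.cyclesIsKernel (j+1) (j+2) (by simp)))
  have hi : Function.Injective (K.iCycles (j+1)).hom :=
    (ModuleCat.mono_iff_injective _).mp inferInstance
  have hd : ∀ w, (K.iCycles (j+1)).hom ((K.toCycles j (j+1)).hom w) = (K.d j (j+1)).hom w := by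
    intro w
    rw [← K.toCycles_i j (j+1)]; rfl
  refine ⟨(ModuleCat.epi_iff_surjective _).mp inferInstance, ?_, ?_, ?_, ?_⟩
  · intro z hz
    obtain ⟨w, hw⟩ := (e1 z).mp hz
    refine ⟨w, ?_⟩
    rw [← hd]
    exact congrArg _ hw
  · intro z w h
    refine (e1 z).mpr ⟨w, hi ?_⟩
    rw [← h, ← hd]
  · intro y hy
    exact (e2 y).mp hy
  · intro z
    exact (e2 _).mpr ⟨z, rfl⟩

theorem s13_hmap {R : Type u} [CommRing R] {K L : CochainComplex (ModuleCat.{u} R) ℕ} (φ : K ⟶ L)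
    (j : ℕ) (z : K.cycles (j+1)) :
    (HomologicalComplex.homologyMap φ (j+1)).hom ((K.homologyπ (j+1)).hom z) = 0 ↔
      ∃ w : L.X j, (L.d j (j+1)).hom w = (φ.f (j+1)).hom ((K.iCycles (j+1)).hom z) := by
  obtain ⟨-, h2, h3, -, -⟩ := s13_hπ L j
  have e1 : (HomologicalComplex.homologyMap φ (j+1)).hom ((K.homologyπ (j+1)).hom z) =
      (L.homologyπ (j+1)).hom ((HomologicalComplex.cyclesMap φ (j+1)).hom z) := by
    have := HomologicalComplex.homologyπ_naturality φ (j+1)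
    exact congrArg (fun t => t.hom z) this
  have e2 : (L.iCycles (j+1)).hom ((HomologicalComplex.cyclesMap φ (j+1)).hom z) =
      (φ.f (j+1)).hom ((K.iCycles (j+1)).hom z) := by
    have := HomologicalComplex.cyclesMap_i φ (j+1)
    exact congrArg (fun t => t.hom z) this
  rw [e1, ← e2]
  exact ⟨h2 _, fun ⟨w, hw⟩ => h3 _ w hw⟩

theorem s13_ext_map_zero {R : Type u} [CommRing R] {X X' : ModuleCat.{u} R}
    (P : ProjectiveResolution X)
    (Q : ProjectiveResolution X') (f : X' ⟶ X) (g : Q.complex ⟶ P.complex)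
    (comm : g.f 0 ≫ P.π.f 0 = Q.π.f 0 ≫ f) (Y : ModuleCat.{u} R) (n : ℕ)
    (x : ((Ext R (ModuleCat.{u} R) n).obj (Opposite.op X)).obj Y) :
    (((Ext R (ModuleCat.{u} R) n).map f.op).app Y).hom x = 0 ↔
    (HomologicalComplex.homologyMap (s13ym g Y) n).hom ((P.isoExt n Y).hom.hom x) = 0 := by
  have h := congrArg (fun t => t.hom x) (s13_ext_nat P Q f g comm Y n)
  have h' : (Q.isoExt n Y).hom.hom ((((Ext R (ModuleCat.{u} R) n).map f.op).app Y).hom x) =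
    (HomologicalComplex.homologyMap (s13ym g Y) n).hom ((P.isoExt n Y).hom.hom x) := h
  rw [← h']
  constructor
  · intro h0
    rw [h0, map_zero]
  · intro h0
    have hi : Function.Injective (Q.isoExt (R := R) n Y).hom.hom :=
      (ModuleCat.mono_iff_injective _).mp inferInstance
    exact hi (by rw [h0, map_zero])

theorem s13_ext_zero {R : Type u} [CommRing R] {X X' : ModuleCat.{u} R} (P : ProjectiveResolution X)
    (Q : ProjectiveResolution X') (f : X' ⟶ X) (g : Q.complex ⟶ P.complex)
    (comm : g.f 0 ≫ P.π.f 0 = Q.π.f 0 ≫ f) (Y : ModuleCat.{u} R) (j : ℕ)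
    (H : ∀ φ : P.complex.X (j+1) ⟶ Y, P.complex.d (j+2) (j+1) ≫ φ = 0 →
      ∃ ψ : Q.complex.X j ⟶ Y, Q.complex.d (j+1) j ≫ ψ = g.f (j+1) ≫ φ)
    (x : ((Ext R (ModuleCat.{u} R) (j+1)).obj (Opposite.op X)).obj Y) :
    (((Ext R (ModuleCat.{u} R) (j+1)).map f.op).app Y).hom x = 0 := by
  rw [s13_ext_map_zero P Q f g comm]
  obtain ⟨h1, -, -, -, h5⟩ := s13_hπ (P.complex.linearYonedaObj R Y) j
  obtain ⟨z, hz⟩ := h1 ((P.isoExt (j+1) Y).hom.hom x)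
  rw [← hz, s13_hmap]
  exact H _ (h5 z)

theorem s13_ext_cls {R : Type u} [CommRing R] {X : ModuleCat.{u} R} (P : ProjectiveResolution X)
    (Y : ModuleCat.{u} R) (j : ℕ)
    (φ : P.complex.X (j+1) ⟶ Y) (hφ : P.complex.d (j+2) (j+1) ≫ φ = 0) :
    ∃ x : ((Ext R (ModuleCat.{u} R) (j+1)).obj (Opposite.op X)).obj Y,
      ∀ (X' : ModuleCat.{u} R) (Q : ProjectiveResolution X') (f : X' ⟶ X)
        (g : Q.complex ⟶ P.complex) (_ : g.f 0 ≫ P.π.f 0 = Q.π.f 0 ≫ f),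
      (((Ext R (ModuleCat.{u} R) (j+1)).map f.op).app Y).hom x = 0 →
      ∃ ψ : Q.complex.X j ⟶ Y, Q.complex.d (j+1) j ≫ ψ = g.f (j+1) ≫ φ := by
  obtain ⟨-, -, -, h4, -⟩ := s13_hπ (P.complex.linearYonedaObj R Y) j
  obtain ⟨z, hz⟩ := h4 φ hφ
  refine ⟨(P.isoExt (j+1) Y).inv.hom (((P.complex.linearYonedaObj R Y).homologyπ (j+1)).hom z), ?_⟩
  intro X' Q f g comm h0
  rw [s13_ext_map_zero P Q f g comm] at h0
  have e : (P.isoExt (R := R) (j+1) Y).hom.hom ((P.isoExt (j+1) Y).inv.hom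
      (((P.complex.linearYonedaObj R Y).homologyπ (j+1)).hom z)) =
      (((P.complex.linearYonedaObj R Y).homologyπ (j+1)).hom z) := by
    exact congrArg (fun t => t.hom (((P.complex.linearYonedaObj R Y).homologyπ (j+1)).hom z)) (P.isoExt (R := R) (j+1) Y).inv_hom_id
  rw [e, s13_hmap] at h0
  obtain ⟨w, hw⟩ := h0
  refine ⟨w, ?_⟩
  rw [hz] at hw
  exact hw

def s13π {R : Type u} [CommRing R] {J : Ideal R}
    (P : ProjectiveResolution (ModuleCat.of R (R ⧸ J))) : P.complex.X 0 →ₗ[R] (R ⧸ J) :=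
  (P.π.f 0).hom

theorem s13_v {R : Type u} [CommRing R] {J : Ideal R} (a b : R) (ha : a ∈ J) (hb : b ∈ J)
    (P : ProjectiveResolution (ModuleCat.of R (R ⧸ J))) :
    ∃ (p0 : P.complex.X 0) (e1 e2 : P.complex.X 1) (p2 : P.complex.X 2),
      s13π P p0 = Ideal.Quotient.mk J 1 ∧ (P.complex.d 1 0).hom e1 = a • p0 ∧
      (P.complex.d 1 0).hom e2 = b • p0 ∧ (P.complex.d 2 1).hom p2 = a • e2 - b • e1 := by
  have hs : Function.Surjective (s13π P) := s13_res_surj P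
  have h0 : Function.Exact (P.complex.d 1 0).hom (s13π P) := s13_res_exact0 P
  have h1 := s13_res_exact P 0
  obtain ⟨p0, hp0⟩ := hs (Ideal.Quotient.mk J 1)
  have key : ∀ c ∈ J, s13π P (c • p0) = 0 := by
    intro c hc
    rw [map_smul, hp0]
    have : c • Ideal.Quotient.mk J 1 = Ideal.Quotient.mk J c := by
      rw [← mul_one c]; simp [Algebra.smul_def]
    rw [this]
    exact Ideal.Quotient.eq_zero_iff_mem.mpr hc
  obtain ⟨e1, he1⟩ := (h0 _).mp (key a ha)
  obtain ⟨e2, he2⟩ := (h0 _).mp (key b hb)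
  obtain ⟨p2, hp2⟩ := (h1 (a • e2 - b • e1)).mp (by
    have : (P.complex.d 1 0).hom (a • e2 - b • e1) = 0 := by
      rw [map_sub, map_smul, map_smul, he1, he2, smul_smul, smul_smul, mul_comm, sub_self]
    exact this)
  exact ⟨p0, e1, e2, p2, hp0, he1, he2, hp2⟩

theorem s13_u {R : Type u} [CommRing R] {J : Ideal R} (a b : R) (hJ : J ≤ Ideal.span {a, b})
    (P : ProjectiveResolution (ModuleCat.of R (R ⧸ J))) :
    ∃ (u0 : P.complex.X 0 →ₗ[R] R) (u1 : P.complex.X 1 →ₗ[R] R × R),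
      (∀ p, Ideal.Quotient.mk J (u0 p) = s13π P p) ∧
      (∀ p, s13d a b (u1 p) = u0 ((P.complex.d 1 0).hom p)) := by
  have h0 : Function.Exact (P.complex.d 1 0).hom (s13π P) := s13_res_exact0 P
  obtain ⟨u0, hu0⟩ := Module.projective_lifting_property (Submodule.mkQ J) (s13π P)
    (Submodule.mkQ_surjective J)
  have hu0' : ∀ p, Ideal.Quotient.mk J (u0 p) = s13π P p := fun p => LinearMap.congr_fun hu0 p
  have hr : ∀ p, u0 ((P.complex.d 1 0).hom p) ∈ LinearMap.range (s13d a b) := by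
    intro p
    have h1 : u0 ((P.complex.d 1 0).hom p) ∈ J := by
      rw [← Ideal.Quotient.eq_zero_iff_mem, hu0']
      exact h0.apply_apply_eq_zero p
    obtain ⟨x, y, hxy⟩ := Ideal.mem_span_pair.mp (hJ h1)
    refine ⟨(x, y), ?_⟩
    rw [s13d_apply, ← hxy]
    ring
  obtain ⟨u1, hu1⟩ := Module.projective_lifting_property (s13d a b).rangeRestrict
    (LinearMap.codRestrict _ (u0 ∘ₗ (P.complex.d 1 0).hom) hr) (s13d a b).surjective_rangeRestrict
  exact ⟨u0, u1, hu0', fun p => congrArg Subtype.val (LinearMap.congr_fun hu1 p)⟩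

theorem s13_mkhom {R : Type u} [CommRing R] (K L : ChainComplex (ModuleCat.{u} R) ℕ)
    (f0 : K.X 0 ⟶ L.X 0) (f1 : K.X 1 ⟶ L.X 1) (f2 : K.X 2 ⟶ L.X 2)
    (c1 : f1 ≫ L.d 1 0 = K.d 1 0 ≫ f0) (c2 : f2 ≫ L.d 2 1 = K.d 2 1 ≫ f1)
    (c3 : K.d 3 2 ≫ f2 = 0) :
    ∃ g : K ⟶ L, g.f 0 = f0 ∧ g.f 1 = f1 ∧ g.f 2 = f2 ∧ ∀ i, g.f (i+3) = 0 := by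
  let F : ∀ i, K.X i ⟶ L.X i := fun i => match i with
    | 0 => f0
    | 1 => f1
    | 2 => f2
    | _ + 3 => 0
  refine ⟨⟨F, ?_⟩, rfl, rfl, rfl, fun _ => rfl⟩
  rintro i j rfl
  match j with
  | 0 => exact c1
  | 1 => exact c2
  | 2 => 
    have : (0 : K.X 3 ⟶ L.X 3) ≫ L.d 3 2 = K.d 3 2 ≫ f2 := by rw [c3]; simp
    exact this
  | k + 3 =>
    have : (0 : K.X (k+4) ⟶ L.X (k+4)) ≫ L.d (k+4) (k+3) = K.d (k+4) (k+3) ≫ 0 := by simp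
    exact this

theorem s13_pow_le {R : Type u} [CommRing R] (a b : R) (I : Ideal R) (hI : I = Ideal.span {a, b})
    (m : ℕ) : I ^ (2 * m) ≤ Ideal.span {a ^ m, b ^ m} := by
  subst hI
  rw [Ideal.span_insert, Ideal.span_insert, ← Ideal.span_singleton_pow, ← Ideal.span_singleton_pow,
    two_mul]
  exact Ideal.sup_pow_add_le_pow_sup_pow

theorem s13_fmap {R : Type u} [CommRing R] [IsNoetherianRing R] (a b : R) (I : Ideal R)
    (hI : I = Ideal.span {a, b}) (n N : ℕ) :
    ∃ (q m : ℕ) (hm : n ≤ m), ∀ (P : ProjectiveResolution (ModuleCat.of R (R ⧸ I ^ n)))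
      (Q : ProjectiveResolution (ModuleCat.of R (R ⧸ I ^ m))),
      ∃ g : Q.complex ⟶ P.complex, g.f 0 ≫ P.π.f 0 = Q.π.f 0 ≫ s13tr I hm ∧
        (∀ i, g.f (i+3) = 0) ∧
        ∃ (p2 : P.complex.X 2) (u1 : Q.complex.X 1 →ₗ[R] R × R) (h : Q.complex.X 2 → R),
          ∀ t, (g.f 2).hom t = ((a*b)^N * h t) • p2 ∧
            a^q * (u1 ((Q.complex.d 2 1).hom t)).1 = -(b^(n+N) * h t) ∧
            b^q * (u1 ((Q.complex.d 2 1).hom t)).2 = a^(n+N) * h t := by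
  obtain ⟨q, h, h1, h2, -⟩ := s13_key a b (n+N)
  refine ⟨q, 2*(n+N+q), by lia, ?_⟩
  intro P Q
  have haI : a ∈ I := by rw [hI]; exact Ideal.subset_span (by simp)
  have hbI : b ∈ I := by rw [hI]; exact Ideal.subset_span (by simp)
  obtain ⟨p0, e1, e2, p2, hp0, he1, he2, hp2⟩ := s13_v (a^n) (b^n) (Ideal.pow_mem_pow haI n)
    (Ideal.pow_mem_pow hbI n) P
  obtain ⟨u0, u1, hu0, hu1⟩ := s13_u (a^(n+N+q)) (b^(n+N+q)) (s13_pow_le a b I hI _) Q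
  have hz : ∀ t, (u1 ∘ₗ (Q.complex.d 2 1).hom) t ∈
      LinearMap.ker (s13d (a^(n+N+q)) (b^(n+N+q))) := by
    intro t
    rw [LinearMap.mem_ker, LinearMap.comp_apply, hu1]
    have := (s13_res_exact Q 0).apply_apply_eq_zero t
    exact (congrArg u0 this).trans (map_zero u0)
  let z := LinearMap.codRestrict _ (u1 ∘ₗ (Q.complex.d 2 1).hom) hz
  have z1 : ∀ t, a^q * (u1 ((Q.complex.d 2 1).hom t)).1 = -(b^(n+N) * h (z t)) := fun t => h1 (z t)
  have z2 : ∀ t, b^q * (u1 ((Q.complex.d 2 1).hom t)).2 = a^(n+N) * h (z t) := fun t => h2 (z t)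
  let f0 : Q.complex.X 0 →ₗ[R] P.complex.X 0 := (LinearMap.toSpanSingleton R _ p0) ∘ₗ u0
  let f1 : Q.complex.X 1 →ₗ[R] P.complex.X 1 :=
    (LinearMap.toSpanSingleton R _ e1) ∘ₗ (a^(N+q) • (LinearMap.fst R R R ∘ₗ u1)) +
    (LinearMap.toSpanSingleton R _ e2) ∘ₗ (b^(N+q) • (LinearMap.snd R R R ∘ₗ u1))
  let f2 : Q.complex.X 2 →ₗ[R] P.complex.X 2 :=
    (LinearMap.toSpanSingleton R _ p2) ∘ₗ ((a*b)^N • (h ∘ₗ z))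
  have hf0 : ∀ t, f0 t = u0 t • p0 := fun t => rfl
  have hf1 : ∀ t, f1 t = (a^(N+q) * (u1 t).1) • e1 + (b^(N+q) * (u1 t).2) • e2 := fun t => rfl
  have hf2 : ∀ t, f2 t = ((a*b)^N * h (z t)) • p2 := fun t => rfl
  obtain ⟨g, g0, g1, g2, g3⟩ := s13_mkhom Q.complex P.complex (ModuleCat.ofHom f0)
    (ModuleCat.ofHom f1) (ModuleCat.ofHom f2) (by
      ext t
      have : (P.complex.d 1 0).hom (f1 t) = f0 ((Q.complex.d 1 0).hom t) := by
        rw [hf1, hf0, ← hu1, map_add, map_smul, map_smul, he1, he2, smul_smul, smul_smul,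
          ← add_smul, s13d_apply]
        congr 1
        ring
      exact this) (by
      ext t
      have : (P.complex.d 2 1).hom (f2 t) = f1 ((Q.complex.d 2 1).hom t) := by
        have E1 : a^(N+q) * (u1 ((Q.complex.d 2 1).hom t)).1 = -((a*b)^N * h (z t) * b^n) := by
          linear_combination a^N * z1 t
        have E2 : b^(N+q) * (u1 ((Q.complex.d 2 1).hom t)).2 = ((a*b)^N * h (z t) * a^n) := by
          linear_combination b^N * z2 t
        rw [hf1, hf2, E1, E2, map_smul, hp2, smul_sub, smul_smul, smul_smul, neg_smul]
        abel
      exact this) (by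
      ext t
      have : f2 ((Q.complex.d 3 2).hom t) = 0 := by
        have hd : (Q.complex.d 2 1).hom ((Q.complex.d 3 2).hom t) = 0 :=
          (s13_res_exact Q 1).apply_apply_eq_zero t
        have : z ((Q.complex.d 3 2).hom t) = 0 := by
          apply Subtype.ext
          change u1 ((Q.complex.d 2 1).hom ((Q.complex.d 3 2).hom t)) = 0
          rw [hd, map_zero]
        rw [hf2, this, map_zero, mul_zero, zero_smul]
      exact this)
  refine ⟨g, ?_, g3, p2, u1, fun t => h (z t), ?_⟩
  · rw [g0]
    ext t
    have : s13π P (f0 t) = (s13tr I (by lia : n ≤ 2*(n+N+q))).hom (s13π Q t) := by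
      rw [hf0, map_smul, hp0, ← hu0]
      have : u0 t • Ideal.Quotient.mk (I^n) 1 = Ideal.Quotient.mk (I^n) (u0 t) := by
        rw [← mul_one (u0 t)]; simp [Algebra.smul_def]
      rw [this]
      rfl
    exact this
  · intro t
    refine ⟨?_, z1 t, z2 t⟩
    rw [g2]
    rfl

theorem s13_C {R : Type u} [CommRing R] [IsNoetherianRing R] (a b : R) (I : Ideal R)
    (hI : I = Ideal.span {a, b}) (i : ℕ) (hi : 2 < i) :
    Subsingleton (LC R I i (ModuleCat.of R R)) := by
  obtain ⟨j, rfl⟩ : ∃ j, i = j + 3 := ⟨i - 3, by lia⟩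
  rw [s13_LC_iff]
  intro n x
  obtain ⟨q, m, hm, H⟩ := s13_fmap a b I hI n 0
  obtain ⟨g, comm, g3, -⟩ := H (projectiveResolution _) (projectiveResolution _)
  refine ⟨m, hm, ?_⟩
  refine s13_ext_zero _ _ _ g comm _ (j+2) ?_ x
  intro φ _
  refine ⟨0, ?_⟩
  have := g3 j
  rw [this]
  simp

theorem s13_A {R : Type u} [CommRing R] [IsNoetherianRing R] (a b : R) (I : Ideal R)
    (hI : I = Ideal.span {a, b})
    (hk : ∀ k, ∃ n r s, (a*b)^n = r*a^(n+k)+s*b^(n+k)) :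
    Subsingleton (LC R I 2 (ModuleCat.of R R)) := by
  rw [s13_LC_iff]
  intro n x
  obtain ⟨N, r, s, hN⟩ := hk n
  obtain ⟨q, m, hm, H⟩ := s13_fmap a b I hI n N
  obtain ⟨g, comm, -, p2, u1, h, hh⟩ := H (projectiveResolution _) (projectiveResolution _)
  refine ⟨m, hm, ?_⟩
  refine s13_ext_zero _ _ _ g comm _ 1 ?_ x
  intro φ _
  let c : R := φ.hom p2
  let ψ := (c * (r * b^q)) • (LinearMap.snd R R R ∘ₗ u1) - (c * (s * a^q)) • (LinearMap.fst R R R ∘ₗ u1)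
  have hψ : ∀ p, ψ p = c * (r * b^q) * (u1 p).2 - c * (s * a^q) * (u1 p).1 := fun p => rfl
  refine ⟨ModuleCat.ofHom ψ, ?_⟩
  ext t
  obtain ⟨e, e1, e2⟩ := hh t
  have : ψ (((projectiveResolution (ModuleCat.of R (R ⧸ I ^ m))).complex.d 2 1).hom t) = φ.hom ((g.f 2).hom t) := by
    rw [e, map_smul, hψ]
    change _ = (a*b)^N * h t * c
    rw [hN]
    linear_combination c * r * e2 - c * s * e1
  exact this

theorem s13_B {R : Type u} [CommRing R] [IsNoetherianRing R] (a b : R) (I : Ideal R)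
    (hI : I = Ideal.span {a, b}) (hs : Subsingleton (LC R I 2 (ModuleCat.of R R))) :
    ∃ N r s, (a*b)^N = r*a^(N+1)+s*b^(N+1) := by
  rw [s13_LC_iff] at hs
  obtain ⟨q, h, -, -, h3⟩ := s13_key a b 1
  have haI : a ∈ I := by rw [hI]; exact Ideal.subset_span (by simp)
  have hbI : b ∈ I := by rw [hI]; exact Ideal.subset_span (by simp)
  generalize hP : projectiveResolution (ModuleCat.of R (R ⧸ I ^ (2*(1+q)))) = P
  have hle := s13_pow_le a b I hI (1+q)
  obtain ⟨u0, u1, hu0, hu1⟩ := s13_u (a^(1+q)) (b^(1+q)) hle P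
  have hz : ∀ t, (u1 ∘ₗ (P.complex.d 2 1).hom) t ∈ LinearMap.ker (s13d (a^(1+q)) (b^(1+q))) := by
    intro t
    rw [LinearMap.mem_ker, LinearMap.comp_apply, hu1]
    have := (s13_res_exact P 0).apply_apply_eq_zero t
    exact (congrArg u0 this).trans (map_zero u0)
  let z := LinearMap.codRestrict _ (u1 ∘ₗ (P.complex.d 2 1).hom) hz
  have hzv : ∀ t, (z t).1 = u1 ((P.complex.d 2 1).hom t) := fun t => rfl
  obtain ⟨x, hx⟩ := s13_ext_cls P (ModuleCat.of R R) 1 (ModuleCat.ofHom (h ∘ₗ z)) (by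
    ext t
    have : h (z ((P.complex.d 3 2).hom t)) = 0 := by
      have hd : (P.complex.d 2 1).hom ((P.complex.d 3 2).hom t) = 0 :=
        (s13_res_exact P 1).apply_apply_eq_zero t
      have : z ((P.complex.d 3 2).hom t) = 0 := by
        apply Subtype.ext
        rw [hzv, hd, map_zero]
        rfl
      rw [this, map_zero]
    exact this)
  obtain ⟨M', hM, h0⟩ := hs _ x
  generalize hQ : projectiveResolution (ModuleCat.of R (R ⧸ I ^ M')) = Q
  have comm : (ProjectiveResolution.lift (s13tr I hM) Q P).f 0 ≫ P.π.f 0 =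
      Q.π.f 0 ≫ s13tr I hM := by
    simpa using ProjectiveResolution.lift_commutes_zero (s13tr I hM) Q P
  generalize ProjectiveResolution.lift (s13tr I hM) Q P = g at comm
  obtain ⟨ψ, hψ⟩ := hx _ Q _ g comm h0
  obtain ⟨p0, e1, e2, p2, hp0, he1, he2, hp2⟩ := s13_v (a^M') (b^M') (Ideal.pow_mem_pow haI M')
    (Ideal.pow_mem_pow hbI M') Q
  have g10 : ∀ t, (P.complex.d 1 0).hom ((g.f 1).hom t) = (g.f 0).hom ((Q.complex.d 1 0).hom t) :=
    fun t => congrArg (fun f => f.hom t) (g.comm 1 0)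
  have g21 : ∀ t, (P.complex.d 2 1).hom ((g.f 2).hom t) = (g.f 1).hom ((Q.complex.d 2 1).hom t) :=
    fun t => congrArg (fun f => f.hom t) (g.comm 2 1)
  have hψ' : ∀ t, ψ.hom ((Q.complex.d 2 1).hom t) = h (z ((g.f 2).hom t)) :=
    fun t => congrArg (fun f => f.hom t) hψ
  have hw0 : u0 ((g.f 0).hom p0) - 1 ∈ Ideal.span {a^(1+q), b^(1+q)} := by
    apply hle
    rw [← Ideal.Quotient.eq, hu0]
    have e : s13π P ((g.f 0).hom p0) = (s13tr I hM).hom (s13π Q p0) :=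
      congrArg (fun f => f.hom p0) comm
    rw [e, hp0]
    rfl
  obtain ⟨s, t, hst⟩ := Ideal.mem_span_pair.mp hw0
  obtain ⟨k, rfl⟩ : ∃ k, M' = 1 + q + k := ⟨M' - (1+q), by lia⟩
  have hE1 : s13d (a^(1+q)) (b^(1+q)) (u1 ((g.f 1).hom e1)) = a^(1+q+k) * u0 ((g.f 0).hom p0) := by
    rw [hu1, g10, he1, map_smul, map_smul, smul_eq_mul]
  have hE2 : s13d (a^(1+q)) (b^(1+q)) (u1 ((g.f 1).hom e2)) = b^(1+q+k) * u0 ((g.f 0).hom p0) := by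
    rw [hu1, g10, he2, map_smul, map_smul, smul_eq_mul]
  have hd := hψ' p2
  have hzz : (z ((g.f 2).hom p2)).1 =
      a^(1+q+k) • u1 ((g.f 1).hom e2) - b^(1+q+k) • u1 ((g.f 1).hom e1) := by
    rw [hzv, g21, hp2, map_sub, map_sub, map_smul, map_smul, map_smul, map_smul]
  generalize z ((g.f 2).hom p2) = Z at hd hzz
  rw [hp2, map_sub, map_smul, map_smul] at hd
  generalize u1 ((g.f 1).hom e1) = E1 at hE1 hzz
  generalize u1 ((g.f 1).hom e2) = E2 at hE2 hzz
  generalize u0 ((g.f 0).hom p0) = w at hE1 hE2 hst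
  rw [s13d_apply] at hE1 hE2
  let z1 : LinearMap.ker (s13d (a^(1+q)) (b^(1+q))) :=
    ⟨(E1.1 - a^k - a^(1+q+k) * s, E1.2 - a^(1+q+k) * t), by
      rw [LinearMap.mem_ker, s13d_apply]
      linear_combination hE1 - a^(1+q+k) * hst⟩
  let z2 : LinearMap.ker (s13d (a^(1+q)) (b^(1+q))) :=
    ⟨(E2.1 - b^(1+q+k) * s, E2.2 - b^k - b^(1+q+k) * t), by
      rw [LinearMap.mem_ker, s13d_apply]
      linear_combination hE2 - b^(1+q+k) * hst⟩
  let zm : LinearMap.ker (s13d (a^(1+q)) (b^(1+q))) :=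
    ⟨(-b^(1+q), a^(1+q)), by
      rw [LinearMap.mem_ker, s13d_apply]
      ring⟩
  have hZ : Z = a^(1+q+k) • z2 - b^(1+q+k) • z1 + (a*b)^k • zm := by
    apply Subtype.ext
    rw [hzz]
    ext
    · simp [z1, z2, zm]
      ring
    · simp [z1, z2, zm]
      ring
  have hzm : h zm = (a*b)^q := h3 zm rfl rfl
  rw [hZ, map_add, map_sub, map_smul, map_smul, map_smul, hzm] at hd
  have hd' : a^(1+q+k) * (ψ.hom e2 : R) - b^(1+q+k) * (ψ.hom e1 : R) =
    a^(1+q+k) * h z2 - b^(1+q+k) * h z1 + (a*b)^k * (a*b)^q := hd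
  refine ⟨q + k, (ψ.hom e2 : R) - h z2, h z1 - (ψ.hom e1 : R), ?_⟩
  linear_combination -hd'

theorem stmt13 (R : Type u) [CommRing R] [IsNoetherianRing R] (a₁ a₂ : R) (I : Ideal R)
    (hI : I = Ideal.span {a₁, a₂}) :
    (¬ Subsingleton (LC R I 2 (ModuleCat.of R R)) ∧
        ∀ i : ℕ, 2 < i → Subsingleton (LC R I i (ModuleCat.of R R))) ↔
      ∃ M : ModuleCat.{u} R,
        Subsingleton (TorMod R 0 (ModuleCat.of R (R ⧸ I)) M) ∧
          Subsingleton (TorMod R 1 (ModuleCat.of R (R ⧸ I)) M) ∧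
            ¬ Subsingleton (TorMod R 2 (ModuleCat.of R (R ⧸ I)) M) := by
  have hp : ∀ z, s13d a₁ a₂ z ∈ I := by
    intro z
    rw [s13d_apply, hI]
    exact Ideal.mem_span_pair.mpr ⟨z.1, z.2, by ring⟩
  constructor
  · rintro ⟨h2, -⟩
    have hk : ∃ k, ∀ n r s, (a₁*a₂)^n ≠ r*a₁^(n+k)+s*a₂^(n+k) := by
      by_contra hcon
      push Not at hcon
      exact h2 (s13_A a₁ a₂ I hI hcon)
    obtain ⟨k, hk⟩ := hk
    obtain ⟨M, _, _, hK0, hK1, m, hm, ha, hb, β, hβ⟩ := s13_exM a₁ a₂ k hk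
    have h12 := s13_tor12 a₁ a₂ I hI (ModuleCat.of R M)
      (LinearMap.codRestrict I (s13d a₁ a₂) hp) (fun _ => rfl)
    obtain ⟨t0, t1⟩ := s13_tensor_M a₁ a₂ I hI hK0 hK1
    refine ⟨ModuleCat.of R M, (s13_tor0 _ _).mpr t0, h12.1.mpr t1, ?_⟩
    rw [h12.2]
    exact s13_tensor_M2 a₁ a₂ m hm ha hb β hβ
  · rintro ⟨M, h0, h1, h2⟩
    have h12 := s13_tor12 a₁ a₂ I hI M
      (LinearMap.codRestrict I (s13d a₁ a₂) hp) (fun _ => rfl)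
    rw [s13_tor0] at h0
    rw [h12.1] at h1
    rw [h12.2] at h2
    obtain ⟨hK1, m, hm, ha, hb⟩ := s13_tensor_back a₁ a₂ I hI
      (LinearMap.codRestrict I (s13d a₁ a₂) hp) (fun _ => rfl) h0 h1 h2
    refine ⟨fun hs => ?_, fun i hi => s13_C a₁ a₂ I hI i hi⟩
    obtain ⟨N, r, s, hN⟩ := s13_B a₁ a₂ I hI hs
    exact s13_chain a₁ a₂ hK1 m hm ha hb N r s hN
end
end

section
/- Let R be a commutative Noetherian ring and I = Ra₁ + Ra₂ an ideal generated by two elements. Then cd(I, R) = 2 if and only if there exists an R-module M with Hom_R(R/I, M) = Ext_R^1(R/I, M) = 0 and Ext_R^2(R/I, M) ≠ 0. -/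
open CategoryTheory

noncomputable section

universe u

section hmk
variable {R : Type u} [CommRing R]

lemma hmk_exists (K : CochainComplex (ModuleCat.{u} R) ℕ) (n : ℕ) (x : K.X n)
    (hx : K.d n (n+1) x = 0) : ∃ z : K.cycles n, K.iCycles n z = x := by
  have h := (K.sc n).moduleCat_exact_iff
  refine ⟨K.cyclesMk x (n+1) (by simp) hx, ?_⟩
  exact K.i_cyclesMk x (n+1) (by simp) hx

def hmk (K : CochainComplex (ModuleCat.{u} R) ℕ) (n : ℕ) (x : K.X n)
    (hx : K.d n (n+1) x = 0) : K.homology n := K.homologyπ n (hmk_exists K n x hx).choose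

lemma iCycles_inj (K : CochainComplex (ModuleCat.{u} R) ℕ) (n : ℕ) :
    Function.Injective (K.iCycles n) := (ModuleCat.mono_iff_injective _).1 inferInstance

lemma hmk_surj (K : CochainComplex (ModuleCat.{u} R) ℕ) (n : ℕ) (ξ : K.homology n) :
    ∃ x hx, hmk K n x hx = ξ := by
  obtain ⟨z, rfl⟩ := (ModuleCat.epi_iff_surjective (K.homologyπ n)).1 inferInstance ξ
  have hx : K.d n (n+1) (K.iCycles n z) = 0 := by
    rw [← ConcreteCategory.comp_apply, K.iCycles_d]; rfl
  refine ⟨K.iCycles n z, hx, ?_⟩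
  unfold hmk
  congr 1
  exact iCycles_inj K n (hmk_exists K n _ hx).choose_spec

lemma hmk_map {K L : CochainComplex (ModuleCat.{u} R) ℕ} (ψ : K ⟶ L) (n : ℕ) (x : K.X n)
    (hx : K.d n (n+1) x = 0) (hx' : L.d n (n+1) (ψ.f n x) = 0) :
    HomologicalComplex.homologyMap ψ n (hmk K n x hx) = hmk L n (ψ.f n x) hx' := by
  unfold hmk
  rw [← ConcreteCategory.comp_apply, HomologicalComplex.homologyπ_naturality,
    ConcreteCategory.comp_apply]
  congr 1
  apply iCycles_inj
  rw [(hmk_exists L n _ hx').choose_spec, ← ConcreteCategory.comp_apply,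
    HomologicalComplex.cyclesMap_i, ConcreteCategory.comp_apply, (hmk_exists K n _ hx).choose_spec]

lemma hmk_eq_zero_iff (K : CochainComplex (ModuleCat.{u} R) ℕ) (n : ℕ) (x : K.X n)
    (hx : K.d n (n+1) x = 0) (m : ℕ) (hm : (ComplexShape.up ℕ).prev n = m) :
    hmk K n x hx = 0 ↔ ∃ y, K.d m n y = x := by
  unfold hmk
  have hz := (hmk_exists K n x hx).choose_spec
  set z := (hmk_exists K n x hx).choose
  have he : (ShortComplex.mk (K.toCycles m n) (K.homologyπ n) (by simp)).Exact :=
    ShortComplex.exact_of_g_is_cokernel _ (K.homologyIsCokernel m n hm)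
  rw [ShortComplex.moduleCat_exact_iff] at he
  constructor
  · intro h
    obtain ⟨y, hy⟩ := he z h
    refine ⟨y, ?_⟩
    rw [← hz, ← hy, ← K.toCycles_i m n]; rfl
  · rintro ⟨y, hy⟩
    have : z = K.toCycles m n y := by
      apply iCycles_inj
      rw [hz, ← hy, ← ConcreteCategory.comp_apply, K.toCycles_i]
    rw [this, ← ConcreteCategory.comp_apply, HomologicalComplex.toCycles_comp_homologyπ]; rfl

end hmk

section ext
variable {R : Type u} [CommRing R]

def extMk' {X : ModuleCat.{u} R} (P : ProjectiveResolution X) (M : ModuleCat.{u} R) (n : ℕ)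
    (g : P.complex.X n ⟶ M) (hg : P.complex.d (n+1) n ≫ g = 0) :
    ((Ext R (ModuleCat.{u} R) n).obj (Opposite.op X)).obj M :=
  (P.isoExt n M).inv (hmk (P.complex.linearYonedaObj R M) n g hg)

lemma extMk'_surj {X : ModuleCat.{u} R} (P : ProjectiveResolution X) (M : ModuleCat.{u} R) (n : ℕ)
    (ξ : ((Ext R (ModuleCat.{u} R) n).obj (Opposite.op X)).obj M) :
    ∃ g hg, extMk' P M n g hg = ξ := by
  obtain ⟨g, hg, h⟩ := hmk_surj (P.complex.linearYonedaObj R M) n ((P.isoExt n M).hom ξ)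
  refine ⟨g, hg, ?_⟩
  unfold extMk'
  rw [h]; simp

lemma extMk'_eq_zero_iff' {X : ModuleCat.{u} R} (P : ProjectiveResolution X) (M : ModuleCat.{u} R)
    (n : ℕ) (g : P.complex.X n ⟶ M) (hg : P.complex.d (n+1) n ≫ g = 0) :
    extMk' P M n g hg = 0 ↔ hmk (P.complex.linearYonedaObj R M) n g hg = 0 := by
  unfold extMk'
  exact (P.isoExt n M).symm.toLinearEquiv.map_eq_zero_iff

lemma extMk'_succ_eq_zero_iff {X : ModuleCat.{u} R} (P : ProjectiveResolution X)
    (M : ModuleCat.{u} R)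
    (n : ℕ) (g : P.complex.X (n+1) ⟶ M) (hg : P.complex.d (n+2) (n+1) ≫ g = 0) :
    extMk' P M (n+1) g hg = 0 ↔ ∃ h : P.complex.X n ⟶ M, P.complex.d (n+1) n ≫ h = g := by
  exact (extMk'_eq_zero_iff' P M (n+1) g hg).trans
    (hmk_eq_zero_iff (P.complex.linearYonedaObj R M) (n+1) g hg n (by simp))

lemma extMk'_zero_eq_zero_iff {X : ModuleCat.{u} R} (P : ProjectiveResolution X)
    (M : ModuleCat.{u} R) (g : P.complex.X 0 ⟶ M) (hg : P.complex.d 1 0 ≫ g = 0) :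
    extMk' P M 0 g hg = 0 ↔ g = 0 := by
  refine ((extMk'_eq_zero_iff' P M 0 g hg).trans
    (hmk_eq_zero_iff (P.complex.linearYonedaObj R M) 0 g hg 0 (by simp))).trans ?_
  rw [HomologicalComplex.shape _ _ _ (by simp)]
  constructor
  · rintro ⟨y, hy⟩; exact hy.symm
  · rintro rfl; exact ⟨0, rfl⟩

lemma glue_comm {C : Type*} [Category C] {A B D E B' A' : C} (a : A ⟶ B) (b : B ⟶ D) (f : D ⟶ E)
    (p : B ⟶ B') (b' : B' ⟶ E) (m : A ⟶ A') (a' : A' ⟶ B') (h1 : b ≫ f = p ≫ b')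
    (h2 : a ≫ p = m ≫ a') : (a ≫ b) ≫ f = m ≫ (a' ≫ b') := by
  rw [Category.assoc, h1, ← Category.assoc, h2, Category.assoc]

lemma extMk'_map {X Y : ModuleCat.{u} R} (P : ProjectiveResolution X) (Q : ProjectiveResolution Y)
    (f : X ⟶ Y) (φ : P.complex ⟶ Q.complex) (comm : φ.f 0 ≫ Q.π.f 0 = P.π.f 0 ≫ f)
    (M : ModuleCat.{u} R) (n : ℕ) (g : Q.complex.X n ⟶ M) (hg : Q.complex.d (n+1) n ≫ g = 0)
    (hg' : P.complex.d (n+1) n ≫ φ.f n ≫ g = 0) :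
    ((Ext R (ModuleCat.{u} R) n).map f.op).app M (extMk' Q M n g hg) =
      extMk' P M n (φ.f n ≫ g) hg' := by
  let F := ((linearYoneda R (ModuleCat.{u} R)).obj M).rightOp
  let ψ : Q.complex.linearYonedaObj R M ⟶ P.complex.linearYonedaObj R M :=
    (HomologicalComplex.unopFunctor _ _).map (((F.mapHomologicalComplex _).map φ).op)
  have h1 : (Q.isoExt n M).inv ≫ ((Ext R (ModuleCat.{u} R) n).map f.op).app M =
      HomologicalComplex.homologyMap ψ n ≫ (P.isoExt n M).inv := by
    have e1 := congrArg Quiver.Hom.unop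
      (ProjectiveResolution.isoLeftDerivedObj_hom_naturality f P Q φ comm F n)
    have e2 := congrArg Quiver.Hom.unop (HomologicalComplex.homologyOp_hom_naturality ψ n)
    change (((Q.complex.linearYonedaObj R M).homologyOp n).hom.unop ≫
      (Q.isoLeftDerivedObj F n).hom.unop) ≫ ((F.leftDerived n).map f).unop =
      HomologicalComplex.homologyMap ψ n ≫ (((P.complex.linearYonedaObj R M).homologyOp n).hom.unop ≫
      (P.isoLeftDerivedObj F n).hom.unop)
    exact glue_comm _ _ _ _ _ _ _ e1 e2
  have h2 := congrArg (fun t => t.hom (hmk (Q.complex.linearYonedaObj R M) n g hg)) h1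
  have h3 := hmk_map ψ n g hg hg'
  unfold extMk'
  exact h2.trans (congrArg (P.isoExt n M).inv.hom h3)

end ext

section tr
variable {R : Type u} [CommRing R]

def trq {J J' : Ideal R} (h : J ≤ J') :
    ModuleCat.of R (R ⧸ J) ⟶ ModuleCat.of R (R ⧸ J') :=
  ModuleCat.ofHom <| Submodule.mapQ _ _ LinearMap.id h

lemma trq_comp {J J' J'' : Ideal R} (h : J ≤ J') (h' : J' ≤ J'') :
    trq h ≫ trq h' = trq (h.trans h') := by
  apply ModuleCat.hom_ext
  apply LinearMap.ext
  intro x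
  obtain ⟨x, rfl⟩ := Submodule.Quotient.mk_surjective _ x
  rfl

def tr {J J' : Ideal R} (h : J ≤ J') (i : ℕ) (M : ModuleCat.{u} R) :
    ExtMod R i (ModuleCat.of R (R ⧸ J')) M ⟶ ExtMod R i (ModuleCat.of R (R ⧸ J)) M :=
  ((Ext R (ModuleCat.{u} R) i).map (trq h).op).app M

lemma tr_comp {J J' J'' : Ideal R} (h : J ≤ J') (h' : J' ≤ J'') (i : ℕ) (M : ModuleCat.{u} R)
    (ξ : ExtMod R i (ModuleCat.of R (R ⧸ J'')) M) :
    tr h i M (tr h' i M ξ) = tr (h.trans h') i M ξ := by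
  have e : tr h' i M ≫ tr h i M = tr (h.trans h') i M := by
    unfold tr
    rw [← trq_comp h h', op_comp, Functor.map_comp]
    rfl
  exact congrArg (fun t => t.hom ξ) e

lemma LC_sub_iff (I : Ideal R) (i : ℕ) (M : ModuleCat.{u} R) :
    Subsingleton (LC R I i M) ↔ ∀ (n : ℕ) (ξ : ExtMod R i (ModuleCat.of R (R ⧸ I ^ n)) M),
      ∃ (m : ℕ) (h : I ^ m ≤ I ^ n), tr h i M ξ = 0 := by
  let D := localCohomology.diagram (localCohomology.idealPowersDiagram I) i
  let E := D ⋙ (evaluation _ _).obj M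
  have e : LC R I i M ≅ Limits.colimit E :=
    Limits.colimitObjIsoColimitCompEvaluation D M
  have key : Subsingleton (LC R I i M) ↔ Subsingleton ↑(Limits.colimit E) :=
    e.toLinearEquiv.toEquiv.subsingleton_congr
  rw [key]
  have hc := Limits.colimit.isColimit E
  have : IsFiltered ℕᵒᵖᵒᵖ := inferInstance
  have : Limits.PreservesFilteredColimitsOfSize.{0, 0} (forget (ModuleCat.{u} R)) :=
    Limits.preservesFilteredColimitsOfSize_shrink.{0, u, 0, u} _
  constructor
  · intro hs n ξ
    have h0 : (Limits.colimit.cocone E).ι.app (Opposite.op (Opposite.op n)) ξ =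
      (Limits.colimit.cocone E).ι.app (Opposite.op (Opposite.op n)) 0 := Subsingleton.elim (α := ↑(Limits.colimit E)) _ _
    obtain ⟨k, f, g, h⟩ := Limits.Concrete.isColimit_exists_of_rep_eq E hc _ _ h0
    refine ⟨k.unop.unop, Ideal.pow_le_pow_right (f.unop.unop.down.down), ?_⟩
    have : E.map f ξ = 0 := by rw [h]; exact map_zero (E.map g).hom
    exact this
  · intro H
    suffices ∀ x : ↑(Limits.colimit E), x = 0 from ⟨fun a b => by rw [this a, this b]⟩
    intro x
    obtain ⟨j, ξ, rfl⟩ := Limits.Concrete.isColimit_exists_rep E hc x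
    obtain ⟨m, h, hm⟩ := H j.unop.unop ξ
    let m' := max m j.unop.unop
    have hle : I ^ m' ≤ I ^ m := Ideal.pow_le_pow_right (le_max_left _ _)
    let f : j ⟶ Opposite.op (Opposite.op m') := (homOfLE (le_max_right m j.unop.unop)).op.op
    have h1 : E.map f ξ = 0 := by
      have : tr (hle.trans h) i M ξ = 0 :=
        (tr_comp hle h i M ξ).symm.trans ((congrArg (tr hle i M).hom hm).trans (map_zero _))
      exact this
    have := congrArg (fun t => t.hom ξ) ((Limits.colimit.cocone E).w f)
    refine this.symm.trans ?_
    change (Limits.colimit.cocone E).ι.app _ (E.map f ξ) = 0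
    rw [h1, map_zero]

lemma cofinal_iff (A B : ℕ → Ideal R) (hAB : ∀ n, ∃ m, A m ≤ B n) (hBA : ∀ n, ∃ m, B m ≤ A n)
    (i : ℕ) (M : ModuleCat.{u} R)
    (H : ∀ (n : ℕ) (ξ : ExtMod R i (ModuleCat.of R (R ⧸ A n)) M),
      ∃ (m : ℕ) (h : A m ≤ A n), tr h i M ξ = 0)
    (n : ℕ) (ξ : ExtMod R i (ModuleCat.of R (R ⧸ B n)) M) :
      ∃ (m : ℕ) (h : B m ≤ B n), tr h i M ξ = 0 := by
  obtain ⟨k, hk⟩ := hAB n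
  obtain ⟨l, hl, hz⟩ := H k (tr hk i M ξ)
  obtain ⟨m, hm⟩ := hBA l
  refine ⟨m, hm.trans (hl.trans hk), ?_⟩
  rw [← tr_comp hm (hl.trans hk), ← tr_comp hl hk, hz, map_zero]

def Jn (a₁ a₂ : R) (n : ℕ) : Ideal R := Ideal.span {a₁ ^ n, a₂ ^ n}

lemma Jn_le (a₁ a₂ : R) (n : ℕ) : Jn a₁ a₂ n ≤ Ideal.span {a₁, a₂} ^ n := by
  rw [Jn, Ideal.span_le]
  rintro x (rfl | rfl) <;> exact Ideal.pow_mem_pow (Ideal.subset_span (by simp)) _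

lemma pow_le_Jn (a₁ a₂ : R) (n : ℕ) : ∃ m, Ideal.span {a₁, a₂} ^ m ≤ Jn a₁ a₂ n := by
  apply Ideal.exists_pow_le_of_le_radical_of_fg
  · rw [Ideal.span_le]
    rintro x (rfl | rfl)
    · exact ⟨n, Ideal.subset_span (by simp)⟩
    · exact ⟨n, Ideal.subset_span (by simp)⟩
  · exact Submodule.fg_span (by simp)

lemma LC_sub_iff' (a₁ a₂ : R) (i : ℕ) (M : ModuleCat.{u} R) :
    Subsingleton (LC R (Ideal.span {a₁, a₂}) i M) ↔
    ∀ (n : ℕ) (ξ : ExtMod R i (ModuleCat.of R (R ⧸ Jn a₁ a₂ n)) M),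
      ∃ (m : ℕ) (h : Jn a₁ a₂ m ≤ Jn a₁ a₂ n), tr h i M ξ = 0 := by
  rw [LC_sub_iff]
  have h1 : ∀ n, ∃ m, Ideal.span {a₁, a₂} ^ m ≤ Jn a₁ a₂ n := pow_le_Jn a₁ a₂
  have h2 : ∀ n, ∃ m, Jn a₁ a₂ m ≤ Ideal.span {a₁, a₂} ^ n := fun n => ⟨_, Jn_le a₁ a₂ n⟩
  exact ⟨cofinal_iff (fun n => Ideal.span {a₁, a₂} ^ n) (Jn a₁ a₂) h1 h2 i M,
    cofinal_iff (Jn a₁ a₂) (fun n => Ideal.span {a₁, a₂} ^ n) h2 h1 i M⟩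
end tr

section alg
variable {R : Type u} [CommRing R]

/-- Condition expressing the vanishing of the second Cech cohomology. -/
def PP (a₁ a₂ : R) : Prop :=
  ∀ k : ℕ, ∃ n : ℕ, ∃ α β : R, (a₁ * a₂) ^ n = α * a₁ ^ (n + k) + β * a₂ ^ (n + k)

lemma colon_stable [IsNoetherianRing R] (J : Ideal R) (a : R) :
    ∃ N : ℕ, ∀ (r : R) (j : ℕ), r * a ^ j ∈ J → ∀ d, N ≤ d → r * a ^ d ∈ J := by
  let f : ℕ →o Ideal R :=
    { toFun := fun n => Submodule.comap (LinearMap.mulRight R (a ^ n)) J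
      monotone' := by
        intro m n h x hx
        obtain ⟨k, rfl⟩ := Nat.exists_eq_add_of_le h
        simp only [Submodule.mem_comap, LinearMap.mulRight_apply] at hx ⊢
        rw [pow_add, ← mul_assoc]
        exact J.mul_mem_right _ hx }
  obtain ⟨N, hN⟩ := monotone_stabilizes_iff_noetherian.2 (inferInstance : IsNoetherian R R) f
  refine ⟨N, fun r j hj d hd => ?_⟩
  have h1 : r ∈ f j := hj
  have h2 : r ∈ f (max j N) := f.monotone (le_max_left j N) h1
  rw [← hN _ (le_max_right j N)] at h2
  exact f.monotone hd h2

lemma koszul_H1 [IsNoetherianRing R] (a₁ a₂ : R) (m' : ℕ) : ∃ d : ℕ, ∀ x y : R,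
    x * a₁ ^ (m' + d) + y * a₂ ^ (m' + d) = 0 →
    ∃ t, a₁ ^ d * x = t * a₂ ^ m' ∧ a₂ ^ d * y = - (t * a₁ ^ m') := by
  obtain ⟨d2, h2⟩ := colon_stable (⊥ : Ideal R) a₂
  obtain ⟨d1, h1⟩ := colon_stable (Ideal.span {a₂ ^ (m' + d2)}) a₁
  refine ⟨d1 + d2, fun x y h => ?_⟩
  have e1 : x * a₁ ^ (m' + (d1 + d2)) ∈ Ideal.span {a₂ ^ (m' + d2)} := by
    rw [Ideal.mem_span_singleton']
    exact ⟨-y * a₂ ^ d1, by linear_combination (norm := ring) -h⟩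
  obtain ⟨t, ht⟩ := Ideal.mem_span_singleton'.1 (h1 x _ e1 d1 le_rfl)
  have e2 := h2 (t * a₁ ^ (m' + d2) + y * a₂ ^ d1) (m' + d2) (by
    rw [Ideal.mem_bot]
    linear_combination (norm := ring) h + a₁ ^ (m' + d2) * ht) d2 le_rfl
  rw [Ideal.mem_bot] at e2
  refine ⟨t * (a₁ * a₂) ^ d2, ?_, ?_⟩
  · linear_combination (norm := ring) - a₁ ^ d2 * ht
  · linear_combination (norm := ring) e2

/-- syzygies -/
def Syz (b₁ b₂ : R) : Submodule R (R × R) :=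
  LinearMap.ker ((LinearMap.lsmul R R b₁).coprod (LinearMap.lsmul R R b₂))

lemma mem_Syz {b₁ b₂ : R} {z : R × R} : z ∈ Syz b₁ b₂ ↔ z.1 * b₁ + z.2 * b₂ = 0 := by
  simp [Syz, mul_comm]

lemma theta_exists [IsNoetherianRing R] (a₁ a₂ : R) (n D : ℕ) :
    ∃ d : ℕ, D ≤ d ∧ ∃ θ : Syz (a₁ ^ (n + d)) (a₂ ^ (n + d)) →ₗ[R] R,
      (∀ z, a₁ ^ d * z.1.1 = θ z * a₂ ^ n ∧ a₂ ^ d * z.1.2 = - (θ z * a₁ ^ n)) ∧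
      ∀ z : Syz (a₁ ^ (n + d)) (a₂ ^ (n + d)), z.1 = (a₂ ^ (n + d), - a₁ ^ (n + d)) →
        θ z = (a₁ * a₂) ^ d := by
  obtain ⟨d3, h3⟩ := colon_stable (⊥ : Ideal R) a₁
  obtain ⟨d2, hd2⟩ : ∃ d2, d2 = d3 + D := ⟨_, rfl⟩
  have h2 : ∀ (r : R) (j : ℕ), r * a₁ ^ j ∈ (⊥ : Ideal R) → r * a₁ ^ d2 ∈ (⊥ : Ideal R) :=
    fun r j h => h3 r j h d2 (by omega)
  obtain ⟨d1, h1⟩ := koszul_H1 a₁ a₂ (n + d2)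
  have ex : ∀ z : Syz (a₁ ^ (n + (d2 + d1))) (a₂ ^ (n + (d2 + d1))),
      ∃ t, a₁ ^ d1 * z.1.1 = t * a₂ ^ (n + d2) ∧ a₂ ^ d1 * z.1.2 = - (t * a₁ ^ (n + d2)) := by
    intro z
    have := mem_Syz.1 z.2
    exact h1 _ _ (by simpa only [add_assoc] using this)
  choose t ht using ex
  have uniq : ∀ r s : R, r * a₁ ^ (n + d2) = s * a₁ ^ (n + d2) →
      r * (a₁ * a₂) ^ d2 = s * (a₁ * a₂) ^ d2 := by
    intro r s h
    have := h2 (r - s) (n + d2) (by rw [Ideal.mem_bot]; linear_combination h)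
    rw [Ideal.mem_bot] at this
    linear_combination (norm := ring) a₂ ^ d2 * this
  refine ⟨d2 + d1, by omega,
    { toFun := fun z => t z * (a₁ * a₂) ^ d2
      map_add' := fun z w => ?_
      map_smul' := fun c z => ?_ }, fun z => ⟨?_, ?_⟩, fun z hz => ?_⟩
  · rw [← add_mul]
    apply uniq
    have e1 := (ht z).2
    have e2 := (ht w).2
    have e3 := (ht (z + w)).2
    simp only [Submodule.coe_add, Prod.snd_add] at e3
    linear_combination e3 - e1 - e2
  · simp only [RingHom.id_apply, smul_eq_mul]
    rw [← mul_assoc]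
    apply uniq
    have e1 := (ht z).2
    have e3 := (ht (c • z)).2
    simp only [Submodule.coe_smul, Prod.smul_snd, smul_eq_mul] at e3
    linear_combination e3 * (1) - c * e1
  · have := (ht z).1
    simp only [LinearMap.coe_mk, AddHom.coe_mk]
    linear_combination (norm := ring) a₁ ^ d2 * this
  · have := (ht z).2
    simp only [LinearMap.coe_mk, AddHom.coe_mk]
    linear_combination (norm := ring) a₂ ^ d2 * this
  · simp only [LinearMap.coe_mk, AddHom.coe_mk]
    rw [pow_add, mul_comm ((a₁ * a₂) ^ d2)]
    apply uniq
    have := (ht z).2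
    rw [hz] at this
    simp only at this
    linear_combination (norm := ring) this

lemma PP_mono {a₁ a₂ : R} (h : PP a₁ a₂) [IsNoetherianRing R] (n : ℕ) :
    ∃ d : ℕ, ∃ u v : R, ∀ x y, x * a₁ ^ (n + d) + y * a₂ ^ (n + d) = 0 →
      a₁ ^ d * x = (u * x + v * y) * a₂ ^ n ∧ a₂ ^ d * y = - ((u * x + v * y) * a₁ ^ n) := by
  obtain ⟨p, α, β, hp⟩ := h n
  obtain ⟨d, hd⟩ := koszul_H1 a₁ a₂ (n + p)
  refine ⟨p + d, β * a₁ ^ d, - α * a₂ ^ d, fun x y hxy => ?_⟩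
  rw [← add_assoc] at hxy
  obtain ⟨t, h1, h2⟩ := hd x y hxy
  have e : t * (a₁ * a₂) ^ p = β * a₁ ^ d * x + - α * a₂ ^ d * y := by
    linear_combination (norm := ring) t * hp - β * h1 + α * h2
  rw [← e]
  constructor
  · linear_combination (norm := ring) a₁ ^ p * h1
  · linear_combination (norm := ring) a₂ ^ p * h2

variable {M : Type u} [AddCommGroup M] [Module R M]

/-- depth condition plus PP forces `M = IM`. -/
lemma depth_PP {a₁ a₂ : R} (hP : PP a₁ a₂)
    (h1 : ∀ p q : M, a₁ • p = a₂ • q → ∃ w, p = a₂ • w ∧ q = a₁ • w) (m : M) :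
    ∃ u v : M, m = a₁ • u + a₂ • v := by
  have h1j : ∀ j (p q : M), a₁ • p = a₂ ^ j • q → ∃ w, p = a₂ ^ j • w ∧ q = a₁ • w := by
    intro j
    induction j with
    | zero => intro p q h; exact ⟨p, by simp, by simpa using h.symm⟩
    | succ j ih =>
      intro p q h
      obtain ⟨w, hw, hw'⟩ := ih p (a₂ • q) (by rw [h, smul_smul, pow_succ])
      obtain ⟨w', e, e'⟩ := h1 w q hw'.symm
      exact ⟨w', by rw [hw, e, smul_smul, pow_succ], e'⟩
  have hij : ∀ i j (p q : M), a₁ ^ i • p = a₂ ^ j • q → ∃ w, p = a₂ ^ j • w ∧ q = a₁ ^ i • w := by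
    intro i j
    induction i with
    | zero => intro p q h; exact ⟨q, by simpa using h, by simp⟩
    | succ i ih =>
      intro p q h
      obtain ⟨w, hw, hw'⟩ := h1j j (a₁ ^ i • p) q (by rw [← h, smul_smul, pow_succ'])
      obtain ⟨w', e, e'⟩ := ih p w hw
      exact ⟨w', e, by rw [hw', e', smul_smul, pow_succ']⟩
  obtain ⟨n, α, β, hn⟩ := hP 1
  obtain ⟨w, e, e'⟩ := hij n n (a₂ ^ n • m - (α * a₁) • m) ((β * a₂) • m) (by
    rw [smul_sub, smul_smul, smul_smul, smul_smul, ← sub_smul]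
    congr 1
    linear_combination (norm := ring) hn)
  obtain ⟨w1, f1, f1'⟩ := hij 1 n (α • m) (m - w) (by
    rw [smul_sub, ← e, smul_smul]; simp [mul_comm])
  obtain ⟨w2, f2, f2'⟩ := hij n 1 w (β • m) (by
    rw [← e', smul_smul]; simp [mul_comm])
  refine ⟨w1, w2, ?_⟩
  rw [pow_one] at f1' f2
  rw [← f1', ← f2]; abel

end alg

section kos
variable {R : Type u} [CommRing R]

/-- first differential -/
def d10 (b₁ b₂ : R) : ModuleCat.of R (R × R) ⟶ ModuleCat.of R R :=
  ModuleCat.ofHom ((LinearMap.lsmul R R b₁).coprod (LinearMap.lsmul R R b₂))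

lemma d10_apply (b₁ b₂ : R) (z : R × R) : (d10 b₁ b₂).hom z = z.1 * b₁ + z.2 * b₂ := by
  simp [d10, mul_comm]

lemma pd_comp {X Y : ModuleCat.{u} R} (f : X ⟶ Y) : Projective.d f ≫ f = 0 :=
  (Category.assoc _ _ _).trans ((congrArg _ (Limits.kernel.condition f)).trans Limits.comp_zero)

lemma pd_exact {X Y : ModuleCat.{u} R} (f : X ⟶ Y) :
    (ShortComplex.mk (Projective.d f) f (pd_comp f)).Exact := exact_d_f f

/-- successor step -/
def ksucc {X₀ X₁ : ModuleCat.{u} R} (f : X₁ ⟶ X₀) :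
    Σ' (X₂ : ModuleCat.{u} R) (d : X₂ ⟶ X₁), d ≫ f = 0 :=
  ⟨_, Projective.d f, pd_comp f⟩

/-- the complex -/
def kosC (b₁ b₂ : R) : ChainComplex (ModuleCat.{u} R) ℕ :=
  ChainComplex.mk' (ModuleCat.of R R) (ModuleCat.of R (R × R)) (d10 b₁ b₂) ksucc

def kXIso (b₁ b₂ : R) (n : ℕ) :
    (kosC b₁ b₂).X (n + 2) ≅ Projective.syzygies ((kosC b₁ b₂).d (n + 1) n) :=
  ChainComplex.mk'XIso (ModuleCat.of R R) (ModuleCat.of R (R × R)) (d10 b₁ b₂) ksucc n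

lemma kd (b₁ b₂ : R) (n : ℕ) :
    (kosC b₁ b₂).d (n + 2) (n + 1) = (kXIso b₁ b₂ n).hom ≫ Projective.d _ :=
  ChainComplex.mk'_d (ModuleCat.of R R) (ModuleCat.of R (R × R)) (d10 b₁ b₂) ksucc n

lemma kosC_d10 (b₁ b₂ : R) : (kosC b₁ b₂).d 1 0 = d10 b₁ b₂ := by
  unfold kosC
  rw [ChainComplex.mk'_d_1_0]

lemma kosC_exact (b₁ b₂ : R) (n : ℕ) : (kosC b₁ b₂).ExactAt (n + 1) := by
  rw [HomologicalComplex.exactAt_iff' _ (n + 1 + 1) (n + 1) n (by simp) (by simp)]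
  suffices h : ∀ (h : (kosC b₁ b₂).d (n + 1 + 1) (n + 1) ≫ (kosC b₁ b₂).d (n + 1) n = 0),
      (ShortComplex.mk ((kosC b₁ b₂).d (n + 1 + 1) (n + 1)) ((kosC b₁ b₂).d (n + 1) n) h).Exact from
    h _
  intro h
  refine (ShortComplex.exact_iff_of_iso ?_).2 (pd_exact ((kosC b₁ b₂).d (n + 1) n))
  refine ShortComplex.isoMk (kXIso b₁ b₂ n) (Iso.refl _) (Iso.refl _) ?_ ?_
  · refine Eq.trans ?_ (Category.comp_id _).symm
    exact (kd b₁ b₂ n).symm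
  · exact (Category.id_comp _).trans (Category.comp_id _).symm

instance kosC_proj (b₁ b₂ : R) (n : ℕ) : Projective ((kosC b₁ b₂).X n) := by
  obtain (_ | _ | n) := n
  · exact (IsProjective.iff_projective (R := R) R).1 inferInstance
  · exact (IsProjective.iff_projective (R := R) (R × R)).1 inferInstance
  · exact Projective.of_iso (kXIso b₁ b₂ n).symm (inferInstanceAs (Projective (Projective.syzygies _)))

/-- augmentation -/
def augm (b₁ b₂ : R) : ModuleCat.of R R ⟶ ModuleCat.of R (R ⧸ Ideal.span {b₁, b₂}) :=
  ModuleCat.ofHom (Submodule.mkQ _)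

lemma d10_augm (b₁ b₂ : R) : d10 b₁ b₂ ≫ augm b₁ b₂ = 0 := by
  apply ModuleCat.hom_ext
  apply LinearMap.ext
  intro z
  change Submodule.Quotient.mk ((d10 b₁ b₂).hom z) = 0
  rw [d10_apply, Submodule.Quotient.mk_eq_zero]
  exact Ideal.mem_span_pair.2 ⟨_, _, rfl⟩

lemma d10_augm_exact (b₁ b₂ : R) :
    (ShortComplex.mk (d10 b₁ b₂) (augm b₁ b₂) (d10_augm b₁ b₂)).Exact := by
  rw [ShortComplex.moduleCat_exact_iff]
  intro x hx
  have : x ∈ Ideal.span {b₁, b₂} := (Submodule.Quotient.mk_eq_zero _).1 hx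
  obtain ⟨p, q, h⟩ := Ideal.mem_span_pair.1 this
  exact ⟨((p, q) : R × R), by rw [← h]; exact d10_apply b₁ b₂ (p, q)⟩

lemma augm_epi (b₁ b₂ : R) : Epi (augm b₁ b₂) := by
  rw [ModuleCat.epi_iff_surjective]
  exact Submodule.mkQ_surjective _

/-- the resolution -/
def kos (b₁ b₂ : R) : ProjectiveResolution (ModuleCat.of R (R ⧸ Ideal.span {b₁, b₂})) where
  complex := kosC b₁ b₂
  π := (ChainComplex.toSingle₀Equiv _ _).symm ⟨augm b₁ b₂, by
          rw [kosC_d10]; exact d10_augm _ _⟩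
  quasiIso := ⟨fun n => by
    cases n
    · rw [ChainComplex.quasiIsoAt₀_iff, ShortComplex.quasiIso_iff_of_zeros']
      · refine (ShortComplex.exact_and_epi_g_iff_of_iso ?_).2
          ⟨d10_augm_exact b₁ b₂, augm_epi b₁ b₂⟩
        exact ShortComplex.isoMk (Iso.refl _) (Iso.refl _) (Iso.refl _)
          (by
            change 𝟙 _ ≫ d10 b₁ b₂ = (kosC b₁ b₂).d 1 0 ≫ 𝟙 _
            rw [kosC_d10]; rfl) (by
            simp only [Iso.refl_hom]
            exact (Category.id_comp _).trans (Category.comp_id _).symm)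
      all_goals rfl
    · rw [quasiIsoAt_iff_exactAt']
      · apply kosC_exact
      · apply ChainComplex.exactAt_succ_single_obj⟩

end kos

section extkos
variable {R : Type u} [CommRing R] (b₁ b₂ : R)

/-- second differential as a linear map into R × R -/
def d21 : (kosC b₁ b₂).X 2 →ₗ[R] R × R := ((kosC b₁ b₂).d 2 1).hom

lemma d21_mem (x : (kosC b₁ b₂).X 2) : d21 b₁ b₂ x ∈ Syz b₁ b₂ := by
  have h : (kosC b₁ b₂).d 2 1 ≫ d10 b₁ b₂ = 0 := by
    rw [← kosC_d10]; exact (kosC b₁ b₂).d_comp_d 2 1 0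
  have h2 : (d10 b₁ b₂).hom (d21 b₁ b₂ x) = 0 := congrArg (fun t => t.hom x) h
  rw [d10_apply] at h2
  exact mem_Syz.2 h2

def toSyz : (kosC b₁ b₂).X 2 →ₗ[R] Syz b₁ b₂ := (d21 b₁ b₂).codRestrict _ (d21_mem b₁ b₂)

lemma kexact (n : ℕ) (x : (kosC b₁ b₂).X (n + 1)) (h : ((kosC b₁ b₂).d (n + 1) n).hom x = 0) :
    ∃ y, ((kosC b₁ b₂).d (n + 2) (n + 1)).hom y = x := by
  have := kosC_exact b₁ b₂ n
  rw [HomologicalComplex.exactAt_iff' _ (n + 1 + 1) (n + 1) n (by simp) (by simp),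
    ShortComplex.moduleCat_exact_iff] at this
  exact this x h

lemma toSyz_surj : Function.Surjective (toSyz b₁ b₂) := by
  rintro ⟨z, hz⟩
  obtain ⟨y, hy⟩ := kexact b₁ b₂ 0 z (by
    rw [kosC_d10]
    exact (d10_apply b₁ b₂ z).trans (mem_Syz.1 hz))
  exact ⟨y, Subtype.ext hy⟩

variable {b₁ b₂}
variable {M : ModuleCat.{u} R}

def coc (γ : Syz b₁ b₂ →ₗ[R] M) : (kos b₁ b₂).complex.X 2 ⟶ M :=
  ModuleCat.ofHom (γ ∘ₗ toSyz b₁ b₂)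

lemma coc_cond (γ : Syz b₁ b₂ →ₗ[R] M) : (kos b₁ b₂).complex.d 3 2 ≫ coc γ = 0 := by
  apply ModuleCat.hom_ext
  apply LinearMap.ext
  intro x
  change γ (toSyz b₁ b₂ (((kosC b₁ b₂).d 3 2).hom x)) = 0
  have : toSyz b₁ b₂ (((kosC b₁ b₂).d 3 2).hom x) = 0 := by
    apply Subtype.ext
    exact congrArg (fun t => t.hom x) ((kosC b₁ b₂).d_comp_d 3 2 1)
  rw [this, map_zero]

lemma lin_factor {A B C : Type u} [AddCommGroup A] [AddCommGroup B] [AddCommGroup C]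
    [Module R A] [Module R B] [Module R C] (f : A →ₗ[R] B) (hf : Function.Surjective f)
    (g : A →ₗ[R] C) (h : ∀ x, f x = 0 → g x = 0) : ∃ γ : B →ₗ[R] C, ∀ x, γ (f x) = g x := by
  have hker : LinearMap.ker f ≤ LinearMap.ker g := fun x hx => h x hx
  let e := f.quotKerEquivOfSurjective hf
  refine ⟨((LinearMap.ker f).liftQ g hker) ∘ₗ e.symm.toLinearMap, fun x => ?_⟩
  change ((LinearMap.ker f).liftQ g hker) (e.symm (f x)) = _
  have : e.symm (f x) = Submodule.Quotient.mk x := by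
    rw [LinearEquiv.symm_apply_eq]; rfl
  rw [this]
  rfl

lemma coc_surj (g : (kos b₁ b₂).complex.X 2 ⟶ M) (hg : (kos b₁ b₂).complex.d 3 2 ≫ g = 0) :
    ∃ γ : Syz b₁ b₂ →ₗ[R] M, coc γ = g := by
  let g' : (kosC b₁ b₂).X 2 →ₗ[R] M := g.hom
  obtain ⟨γ, hγ⟩ := lin_factor (toSyz b₁ b₂) (toSyz_surj b₁ b₂) g' (fun x hx => by
    obtain ⟨y, hy⟩ := kexact b₁ b₂ 1 x (congrArg Subtype.val hx)
    rw [← hy]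
    exact congrArg (fun t => t.hom y) hg)
  refine ⟨γ, ?_⟩
  apply ModuleCat.hom_ext
  apply LinearMap.ext
  intro x
  exact hγ x

def e2 (γ : Syz b₁ b₂ →ₗ[R] M) :
    ExtMod R 2 (ModuleCat.of R (R ⧸ Ideal.span {b₁, b₂})) M :=
  extMk' (kos b₁ b₂) M 2 (coc γ) (coc_cond γ)

lemma e2_surj (ξ : ExtMod R 2 (ModuleCat.of R (R ⧸ Ideal.span {b₁, b₂})) M) :
    ∃ γ, e2 γ = ξ := by
  obtain ⟨g, hg, h⟩ := extMk'_surj (kos b₁ b₂) M 2 ξ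
  obtain ⟨γ, rfl⟩ := coc_surj g hg
  exact ⟨γ, h⟩

lemma e2_zero_iff (γ : Syz b₁ b₂ →ₗ[R] M) :
    e2 γ = 0 ↔ ∃ h : R × R →ₗ[R] M, ∀ z : Syz b₁ b₂, γ z = h z.1 := by
  refine (extMk'_succ_eq_zero_iff (kos b₁ b₂) M 1 (coc γ) (coc_cond γ)).trans ⟨?_, ?_⟩
  · rintro ⟨h, hh⟩
    refine ⟨h.hom, fun z => ?_⟩
    obtain ⟨x, rfl⟩ := toSyz_surj b₁ b₂ z
    exact (congrArg (fun t => t.hom x) hh).symm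
  · rintro ⟨h, hh⟩
    refine ⟨ModuleCat.ofHom h, ?_⟩
    apply ModuleCat.hom_ext
    apply LinearMap.ext
    intro x
    exact (hh (toSyz b₁ b₂ x)).symm

lemma ext0_iff : Subsingleton (ExtMod R 0 (ModuleCat.of R (R ⧸ Ideal.span {b₁, b₂})) M) ↔
    ∀ m : M, b₁ • m = 0 → b₂ • m = 0 → m = 0 := by
  constructor
  · intro hs m h1 h2
    let g : (kos b₁ b₂).complex.X 0 ⟶ M := ModuleCat.ofHom (LinearMap.toSpanSingleton R M m)
    have hg : (kos b₁ b₂).complex.d 1 0 ≫ g = 0 := by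
      change (kosC b₁ b₂).d 1 0 ≫ g = 0
      rw [kosC_d10]
      apply ModuleCat.hom_ext
      apply LinearMap.ext
      intro (z : R × R)
      change (d10 b₁ b₂).hom z • m = 0
      rw [d10_apply, add_smul, mul_smul, mul_smul, h1, h2]; simp
    have := (extMk'_zero_eq_zero_iff (kos b₁ b₂) M g hg).1 (Subsingleton.elim
      (α := ExtMod R 0 (ModuleCat.of R (R ⧸ Ideal.span {b₁, b₂})) M) _ _)
    have h3 : (1 : R) • m = 0 := congrArg (fun t => t.hom (1 : R)) this
    simpa using h3
  · intro H
    suffices ∀ ξ : ExtMod R 0 (ModuleCat.of R (R ⧸ Ideal.span {b₁, b₂})) M, ξ = 0 from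
      ⟨fun a b => by rw [this a, this b]⟩
    intro ξ
    obtain ⟨g, hg, rfl⟩ := extMk'_surj (kos b₁ b₂) M 0 ξ
    refine (extMk'_zero_eq_zero_iff (kos b₁ b₂) M g hg).2 ?_
    let g' : R →ₗ[R] M := g.hom
    have hg' : d10 b₁ b₂ ≫ g = 0 := by rw [← kosC_d10]; exact hg
    have key : ∀ z : R × R, g' (z.1 * b₁ + z.2 * b₂) = 0 := by
      intro z
      have : g' ((d10 b₁ b₂).hom z) = 0 := congrArg (fun t => t.hom z) hg'
      rwa [d10_apply] at this
    have h1 : g' 1 = 0 := by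
      apply H
      · rw [← map_smul]; simpa using key (1, 0)
      · rw [← map_smul]; simpa using key (0, 1)
    apply ModuleCat.hom_ext
    apply LinearMap.ext
    intro (x : R)
    change g' x = 0
    have : x = x • (1 : R) := by simp
    rw [this, map_smul, h1, smul_zero]

lemma ext1_iff : Subsingleton (ExtMod R 1 (ModuleCat.of R (R ⧸ Ideal.span {b₁, b₂})) M) ↔
    ∀ g : R × R →ₗ[R] M, (∀ z ∈ Syz b₁ b₂, g z = 0) →
      ∃ w : M, g (1, 0) = b₁ • w ∧ g (0, 1) = b₂ • w := by
  constructor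
  · intro hs g hg
    let g1 : (kos b₁ b₂).complex.X 1 ⟶ M := ModuleCat.ofHom g
    have hg1 : (kos b₁ b₂).complex.d 2 1 ≫ g1 = 0 := by
      apply ModuleCat.hom_ext
      apply LinearMap.ext
      intro x
      exact hg _ (d21_mem b₁ b₂ x)
    obtain ⟨h, hh⟩ := (extMk'_succ_eq_zero_iff (kos b₁ b₂) M 0 g1 hg1).1 (Subsingleton.elim
      (α := ExtMod R 1 (ModuleCat.of R (R ⧸ Ideal.span {b₁, b₂})) M) _ _)
    have hh' : d10 b₁ b₂ ≫ h = g1 := by rw [← kosC_d10]; exact hh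
    let h' : R →ₗ[R] M := h.hom
    have key : ∀ z : R × R, g z = h' (z.1 * b₁ + z.2 * b₂) := by
      intro z
      rw [← d10_apply]
      exact congrArg (fun t => t.hom z) hh'.symm
    refine ⟨h' 1, ?_, ?_⟩
    · rw [key, ← map_smul]; simp
    · rw [key, ← map_smul]; simp
  · intro H
    suffices ∀ ξ : ExtMod R 1 (ModuleCat.of R (R ⧸ Ideal.span {b₁, b₂})) M, ξ = 0 from
      ⟨fun a b => by rw [this a, this b]⟩
    intro ξ
    obtain ⟨g, hg, rfl⟩ := extMk'_surj (kos b₁ b₂) M 1 ξ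
    refine (extMk'_succ_eq_zero_iff (kos b₁ b₂) M 0 g hg).2 ?_
    let g' : R × R →ₗ[R] M := g.hom
    obtain ⟨w, h1, h2⟩ := H g' (fun z hz => by
      obtain ⟨x, hx⟩ := toSyz_surj b₁ b₂ ⟨z, hz⟩
      have : d21 b₁ b₂ x = z := congrArg Subtype.val hx
      rw [← this]
      exact congrArg (fun t => t.hom x) hg)
    refine ⟨ModuleCat.ofHom (LinearMap.toSpanSingleton R M w), ?_⟩
    change (kosC b₁ b₂).d 1 0 ≫ _ = g
    rw [kosC_d10]
    apply ModuleCat.hom_ext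
    apply LinearMap.ext
    intro (z : R × R)
    change (d10 b₁ b₂).hom z • w = g' z
    have : z = z.1 • ((1, 0) : R × R) + z.2 • ((0, 1) : R × R) := by ext <;> simp
    rw [d10_apply, this, map_add, map_smul, map_smul, h1, h2, add_smul, mul_smul, mul_smul]
    simp

end extkos

section chainmap
variable {R : Type u} [CommRing R]

/-- the Koszul syzygy -/
def eb (b₁ b₂ : R) : Syz b₁ b₂ := ⟨(b₂, -b₁), mem_Syz.2 (by simp only; ring)⟩

def lift_eb (b₁ b₂ : R) : (kosC b₁ b₂).X 2 := (toSyz_surj b₁ b₂ (eb b₁ b₂)).choose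

lemma toSyz_lift_eb (b₁ b₂ : R) : toSyz b₁ b₂ (lift_eb b₁ b₂) = eb b₁ b₂ :=
  (toSyz_surj b₁ b₂ (eb b₁ b₂)).choose_spec

variable {b₁ b₂ c₁ c₂ s₁ s₂ : R}

def phi1 (s₁ s₂ : R) : R × R →ₗ[R] R × R :=
  (LinearMap.lsmul R R s₁).prodMap (LinearMap.lsmul R R s₂)

def phi2 (b₁ b₂ : R) (θ : Syz c₁ c₂ →ₗ[R] R) : (kosC c₁ c₂).X 2 →ₗ[R] (kosC b₁ b₂).X 2 :=
  (LinearMap.toSpanSingleton R _ (lift_eb b₁ b₂)) ∘ₗ θ ∘ₗ toSyz c₁ c₂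

def phif (b₁ b₂ s₁ s₂ : R) (θ : Syz c₁ c₂ →ₗ[R] R) :
    (n : ℕ) → ((kosC c₁ c₂).X n ⟶ (kosC b₁ b₂).X n)
  | 0 => 𝟙 (ModuleCat.of R R)
  | 1 => ModuleCat.ofHom (phi1 s₁ s₂)
  | 2 => ModuleCat.ofHom (phi2 b₁ b₂ θ)
  | _ + 3 => 0

lemma phif_comm (hc₁ : c₁ = s₁ * b₁) (hc₂ : c₂ = s₂ * b₂) (θ : Syz c₁ c₂ →ₗ[R] R)
    (hθ : ∀ z, s₁ * z.1.1 = θ z * b₂ ∧ s₂ * z.1.2 = - (θ z * b₁)) (j : ℕ) :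
    phif b₁ b₂ s₁ s₂ θ (j + 1) ≫ (kosC b₁ b₂).d (j + 1) j =
      (kosC c₁ c₂).d (j + 1) j ≫ phif b₁ b₂ s₁ s₂ θ j := by
  match j with
  | 0 =>
    change phif b₁ b₂ s₁ s₂ θ 1 ≫ (kosC b₁ b₂).d 1 0 = (kosC c₁ c₂).d 1 0 ≫ phif b₁ b₂ s₁ s₂ θ 0
    rw [kosC_d10, kosC_d10]
    apply ModuleCat.hom_ext
    apply LinearMap.ext
    intro (z : R × R)
    change (d10 b₁ b₂).hom (phi1 s₁ s₂ z) = (d10 c₁ c₂).hom z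
    rw [d10_apply, d10_apply, hc₁, hc₂]
    simp only [phi1, LinearMap.prodMap_apply, LinearMap.lsmul_apply, smul_eq_mul]
    ring
  | 1 =>
    apply ModuleCat.hom_ext
    apply LinearMap.ext
    intro (x : (kosC c₁ c₂).X 2)
    change d21 b₁ b₂ (θ (toSyz c₁ c₂ x) • lift_eb b₁ b₂) = phi1 s₁ s₂ (toSyz c₁ c₂ x).1
    have h : d21 b₁ b₂ (lift_eb b₁ b₂) = (b₂, -b₁) := congrArg Subtype.val (toSyz_lift_eb b₁ b₂)
    rw [map_smul, h]
    obtain ⟨h1, h2⟩ := hθ (toSyz c₁ c₂ x)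
    apply Prod.ext
    · exact h1.symm
    · refine Eq.trans ?_ h2.symm
      simp
  | 2 =>
    refine (Limits.zero_comp).trans ?_
    apply ModuleCat.hom_ext
    apply LinearMap.ext
    intro (x : (kosC c₁ c₂).X 3)
    change 0 = θ (toSyz c₁ c₂ (((kosC c₁ c₂).d 3 2).hom x)) • lift_eb b₁ b₂
    have : toSyz c₁ c₂ (((kosC c₁ c₂).d 3 2).hom x) = 0 := by
      apply Subtype.ext
      exact congrArg (fun t => t.hom x) ((kosC c₁ c₂).d_comp_d 3 2 1)
    rw [this, map_zero, zero_smul]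
  | j + 3 => exact (Limits.zero_comp).trans (Limits.comp_zero).symm

def phi (hc₁ : c₁ = s₁ * b₁) (hc₂ : c₂ = s₂ * b₂) (θ : Syz c₁ c₂ →ₗ[R] R)
    (hθ : ∀ z, s₁ * z.1.1 = θ z * b₂ ∧ s₂ * z.1.2 = - (θ z * b₁)) :
    (kos c₁ c₂).complex ⟶ (kos b₁ b₂).complex where
  f := phif b₁ b₂ s₁ s₂ θ
  comm' i j h := by
    obtain rfl : j + 1 = i := h
    exact phif_comm hc₁ hc₂ θ hθ j

lemma kos_π (b₁ b₂ : R) : (kos b₁ b₂).π.f 0 = augm b₁ b₂ := by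
  exact ChainComplex.toSingle₀Equiv_symm_apply_f_zero _ _

lemma phi_comm (hc₁ : c₁ = s₁ * b₁) (hc₂ : c₂ = s₂ * b₂) (θ : Syz c₁ c₂ →ₗ[R] R)
    (hθ : ∀ z, s₁ * z.1.1 = θ z * b₂ ∧ s₂ * z.1.2 = - (θ z * b₁))
    (h : Ideal.span {c₁, c₂} ≤ Ideal.span {b₁, b₂}) :
    (phi hc₁ hc₂ θ hθ).f 0 ≫ (kos b₁ b₂).π.f 0 = (kos c₁ c₂).π.f 0 ≫ trq h := by
  rw [kos_π, kos_π]
  rfl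

lemma phi_cond (hc₁ : c₁ = s₁ * b₁) (hc₂ : c₂ = s₂ * b₂) (θ : Syz c₁ c₂ →ₗ[R] R)
    (hθ : ∀ z, s₁ * z.1.1 = θ z * b₂ ∧ s₂ * z.1.2 = - (θ z * b₁)) (M : ModuleCat.{u} R)
    (n : ℕ) (g : (kos b₁ b₂).complex.X n ⟶ M) (hg : (kos b₁ b₂).complex.d (n + 1) n ≫ g = 0) :
    (kos c₁ c₂).complex.d (n + 1) n ≫ (phi hc₁ hc₂ θ hθ).f n ≫ g = 0 := by
  rw [← Category.assoc, ← (phi hc₁ hc₂ θ hθ).comm, Category.assoc, hg, Limits.comp_zero]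

lemma tr_high (hc₁ : c₁ = s₁ * b₁) (hc₂ : c₂ = s₂ * b₂) (θ : Syz c₁ c₂ →ₗ[R] R)
    (hθ : ∀ z, s₁ * z.1.1 = θ z * b₂ ∧ s₂ * z.1.2 = - (θ z * b₁))
    (h : Ideal.span {c₁, c₂} ≤ Ideal.span {b₁, b₂}) (n : ℕ) (M : ModuleCat.{u} R)
    (ξ : ExtMod R (n + 3) (ModuleCat.of R (R ⧸ Ideal.span {b₁, b₂})) M) :
    tr h (n + 3) M ξ = 0 := by
  obtain ⟨g, hg, rfl⟩ := extMk'_surj (kos b₁ b₂) M (n + 3) ξ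
  have e := extMk'_map (kos c₁ c₂) (kos b₁ b₂) (trq h) (phi hc₁ hc₂ θ hθ)
    (phi_comm hc₁ hc₂ θ hθ h) M (n + 3) g hg (phi_cond hc₁ hc₂ θ hθ M _ g hg)
  refine e.trans ?_
  refine (extMk'_succ_eq_zero_iff (kos c₁ c₂) M (n + 2) _ _).2 ⟨0, ?_⟩
  exact (Limits.comp_zero).trans (Limits.zero_comp).symm

lemma tr_two (hc₁ : c₁ = s₁ * b₁) (hc₂ : c₂ = s₂ * b₂) (θ : Syz c₁ c₂ →ₗ[R] R)
    (hθ : ∀ z, s₁ * z.1.1 = θ z * b₂ ∧ s₂ * z.1.2 = - (θ z * b₁))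
    (h : Ideal.span {c₁, c₂} ≤ Ideal.span {b₁, b₂}) (M : ModuleCat.{u} R)
    (γ : Syz b₁ b₂ →ₗ[R] M) :
    tr h 2 M (e2 γ) = e2 ((LinearMap.toSpanSingleton R M (γ (eb b₁ b₂))) ∘ₗ θ) := by
  have e := extMk'_map (kos c₁ c₂) (kos b₁ b₂) (trq h) (phi hc₁ hc₂ θ hθ)
    (phi_comm hc₁ hc₂ θ hθ h) M 2 (coc γ) (coc_cond γ) (phi_cond hc₁ hc₂ θ hθ M _ _ (coc_cond γ))
  refine e.trans ?_
  unfold e2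
  congr 1
  apply ModuleCat.hom_ext
  apply LinearMap.ext
  intro (x : (kosC c₁ c₂).X 2)
  change γ (toSyz b₁ b₂ (θ (toSyz c₁ c₂ x) • lift_eb b₁ b₂)) =
    θ (toSyz c₁ c₂ x) • γ (eb b₁ b₂)
  rw [map_smul, map_smul, toSyz_lift_eb]

end chainmap

section main
variable {R : Type u} [CommRing R]

lemma Jn_anti (a₁ a₂ : R) {m n : ℕ} (h : n ≤ m) : Jn a₁ a₂ m ≤ Jn a₁ a₂ n := by
  unfold Jn
  rw [Ideal.span_le]
  obtain ⟨k, rfl⟩ := Nat.exists_eq_add_of_le h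
  intro x hx
  simp only [Set.mem_insert_iff, Set.mem_singleton_iff] at hx
  rcases hx with rfl | rfl
  · rw [pow_add]; exact Ideal.mul_mem_right _ _ (Ideal.subset_span (by simp))
  · rw [pow_add]; exact Ideal.mul_mem_right _ _ (Ideal.subset_span (by simp))

lemma LC_high [IsNoetherianRing R] (a₁ a₂ : R) (i : ℕ) (hi : 2 < i) (M : ModuleCat.{u} R) :
    Subsingleton (LC R (Ideal.span {a₁, a₂}) i M) := by
  obtain ⟨k, rfl⟩ : ∃ k, i = k + 3 := ⟨i - 3, by omega⟩
  rw [LC_sub_iff']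
  intro n ξ
  obtain ⟨d, -, θ, hθ, -⟩ := theta_exists a₁ a₂ n 0
  refine ⟨n + d, Jn_anti a₁ a₂ (by omega), ?_⟩
  exact tr_high (s₁ := a₁ ^ d) (s₂ := a₂ ^ d) (by ring) (by ring) θ hθ
    (Jn_anti a₁ a₂ (by omega)) k M ξ

lemma LC_two_of_PP [IsNoetherianRing R] (a₁ a₂ : R) (h : PP a₁ a₂) (M : ModuleCat.{u} R) :
    Subsingleton (LC R (Ideal.span {a₁, a₂}) 2 M) := by
  rw [LC_sub_iff']
  intro n ξ
  obtain ⟨d, p, q, hpq⟩ := PP_mono h n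
  refine ⟨n + d, Jn_anti a₁ a₂ (by omega), ?_⟩
  obtain ⟨γ, rfl⟩ := e2_surj (b₁ := a₁ ^ n) (b₂ := a₂ ^ n) ξ
  let T : R × R →ₗ[R] R := (LinearMap.lsmul R R p).coprod (LinearMap.lsmul R R q)
  have hT : ∀ z : R × R, T z = p * z.1 + q * z.2 := fun z => by simp [T]
  refine (tr_two (s₁ := a₁ ^ d) (s₂ := a₂ ^ d) (c₁ := a₁ ^ (n + d)) (c₂ := a₂ ^ (n + d))
    (by ring) (by ring) (T ∘ₗ (Syz _ _).subtype) ?_ (Jn_anti a₁ a₂ (by omega)) M γ).trans ?_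
  · intro z
    simp only [LinearMap.comp_apply, Submodule.subtype_apply, hT]
    exact hpq _ _ (mem_Syz.1 z.2)
  · exact (e2_zero_iff _).2
      ⟨(LinearMap.toSpanSingleton R M (γ (eb _ _))) ∘ₗ T, fun z => rfl⟩

lemma PP_of_LC_two [IsNoetherianRing R] (a₁ a₂ : R)
    (h : Subsingleton (LC R (Ideal.span {a₁, a₂}) 2 (ModuleCat.of R R))) : PP a₁ a₂ := by
  rw [LC_sub_iff'] at h
  intro k
  obtain ⟨d, -, θ0, -, h0⟩ := theta_exists a₁ a₂ k 0
  obtain ⟨m, hm, hz⟩ := h (k + d) (e2 (M := ModuleCat.of R R) θ0)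
  obtain ⟨d', hd', θ, hθ, h1⟩ := theta_exists a₁ a₂ (k + d) m
  have hle : Jn a₁ a₂ (k + d + d') ≤ Jn a₁ a₂ m := Jn_anti a₁ a₂ (by omega)
  have e1 := tr_comp hle hm 2 (ModuleCat.of R R) (e2 (M := ModuleCat.of R R) θ0)
  rw [hz, map_zero] at e1
  have e3 := (tr_two (s₁ := a₁ ^ d') (s₂ := a₂ ^ d') (c₁ := a₁ ^ (k + d + d'))
    (c₂ := a₂ ^ (k + d + d')) (by ring) (by ring) θ hθ (hle.trans hm) (ModuleCat.of R R) θ0)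
  obtain ⟨f, hf⟩ := (e2_zero_iff _).1 (e3.symm.trans e1.symm)
  let f' : R × R →ₗ[R] R := f
  have h2 : θ (eb _ _) * θ0 (eb _ _) = f' (a₂ ^ (k + d + d'), - a₁ ^ (k + d + d')) := hf (eb _ _)
  rw [h1 _ rfl, h0 _ rfl] at h2
  have h3 : ((a₂ ^ (k + d + d'), - a₁ ^ (k + d + d')) : R × R) =
    a₂ ^ (k + d + d') • ((1, 0) : R × R) + (- a₁ ^ (k + d + d')) • ((0, 1) : R × R) := by
    ext <;> simp
  rw [h3, map_add, map_smul, map_smul, smul_eq_mul, smul_eq_mul] at h2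
  refine ⟨d + d', - f' (0, 1), f' (1, 0), ?_⟩
  linear_combination (norm := ring) h2

lemma ext2_zero {a₁ a₂ : R} (hP : PP a₁ a₂) {M : ModuleCat.{u} R}
    (h0 : Subsingleton (ExtMod R 0 (ModuleCat.of R (R ⧸ Ideal.span {a₁, a₂})) M))
    (h1 : Subsingleton (ExtMod R 1 (ModuleCat.of R (R ⧸ Ideal.span {a₁, a₂})) M)) :
    Subsingleton (ExtMod R 2 (ModuleCat.of R (R ⧸ Ideal.span {a₁, a₂})) M) := by
  rw [ext0_iff] at h0
  rw [ext1_iff] at h1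
  have hd : ∀ p q : M, a₁ • p = a₂ • q → ∃ w, p = a₂ • w ∧ q = a₁ • w := by
    intro p q hpq
    obtain ⟨w, hw1, hw2⟩ := h1
      ((LinearMap.toSpanSingleton R M q).coprod (LinearMap.toSpanSingleton R M p)) (by
        intro z hz
        have hz := mem_Syz.1 hz
        simp only [LinearMap.coprod_apply, LinearMap.toSpanSingleton_apply]
        apply h0
        · rw [smul_add, smul_comm a₁ z.2, hpq, smul_smul, smul_smul, ← add_smul, mul_comm a₁, hz,
            zero_smul]
        · rw [smul_add, smul_comm a₂ z.1, ← hpq, smul_smul, smul_smul, ← add_smul, mul_comm a₂, hz,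
            zero_smul])
    simp at hw1 hw2
    exact ⟨w, hw2, hw1⟩
  suffices ∀ ξ : ExtMod R 2 (ModuleCat.of R (R ⧸ Ideal.span {a₁, a₂})) M, ξ = 0 from
    ⟨fun a b => by rw [this a, this b]⟩
  intro ξ
  obtain ⟨γ, rfl⟩ := e2_surj ξ
  rw [e2_zero_iff]
  obtain ⟨p, q, hpq⟩ := depth_PP hP hd (γ (eb a₁ a₂))
  refine ⟨(LinearMap.toSpanSingleton R M q).coprod (LinearMap.toSpanSingleton R M (-p)),
    fun z => ?_⟩
  simp only [LinearMap.coprod_apply, LinearMap.toSpanSingleton_apply]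
  rw [← sub_eq_zero]
  have hz := mem_Syz.1 z.2
  have z1 : a₁ • z = (- z.1.2) • eb a₁ a₂ := by
    apply Subtype.ext
    apply Prod.ext
    · change a₁ * z.1.1 = (- z.1.2) * a₂
      linear_combination hz
    · change a₁ * z.1.2 = (- z.1.2) * (- a₁)
      ring
  have z2 : a₂ • z = z.1.1 • eb a₁ a₂ := by
    apply Subtype.ext
    apply Prod.ext
    · change a₂ * z.1.1 = z.1.1 * a₂
      ring
    · change a₂ * z.1.2 = z.1.1 * (- a₁)
      linear_combination hz
  have hz' : a₁ * z.1.1 = (- z.1.2) * a₂ := by linear_combination hz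
  have hz'' : a₂ * z.1.2 = - (z.1.1 * a₁) := by linear_combination hz
  apply h0
  · rw [smul_sub, ← map_smul, z1, map_smul, hpq, smul_add, smul_add, smul_smul, smul_smul,
      smul_smul, smul_smul, hz', mul_comm a₁ z.1.2]
    module
  · rw [smul_sub, ← map_smul, z2, map_smul, hpq, smul_add, smul_add, smul_smul, smul_smul,
      smul_smul, smul_smul, hz'', mul_comm a₂ z.1.1]
    module

end main

section example_module
variable {R : Type u} [CommRing R] (a₁ a₂ : R)

abbrev A1 := Localization.Away a₁
abbrev A12 := Localization.Away (a₁ * a₂)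

lemma unit1 : IsUnit (algebraMap R (A12 a₁ a₂) a₁) := by
  have := IsLocalization.Away.algebraMap_isUnit (S := A12 a₁ a₂) (a₁ * a₂)
  rw [map_mul] at this
  exact isUnit_of_mul_isUnit_left this

lemma unit2 : IsUnit (algebraMap R (A12 a₁ a₂) a₂) := by
  have := IsLocalization.Away.algebraMap_isUnit (S := A12 a₁ a₂) (a₁ * a₂)
  rw [map_mul] at this
  exact isUnit_of_mul_isUnit_right this

def awayLift (B : Type u) [CommRing B] [Algebra R B] (a : R) (h : IsUnit (algebraMap R B a)) :
    A1 a →ₐ[R] B :=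
  { IsLocalization.Away.lift (S := A1 a) a h with
    commutes' := fun r => IsLocalization.Away.lift_eq a h r }

def DD : Subalgebra R (A1 a₁ × A1 a₂) :=
  AlgHom.equalizer ((awayLift (A12 a₁ a₂) a₁ (unit1 a₁ a₂)).comp (AlgHom.fst R _ _))
    ((awayLift (A12 a₁ a₂) a₂ (unit2 a₁ a₂)).comp (AlgHom.snd R _ _))

lemma mem_DD {z : A1 a₁ × A1 a₂} : z ∈ DD a₁ a₂ ↔
    awayLift (A12 a₁ a₂) a₁ (unit1 a₁ a₂) z.1 = awayLift (A12 a₁ a₂) a₂ (unit2 a₁ a₂) z.2 :=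
  Iff.rfl

lemma away_cancel (a : R) (x y : A1 a) (h : a • x = a • y) : x = y := by
  rw [Algebra.smul_def, Algebra.smul_def] at h
  exact (IsLocalization.Away.algebraMap_isUnit (S := A1 a) a).mul_left_cancel h

lemma away_div (a : R) (x : A1 a) : ∃ y : A1 a, a • y = x :=
  ⟨IsLocalization.Away.invSelf a * x, by
    rw [Algebra.smul_def, ← mul_assoc, IsLocalization.Away.mul_invSelf, one_mul]⟩

lemma DD_of_smul (z : A1 a₁ × A1 a₂) (p q : A1 a₁ × A1 a₂) (hp : p ∈ DD a₁ a₂) (hq : q ∈ DD a₁ a₂)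
    (h1 : a₁ • z.1 = p.1) (h2 : a₂ • z.2 = q.2) (h : a₂ • p = a₁ • q) : z ∈ DD a₁ a₂ := by
  rw [mem_DD] at *
  have u := (unit1 a₁ a₂).mul (unit2 a₁ a₂)
  apply u.mul_left_cancel
  have e1 : a₁ • awayLift (A12 a₁ a₂) a₁ (unit1 a₁ a₂) z.1 =
    awayLift (A12 a₁ a₂) a₁ (unit1 a₁ a₂) p.1 := by rw [← h1, map_smul]
  have e2 : a₂ • awayLift (A12 a₁ a₂) a₂ (unit2 a₁ a₂) z.2 =
    awayLift (A12 a₁ a₂) a₂ (unit2 a₁ a₂) q.2 := by rw [← h2, map_smul]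
  have e3 : a₂ • awayLift (A12 a₁ a₂) a₁ (unit1 a₁ a₂) p.1 =
      a₁ • awayLift (A12 a₁ a₂) a₁ (unit1 a₁ a₂) q.1 := by
    rw [← map_smul, ← map_smul]
    exact congrArg _ (congrArg Prod.fst h)
  simp only [Algebra.smul_def] at e1 e2 e3
  linear_combination algebraMap R (A12 a₁ a₂) a₂ * e1 - algebraMap R (A12 a₁ a₂) a₁ * e2 + e3 +
    algebraMap R (A12 a₁ a₂) a₁ * hq

lemma DD_ext0 (m : DD a₁ a₂) (h1 : a₁ • m = 0) (h2 : a₂ • m = 0) : m = 0 := by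
  apply Subtype.ext
  apply Prod.ext
  · apply away_cancel a₁
    have : a₁ • m.1.1 = 0 := congrArg (fun t => t.1.1) h1
    rw [this]; simp
  · apply away_cancel a₂
    have : a₂ • m.1.2 = 0 := congrArg (fun t => t.1.2) h2
    rw [this]; simp

lemma DD_ext1 (g : R × R →ₗ[R] DD a₁ a₂) (hg : ∀ z ∈ Syz a₁ a₂, g z = 0) :
    ∃ w : DD a₁ a₂, g (1, 0) = a₁ • w ∧ g (0, 1) = a₂ • w := by
  have h : a₂ • g (1, 0) = a₁ • g (0, 1) := by
    have := hg _ (eb a₁ a₂).2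
    have e : (eb a₁ a₂).1 = a₂ • ((1, 0) : R × R) - a₁ • ((0, 1) : R × R) := by
      ext <;> simp [eb]
    rw [e, map_sub, map_smul, map_smul, sub_eq_zero] at this
    exact this
  obtain ⟨w1, hw1⟩ := away_div a₁ (g (1, 0)).1.1
  obtain ⟨w2, hw2⟩ := away_div a₂ (g (0, 1)).1.2
  refine ⟨⟨(w1, w2), DD_of_smul a₁ a₂ _ _ _ (g (1, 0)).2 (g (0, 1)).2 hw1 hw2
    (congrArg Subtype.val h)⟩, ?_, ?_⟩
  · apply Subtype.ext
    apply Prod.ext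
    · exact hw1.symm
    · apply away_cancel a₂
      have : a₂ • (g (1, 0)).1.2 = a₁ • (g (0, 1)).1.2 := congrArg (fun t => t.1.2) h
      refine this.trans ?_
      rw [← hw2, smul_comm]
      rfl
  · apply Subtype.ext
    apply Prod.ext
    · apply away_cancel a₁
      have : a₂ • (g (1, 0)).1.1 = a₁ • (g (0, 1)).1.1 := congrArg (fun t => t.1.1) h
      refine this.symm.trans ?_
      rw [← hw1, smul_comm]
      rfl
    · exact hw2.symm

lemma DD_coprime (k : ℕ) (h : IsCoprime (algebraMap R (DD a₁ a₂) a₁) (algebraMap R (DD a₁ a₂) a₂)) :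
    ∃ n : ℕ, ∃ α β : R, (a₁ * a₂) ^ n = α * a₁ ^ (n + k) + β * a₂ ^ (n + k) := by
  obtain ⟨U, V, hUV⟩ := h.pow (m := k) (n := k)
  obtain ⟨N1, s, hs⟩ := IsLocalization.Away.surj a₂ U.1.2
  obtain ⟨N2, t, ht⟩ := IsLocalization.Away.surj a₁ V.1.1
  have hU := (mem_DD a₁ a₂).1 U.2
  have hV := (mem_DD a₁ a₂).1 V.2
  have hs' := congrArg (awayLift (A12 a₁ a₂) a₂ (unit2 a₁ a₂)) hs
  have ht' := congrArg (awayLift (A12 a₁ a₂) a₁ (unit1 a₁ a₂)) ht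
  have h1 : U.1.1 * (algebraMap R _ a₁) ^ k + V.1.1 * (algebraMap R _ a₂) ^ k = 1 :=
    congrArg (fun t => t.1.1) hUV
  have h1' := congrArg (awayLift (A12 a₁ a₂) a₁ (unit1 a₁ a₂)) h1
  simp only [map_mul, map_pow, map_add, AlgHom.commutes, map_one] at hs' ht' h1'
  rw [hU] at h1'
  have key : algebraMap R (A12 a₁ a₂) ((a₁ * a₂) ^ (N1 + N2)) = algebraMap R (A12 a₁ a₂)
      (s * a₂ ^ N2 * a₁ ^ (N1 + N2 + k) + t * a₁ ^ N1 * a₂ ^ (N1 + N2 + k)) := by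
    simp only [map_mul, map_pow, map_add]
    rw [← hs', ← ht']
    generalize algebraMap R (A12 a₁ a₂) a₁ = x at *
    generalize algebraMap R (A12 a₁ a₂) a₂ = y at *
    linear_combination (norm := ring) - (x * y) ^ (N1 + N2) * h1'
  obtain ⟨⟨_, j, rfl⟩, hj⟩ := (IsLocalization.eq_iff_exists (Submonoid.powers (a₁ * a₂)) _).1 key
  refine ⟨N1 + N2 + j, s * a₂ ^ N2 * a₂ ^ j, t * a₁ ^ N1 * a₁ ^ j, ?_⟩
  simp only at hj
  linear_combination (norm := ring) hj

lemma DD_ext2 (hP : ¬ PP a₁ a₂) : ∃ γ : Syz a₁ a₂ →ₗ[R] DD a₁ a₂,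
    ¬ ∃ h : R × R →ₗ[R] DD a₁ a₂, ∀ z : Syz a₁ a₂, γ z = h z.1 := by
  have mem : ∀ z : Syz a₁ a₂, ((algebraMap R (A1 a₁) (-z.1.2) * IsLocalization.Away.invSelf a₁,
      algebraMap R (A1 a₂) z.1.1 * IsLocalization.Away.invSelf a₂) : A1 a₁ × A1 a₂) ∈ DD a₁ a₂ := by
    intro z
    refine DD_of_smul a₁ a₂ _ (algebraMap R _ (-z.1.2)) (algebraMap R _ z.1.1)
      ((DD a₁ a₂).algebraMap_mem _) ((DD a₁ a₂).algebraMap_mem _) ?_ ?_ ?_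
    · simp only [Algebra.smul_def]
      rw [mul_left_comm, IsLocalization.Away.mul_invSelf, mul_one]; rfl
    · simp only [Algebra.smul_def]
      rw [mul_left_comm, IsLocalization.Away.mul_invSelf, mul_one]; rfl
    · rw [Algebra.smul_def, Algebra.smul_def, ← map_mul, ← map_mul]
      congr 1
      have := mem_Syz.1 z.2
      linear_combination -this
  refine ⟨{ toFun := fun z => ⟨_, mem z⟩
            map_add' := ?_
            map_smul' := ?_ }, ?_⟩
  · intro z w
    apply Subtype.ext
    apply Prod.ext
    · simp; ring
    · simp; ring
  · intro c z
    apply Subtype.ext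
    apply Prod.ext
    · simp [Algebra.smul_def, mul_assoc]
    · simp [Algebra.smul_def, mul_assoc]
  · rintro ⟨h, hh⟩
    apply hP
    intro k
    apply DD_coprime
    have e := hh (eb a₁ a₂)
    have e1 : (eb a₁ a₂).1 = a₂ • ((1, 0) : R × R) - a₁ • ((0, 1) : R × R) := by
      ext <;> simp [eb]
    rw [e1, map_sub, map_smul, map_smul] at e
    have e2 : (1 : DD a₁ a₂) = a₂ • h (1, 0) - a₁ • h (0, 1) := by
      rw [← e]
      apply Subtype.ext
      apply Prod.ext
      · simp [eb, IsLocalization.Away.mul_invSelf]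
      · simp [eb, IsLocalization.Away.mul_invSelf]
    refine ⟨- h (0, 1), h (1, 0), ?_⟩
    rw [Algebra.smul_def, Algebra.smul_def] at e2
    linear_combination -e2

end example_module

theorem stmt14 (R : Type u) [CommRing R] [IsNoetherianRing R] (a₁ a₂ : R) (I : Ideal R)
    (hI : I = Ideal.span {a₁, a₂}) :
    (¬ Subsingleton (LC R I 2 (ModuleCat.of R R)) ∧
        ∀ i : ℕ, 2 < i → Subsingleton (LC R I i (ModuleCat.of R R))) ↔
      ∃ M : ModuleCat.{u} R,
        Subsingleton (ExtMod R 0 (ModuleCat.of R (R ⧸ I)) M) ∧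
          Subsingleton (ExtMod R 1 (ModuleCat.of R (R ⧸ I)) M) ∧
            ¬ Subsingleton (ExtMod R 2 (ModuleCat.of R (R ⧸ I)) M) := by
  subst hI
  constructor
  · rintro ⟨h, -⟩
    have hP : ¬ PP a₁ a₂ := fun hP => h (LC_two_of_PP a₁ a₂ hP _)
    refine ⟨ModuleCat.of R (DD a₁ a₂), ?_, ?_, ?_⟩
    · rw [ext0_iff]
      exact DD_ext0 a₁ a₂
    · rw [ext1_iff]
      exact DD_ext1 a₁ a₂
    · intro hs
      obtain ⟨γ, hγ⟩ := DD_ext2 a₁ a₂ hP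
      exact hγ ((e2_zero_iff (M := ModuleCat.of R (DD a₁ a₂)) γ).1 (Subsingleton.elim _ _))
  · rintro ⟨M, h0, h1, h2⟩
    exact ⟨fun h => h2 (ext2_zero (PP_of_LC_two a₁ a₂ h) h0 h1),
      fun i hi => LC_high a₁ a₂ i hi _⟩
end
end

section
/- Let R be a commutative Noetherian ring and I ⊆ J ideals of R with cd(J, R) = 1. Then for every R-module M, Ext_R^j(R/J, H^i_I(M)) = 0 for all integers i ≥ 2 and j ≥ 0. -/
open CategoryTheory

noncomputable section

universe u

section Aux

variable {R : Type u} [CommRing R]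

def ExtMod.pull (i : ℕ) {A A' : ModuleCat.{u} R} (g : A' ⟶ A) (B : ModuleCat.{u} R) :
    ExtMod R i A B ⟶ ExtMod R i A' B :=
  ((Ext R (ModuleCat.{u} R) i).map g.op).app B

lemma comp_aux {C : Type*} [Category C] {X Y Z W Y' X' : C} (a : X ⟶ Y) (b : Y ⟶ Z) (c : Z ⟶ W)
    (m : Y ⟶ Y') (p' : Y' ⟶ W) (k : X ⟶ X') (a' : X' ⟶ Y') (h2 : b ≫ c = m ≫ p')
    (h3 : a ≫ m = k ≫ a') : (a ≫ b) ≫ c = k ≫ a' ≫ p' := by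
  rw [Category.assoc, h2, ← Category.assoc, h3, Category.assoc]

def ERep {A B : ModuleCat.{u} R} (P : ProjectiveResolution A) {n : ℕ} (f : P.complex.X n ⟶ B)
    (x : ExtMod R n A B) : Prop :=
  ∃ z : (P.complex.linearYonedaObj R B).cycles n,
    (P.complex.linearYonedaObj R B).iCycles n z = f ∧
    (P.isoExt (R := R) n B).inv ((P.complex.linearYonedaObj R B).homologyπ n z) = x

section
variable {A B : ModuleCat.{u} R} (P : ProjectiveResolution A) {n : ℕ}

lemma ERep.surj (x : ExtMod R n A B) : ∃ f : P.complex.X n ⟶ B, ERep P f x := by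
  obtain ⟨z, hz⟩ := (ModuleCat.epi_iff_surjective _).1
    (inferInstance : Epi ((P.complex.linearYonedaObj R B).homologyπ n)) ((P.isoExt (R := R) n B).hom x)
  refine ⟨_, z, rfl, ?_⟩
  rw [hz]
  exact (P.isoExt (R := R) n B).hom_inv_id_apply x

lemma ERep.cocycle {f : P.complex.X n ⟶ B} {x} (h : ERep P f x) : P.complex.d (n+1) n ≫ f = 0 := by
  obtain ⟨z, rfl, -⟩ := h
  have := ConcreteCategory.congr_hom ((P.complex.linearYonedaObj R B).iCycles_d n (n+1)) z
  exact this

lemma ERep.exist {f : P.complex.X n ⟶ B} (h : P.complex.d (n+1) n ≫ f = 0) : ∃ x, ERep P f x := by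
  let K := P.complex.linearYonedaObj R B
  have h1 : ((K.sc n).moduleCatCyclesIso.inv ≫ K.iCycles n) = _ := (K.sc n).moduleCatCyclesIso_inv_iCycles
  let k : LinearMap.ker (K.sc n).g.hom := ⟨f, by
    have : K.d n (n+1) f = 0 := h
    change K.d n _ f = 0
    rw [(CochainComplex.next ℕ n)]
    exact this⟩
  refine ⟨_, (K.sc n).moduleCatCyclesIso.inv k, ?_, rfl⟩
  exact ConcreteCategory.congr_hom h1 k

lemma ERep.add {f g : P.complex.X n ⟶ B} {x y} (h : ERep P f x) (h' : ERep P g y) : ERep P (f+g) (x+y) := by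
  obtain ⟨z, rfl, rfl⟩ := h
  obtain ⟨w, rfl, rfl⟩ := h'
  refine ⟨z + w, ?_, ?_⟩
  · erw [map_add]; rfl
  · erw [map_add, map_add]; rfl

lemma ERep.smul {f : P.complex.X n ⟶ B} {x} (r : R) (h : ERep P f x) : ERep P (r • f) (r • x) := by
  obtain ⟨z, rfl, rfl⟩ := h
  refine ⟨r • z, ?_, ?_⟩
  · erw [map_smul]; rfl
  · erw [map_smul, map_smul]; rfl

lemma ERep.zero : ERep P (0 : P.complex.X n ⟶ B) 0 := by
  refine ⟨0, ?_, ?_⟩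
  · erw [map_zero]; rfl
  · erw [map_zero, map_zero]; rfl

lemma ERep.uniq {f : P.complex.X n ⟶ B} {x y} (h : ERep P f x) (h' : ERep P f y) : x = y := by
  obtain ⟨z, rfl, rfl⟩ := h
  obtain ⟨w, h, rfl⟩ := h'
  have := (ModuleCat.mono_iff_injective _).1
    (inferInstance : Mono ((P.complex.linearYonedaObj R B).iCycles n)) h
  rw [this]

lemma ERep.zero_iff {f : P.complex.X (n+1) ⟶ B} {x} (h : ERep P f x) :
    x = 0 ↔ ∃ g : P.complex.X n ⟶ B, P.complex.d (n+1) n ≫ g = f := by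
  let K := P.complex.linearYonedaObj R B
  have ex : (ShortComplex.mk (K.toCycles n (n+1)) (K.homologyπ (n+1)) (by simp)).Exact :=
    ShortComplex.exact_of_g_is_cokernel _ (K.homologyIsCokernel n (n+1) (by simp))
  rw [ShortComplex.moduleCat_exact_iff] at ex
  obtain ⟨z, rfl, rfl⟩ := h
  constructor
  · intro h
    have h2 : K.homologyπ (n+1) z = 0 := by
      have := congrArg (P.isoExt (R := R) (n+1) B).hom h
      erw [Iso.inv_hom_id_apply, map_zero] at this
      exact this
    obtain ⟨g, hg⟩ := ex z h2
    refine ⟨g, ?_⟩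
    subst hg
    exact (ConcreteCategory.congr_hom (K.toCycles_i n (n+1)) g).symm
  · rintro ⟨g, hg⟩
    have : z = K.toCycles n (n+1) g := by
      apply (ModuleCat.mono_iff_injective _).1 (inferInstance : Mono (K.iCycles (n+1)))
      rw [← hg]
      exact (ConcreteCategory.congr_hom (K.toCycles_i n (n+1)) g).symm
    have h2 : K.homologyπ (n+1) z = 0 := by
      rw [this]
      exact (ConcreteCategory.congr_hom (K.toCycles_comp_homologyπ n (n+1)) g)
    erw [h2, map_zero]; rfl

lemma ERep.nat {A' : ModuleCat.{u} R} (P' : ProjectiveResolution A') {g : A' ⟶ A}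
    (φ : ProjectiveResolution.Hom P' P g) {f : P.complex.X n ⟶ B} {x} (h : ERep P f x) :
    ERep P' (φ.hom.f n ≫ f) (ExtMod.pull n g B x) := by
  let K := P.complex.linearYonedaObj R B
  let K' := P'.complex.linearYonedaObj R B
  let ψ : K ⟶ K' := (HomologicalComplex.unopFunctor _ _).map
     ((((linearYoneda R (ModuleCat.{u} R)).obj B).rightOp.mapHomologicalComplex _).map φ.hom).op
  obtain ⟨z, rfl, rfl⟩ := h
  have key : (P.isoExt (R := R) n B).inv ≫ ExtMod.pull n g B =
     HomologicalComplex.homologyMap ψ n ≫ (P'.isoExt (R := R) n B).inv := by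
    let F := ((linearYoneda R (ModuleCat.{u} R)).obj B).rightOp
    have h1 := P'.isoLeftDerivedObj_hom_naturality g P φ.hom
      (by simpa using φ.hom_f_zero_comp_π_f_zero) F n
    have h2 := congrArg Quiver.Hom.unop h1
    have h3 := congrArg Quiver.Hom.unop (HomologicalComplex.homologyOp_hom_naturality ψ n)
    change ((K.homologyOp n).hom.unop ≫ (P.isoLeftDerivedObj F n).hom.unop) ≫
      ((F.leftDerived n).map g).unop = _ ≫ (K'.homologyOp n).hom.unop ≫ (P'.isoLeftDerivedObj F n).hom.unop
    exact comp_aux _ _ _ _ _ _ _ h2 h3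
  refine ⟨HomologicalComplex.cyclesMap ψ n z, ?_, ?_⟩
  · have := ConcreteCategory.congr_hom (HomologicalComplex.cyclesMap_i ψ n) z
    exact this
  · have := ConcreteCategory.congr_hom key (K.homologyπ n z)
    refine Eq.trans ?_ this.symm
    have := ConcreteCategory.congr_hom (HomologicalComplex.homologyπ_naturality ψ n) z
    exact congrArg (P'.isoExt (R := R) n B).inv this.symm
end


section
variable {A B : ModuleCat.{u} R} (P : ProjectiveResolution A) {n : ℕ}

lemma ERep.sub {f g : P.complex.X n ⟶ B} {x y} (h : ERep P f x) (h' : ERep P g y) :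
    ERep P (f-g) (x-y) := by
  have := h.add P (h'.smul P (-1 : R))
  simpa [sub_eq_add_neg] using this

lemma ERep.sum {ι : Type*} (s : Finset ι) {f : ι → (P.complex.X n ⟶ B)} {x : ι → ExtMod R n A B}
    (h : ∀ i, ERep P (f i) (x i)) : ERep P (∑ i ∈ s, f i) (∑ i ∈ s, x i) := by
  classical
  induction s using Finset.induction_on with
  | empty => simpa using ERep.zero P
  | insert a s ha ih => rw [Finset.sum_insert ha, Finset.sum_insert ha]; exact (h a).add P ih

lemma ERep.extMk_eq_iff {f g : P.complex.X (n+1) ⟶ B} {x y} (h : ERep P f x) (h' : ERep P g y) :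
    P.extMk f _ rfl (h.cocycle P) = P.extMk g _ rfl (h'.cocycle P) ↔ x = y := by
  rw [← sub_eq_zero, P.sub_extMk, P.extMk_eq_zero_iff _ _ rfl _ n rfl, ← sub_eq_zero (a := x),
    (h.sub P h').zero_iff P]

lemma ERep.smul_extMk (f : P.complex.X n ⟶ B) (h : P.complex.d (n+1) n ≫ f = 0) (r : R) :
    r • P.extMk f _ rfl h = P.extMk (r • f) _ rfl (by simp [h]) := by
  rw [Abelian.Ext.smul_eq_comp_mk₀, P.extMk_comp_mk₀]
  congr 1

/-- relation between the two kinds of Ext -/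
def PRel (ξ : Abelian.Ext.{u} A B (n+1)) (x : ExtMod R (n+1) A B) : Prop :=
  ∃ (f : P.complex.X (n+1) ⟶ B) (h : ERep P f x), P.extMk f _ rfl (h.cocycle P) = ξ

lemma PRel.total (ξ : Abelian.Ext.{u} A B (n+1)) : ∃ x, PRel P ξ x := by
  obtain ⟨f, hf, rfl⟩ := P.extMk_surjective ξ _ rfl
  obtain ⟨x, hx⟩ := ERep.exist P hf
  exact ⟨x, f, hx, rfl⟩

lemma PRel.surj (x : ExtMod R (n+1) A B) : ∃ ξ : Abelian.Ext.{u} A B (n+1), PRel P ξ x := by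
  obtain ⟨f, hf⟩ := ERep.surj P x
  exact ⟨_, f, hf, rfl⟩

lemma PRel.uniq_iff {ξ η : Abelian.Ext.{u} A B (n+1)} {x y} (h : PRel P ξ x) (h' : PRel P η y) :
    ξ = η ↔ x = y := by
  obtain ⟨f, h, rfl⟩ := h
  obtain ⟨g, h', rfl⟩ := h'
  exact ERep.extMk_eq_iff P h h'

/-- comparison -/
def extCmp (A B : ModuleCat.{u} R) (n : ℕ) : Abelian.Ext.{u} A B (n+1) ≃ₗ[R] ExtMod R (n+1) A B :=
  LinearEquiv.ofBijective
    { toFun := fun ξ => (PRel.total (projectiveResolution A) ξ).choose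
      map_add' := fun ξ η => by
        obtain ⟨f, hf, h1⟩ := (PRel.total (projectiveResolution A) ξ).choose_spec
        obtain ⟨g, hg, h2⟩ := (PRel.total (projectiveResolution A) η).choose_spec
        refine (PRel.uniq_iff _ (PRel.total (projectiveResolution A) (ξ + η)).choose_spec 
          (η := ξ + η) ?_).1 rfl
        refine ⟨f + g, hf.add _ hg, ?_⟩
        rw [← ProjectiveResolution.add_extMk _ _ _ _ _ (hf.cocycle _) (hg.cocycle _), h1, h2]
      map_smul' := fun r ξ => by
        obtain ⟨f, hf, h1⟩ := (PRel.total (projectiveResolution A) ξ).choose_spec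
        refine (PRel.uniq_iff _ (PRel.total (projectiveResolution A) (r • ξ)).choose_spec 
          (η := r • ξ) ?_).1 rfl
        refine ⟨r • f, hf.smul _ r, ?_⟩
        rw [← ERep.smul_extMk _ _ (hf.cocycle _), h1] }
    ⟨fun ξ η h => (PRel.uniq_iff _ (PRel.total (projectiveResolution A) ξ).choose_spec
        (PRel.total (projectiveResolution A) η).choose_spec).2 h, fun x => by
      obtain ⟨ξ, h⟩ := PRel.surj (projectiveResolution A) x
      exact ⟨ξ, (PRel.uniq_iff _ (PRel.total (projectiveResolution A) ξ).choose_spec h).1 rfl⟩⟩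

lemma extCmp_rel (A B : ModuleCat.{u} R) (n : ℕ) (ξ : Abelian.Ext.{u} A B (n+1)) :
    PRel (projectiveResolution A) ξ (extCmp A B n ξ) :=
  (PRel.total (projectiveResolution A) ξ).choose_spec

def liftHom {A A' : ModuleCat.{u} R} (P : ProjectiveResolution A) (P' : ProjectiveResolution A')
    (g : A' ⟶ A) : ProjectiveResolution.Hom P' P g where
  hom := ProjectiveResolution.lift g P' P
  hom_f_zero_comp_π_f_zero := by
    have := ProjectiveResolution.lift_commutes g P' P
    have := HomologicalComplex.congr_hom this 0
    exact this

lemma extCmp_nat {A A' B : ModuleCat.{u} R} (g : A' ⟶ A) (n : ℕ) (ξ : Abelian.Ext.{u} A B (n+1)) :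
    extCmp A' B n ((Abelian.Ext.mk₀ g).comp ξ (zero_add _)) = ExtMod.pull (n+1) g B (extCmp A B n ξ) := by
  obtain ⟨f, hf, h1⟩ := extCmp_rel A B n ξ
  let φ := liftHom (projectiveResolution A) (projectiveResolution A') g
  refine (PRel.uniq_iff _ (extCmp_rel A' B n ((Abelian.Ext.mk₀ g).comp ξ (zero_add _)))
    ⟨_, hf.nat _ _ φ, rfl⟩).1 ?_
  refine (congrArg (fun ζ => (Abelian.Ext.mk₀ g).comp ζ (zero_add _)) h1.symm).trans ?_
  exact ProjectiveResolution.mk₀_comp_extMk _ _ rfl _ φ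

lemma ExtMod.pull_zero (A A' B : ModuleCat.{u} R) (n : ℕ) :
    ExtMod.pull n (0 : A' ⟶ A) B = 0 := by
  let F := ((linearYoneda R (ModuleCat.{u} R)).obj B).rightOp
  change ((F.leftDerived n).map 0).unop = 0
  rw [F.leftDerived_map_eq n (P := projectiveResolution A') (Q := projectiveResolution A) 0 0
    (by simp)]
  simp only [Functor.map_zero, Limits.zero_comp, Limits.comp_zero]; rfl

lemma ExtMod.smul_eq_zero {J : Ideal R} (a : R) (ha : a ∈ J) (B : ModuleCat.{u} R) (n : ℕ)
    (x : ExtMod R n (ModuleCat.of R (R ⧸ J)) B) : a • x = 0 := by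
  let P := projectiveResolution (ModuleCat.of R (R ⧸ J))
  have h0 : a • 𝟙 (ModuleCat.of R (R ⧸ J)) = 0 := by
    ext
    change Ideal.Quotient.mk J a * 1 = 0
    rw [Ideal.Quotient.eq_zero_iff_mem.2 ha, zero_mul]
  let p : P.complex.X 0 ⟶ ModuleCat.of R (R ⧸ J) := P.π.f 0
  have hp : (a • 𝟙 (P.complex.X 0)) ≫ p = 0 := by
    have : p ≫ (a • 𝟙 (ModuleCat.of R (R ⧸ J))) = 0 := by rw [h0]; simp
    simpa using this
  let φ : ProjectiveResolution.Hom P P (0 : ModuleCat.of R (R ⧸ J) ⟶ ModuleCat.of R (R ⧸ J)) :=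
    { hom := a • 𝟙 _
      hom_f_zero_comp_π_f_zero := by
        rw [Functor.map_zero, HomologicalComplex.zero_f, Limits.comp_zero]
        exact hp }
  obtain ⟨f, hf⟩ := ERep.surj P x
  have h1 := hf.nat P P φ
  rw [ExtMod.pull_zero] at h1
  have h2 := hf.smul P a
  have : φ.hom.f n ≫ f = a • f := by simp [φ]
  rw [this] at h1
  exact ERep.uniq P h2 h1

lemma ExtMod.subsingleton_of_endos {J : Ideal R} (X : ModuleCat.{u} R) {k : ℕ} (a : Fin k → R)
    (ha : ∀ l, a l ∈ J) (s : Fin k → (X ⟶ X)) (h : ∑ l, a l • s l = 𝟙 X) (j : ℕ) :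
    Subsingleton (ExtMod R j (ModuleCat.of R (R ⧸ J)) X) := by
  let P := projectiveResolution (ModuleCat.of R (R ⧸ J))
  refine subsingleton_of_forall_eq 0 fun x => ?_
  obtain ⟨f, hf⟩ := ERep.surj P x
  have hc := hf.cocycle P
  have h1 : ∀ l, ∃ y, ERep P (f ≫ s l) y := fun l => ERep.exist P (by
    rw [← Category.assoc, hc, Limits.zero_comp])
  choose y hy using h1
  have h2 := ERep.sum P Finset.univ (fun l => (hy l).smul P (a l))
  have h3 : ∑ l, a l • (f ≫ s l) = f := by
    conv_rhs => rw [← Category.comp_id f, ← h]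
    rw [Preadditive.comp_sum]
    simp
  rw [h3] at h2
  rw [ERep.uniq P hf h2]
  exact Finset.sum_eq_zero fun l _ => ExtMod.smul_eq_zero _ (ha l) _ _ _
end


/-- quotient map -/
def qmap {L' L : Ideal R} (h : L' ≤ L) : ModuleCat.of R (R ⧸ L') ⟶ ModuleCat.of R (R ⧸ L) :=
  ModuleCat.ofHom (Submodule.mapQ L' L LinearMap.id h)

lemma qmap_comp {L'' L' L : Ideal R} (h' : L'' ≤ L') (h : L' ≤ L) :
    qmap h' ≫ qmap h = qmap (h'.trans h) := by
  ext; rfl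

lemma qmap_pull {L'' L' L : Ideal R} (h' : L'' ≤ L') (h : L' ≤ L) {N : ModuleCat.{u} R} {i : ℕ}
    (ξ : Abelian.Ext.{u} (ModuleCat.of R (R ⧸ L)) N i) :
    (Abelian.Ext.mk₀ (qmap h')).comp ((Abelian.Ext.mk₀ (qmap h)).comp ξ (zero_add i)) (zero_add i) =
    (Abelian.Ext.mk₀ (qmap (h'.trans h))).comp ξ (zero_add i) := by
  rw [← qmap_comp h' h, Abelian.Ext.mk₀_comp_mk₀_assoc]

/-- elementwise vanishing of local cohomology -/
def Van (J : Ideal R) (i : ℕ) (N : ModuleCat.{u} R) : Prop :=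
  ∀ (L : Ideal R) (t : ℕ), J ^ t ≤ L → ∀ ξ : Abelian.Ext.{u} (ModuleCat.of R (R ⧸ L)) N i,
    ∃ (n : ℕ) (h : J ^ n ≤ L), (Abelian.Ext.mk₀ (qmap h)).comp ξ (zero_add i) = 0

/-- it suffices to die on a smaller ideal -/
lemma Van.mk_of {J : Ideal R} {i : ℕ} {N : ModuleCat.{u} R} {L L' : Ideal R} (h : L' ≤ L) {t : ℕ}
    (ht : J ^ t ≤ L') (ξ : Abelian.Ext.{u} (ModuleCat.of R (R ⧸ L)) N i)
    (h0 : (Abelian.Ext.mk₀ (qmap h)).comp ξ (zero_add i) = 0) :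
    ∃ (n : ℕ) (h : J ^ n ≤ L), (Abelian.Ext.mk₀ (qmap h)).comp ξ (zero_add i) = 0 :=
  ⟨t, ht.trans h, by rw [← qmap_pull ht h, h0, Abelian.Ext.comp_zero]⟩

/-- multiplication by `c` between quotients -/
def mulq {L' L : Ideal R} (c : R) (h : ∀ x ∈ L', c * x ∈ L) :
    ModuleCat.of R (R ⧸ L') ⟶ ModuleCat.of R (R ⧸ L) :=
  ModuleCat.ofHom (Submodule.mapQ L' L (LinearMap.lsmul R R c) h)

lemma mulq_comp_qmap {L'' L' L : Ideal R} (c : R) (h : ∀ x ∈ L'', c * x ∈ L') (h' : L' ≤ L) :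
    mulq c h ≫ qmap h' = mulq c (fun x hx => h' (h x hx)) := by
  ext; rfl

/-- `(K : b)` -/
def colonEl (K : Ideal R) (b : R) : Ideal R := Submodule.comap (LinearMap.lsmul R R b) K

lemma mem_colonEl {K : Ideal R} {b x : R} : x ∈ colonEl K b ↔ b * x ∈ K := Iff.rfl

abbrev colonSC (K : Ideal R) (b : R) : ShortComplex (ModuleCat.{u} R) where
  X₁ := ModuleCat.of R (R ⧸ colonEl K b)
  X₂ := ModuleCat.of R (R ⧸ K)
  X₃ := ModuleCat.of R (R ⧸ (K ⊔ Ideal.span {b}))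
  f := mulq b (fun _ hx => hx)
  g := qmap le_sup_left
  zero := by
    ext
    change (Submodule.Quotient.mk (b * 1) : R ⧸ (K ⊔ Ideal.span {b})) = 0
    rw [Submodule.Quotient.mk_eq_zero, mul_one]
    exact (le_sup_right : _ ≤ K ⊔ Ideal.span {b}) (Ideal.mem_span_singleton_self b)

lemma colonSC_shortExact (K : Ideal R) (b : R) : (colonSC K b).ShortExact := by
  apply ModuleCat.shortComplex_shortExact
  · intro y
    obtain ⟨y, rfl⟩ := Submodule.Quotient.mk_surjective _ y
    constructor
    · intro h
      change (Submodule.Quotient.mk y : R ⧸ (K ⊔ Ideal.span {b})) = 0 at h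
      rw [Submodule.Quotient.mk_eq_zero, Submodule.mem_sup] at h
      obtain ⟨k, hk, z, hz, rfl⟩ := h
      obtain ⟨c, rfl⟩ := Ideal.mem_span_singleton'.1 hz
      refine ⟨Submodule.Quotient.mk c, ?_⟩
      change (Submodule.Quotient.mk (b * c) : R ⧸ K) = Submodule.Quotient.mk (k + c * b)
      rw [Submodule.Quotient.eq]
      convert K.neg_mem hk using 1
      ring
    · rintro ⟨x, hx⟩
      rw [← hx]
      exact ConcreteCategory.congr_hom (colonSC K b).zero x
  · change Function.Injective (mulq b (fun _ hx => hx) : ModuleCat.of R (R ⧸ colonEl K b) ⟶ _).hom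
    rw [← LinearMap.ker_eq_bot, LinearMap.ker_eq_bot']
    intro x hx
    obtain ⟨x, rfl⟩ := Submodule.Quotient.mk_surjective _ x
    change (Submodule.Quotient.mk (b * x) : R ⧸ K) = 0 at hx
    rw [Submodule.Quotient.mk_eq_zero] at hx ⊢
    exact hx
  · intro y
    obtain ⟨y, rfl⟩ := Submodule.Quotient.mk_surjective _ y
    exact ⟨Submodule.Quotient.mk y, rfl⟩

/-- morphism of short complexes -/
def colonSCMap {K' K : Ideal R} (h : K' ≤ K) (b c : R) : colonSC K' (b * c) ⟶ colonSC K b where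
  τ₁ := mulq c (fun x hx => by
    rw [mem_colonEl] at hx ⊢
    rw [← mul_assoc]
    exact h hx)
  τ₂ := qmap h
  τ₃ := qmap (sup_le_sup h (by
    rw [Ideal.span_singleton_le_span_singleton]; exact dvd_mul_right b c))
  comm₁₂ := by
    refine ModuleCat.hom_ext (LinearMap.ext fun y => ?_)
    obtain ⟨y, rfl⟩ := Submodule.Quotient.mk_surjective _ y
    change (Submodule.Quotient.mk (b * (c * y)) : R ⧸ K) = Submodule.Quotient.mk (b * c * y)
    rw [mul_assoc]
  comm₂₃ := by
    refine ModuleCat.hom_ext (LinearMap.ext fun y => ?_)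
    obtain ⟨y, rfl⟩ := Submodule.Quotient.mk_surjective _ y
    rfl

lemma artin_rees_aux [IsNoetherianRing R] (K : Ideal R) (a : R) (v w : ℕ) :
    ∃ v' u', w ≤ u' ∧ ∀ x, a ^ v * a ^ v' * x ∈ K ^ u' → a ^ v' * x ∈ K ^ w := by
  obtain ⟨v', hv'⟩ := (monotone_stabilizes_iff_noetherian (R := R) (M := R)).2 inferInstance
    ⟨fun m => colonEl ⊥ (a ^ m), fun m n h x hx => by
      rw [mem_colonEl] at hx ⊢
      rw [← Nat.sub_add_cancel h, pow_add, mul_assoc, Ideal.mem_bot.1 hx, mul_zero]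
      exact Submodule.zero_mem _⟩
  obtain ⟨k, hk⟩ := Ideal.exists_pow_inf_eq_pow_smul K (M := R) (Ideal.span {a ^ v * a ^ v'})
  refine ⟨v', w + k, by omega, fun x hx => ?_⟩
  have h1 : a ^ v * a ^ v' * x ∈ K ^ (w + k - k) • (K ^ k • (⊤ : Submodule R R) ⊓ Ideal.span {a ^ v * a ^ v'}) := by
    rw [← hk (w + k) (by omega)]
    exact ⟨by simpa using hx, Ideal.mem_span_singleton.2 (dvd_mul_right _ _)⟩
  have h2 : a ^ v * a ^ v' * x ∈ K ^ w * Ideal.span {a ^ v * a ^ v'} := by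
    rw [Nat.add_sub_cancel] at h1
    exact Submodule.smul_mono le_rfl inf_le_right h1
  obtain ⟨y, hy, hyx⟩ := Ideal.mem_mul_span_singleton.1 h2
  have h3 : x - y ∈ colonEl ⊥ (a ^ (v' + v)) := by
    rw [mem_colonEl, Ideal.mem_bot, pow_add, mul_sub, sub_eq_zero, mul_comm (a ^ v'), ← hyx]
    ring
  have h4 : x - y ∈ colonEl ⊥ (a ^ v') := by
    have := hv' (v' + v) (by omega)
    change colonEl ⊥ (a ^ v') = colonEl ⊥ (a ^ (v' + v)) at this
    rw [this]; exact h3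
  rw [mem_colonEl, Ideal.mem_bot, mul_sub, sub_eq_zero] at h4
  rw [h4]
  exact Ideal.mul_mem_left _ _ hy

lemma ext_R_zero (N : ModuleCat.{u} R) (i : ℕ) (hi : 0 < i) (P : Type u) [AddCommGroup P] [Module R P]
    [Module.Projective R P] (ξ : Abelian.Ext.{u} (ModuleCat.of R P) N i) : ξ = 0 := by
  obtain ⟨i, rfl⟩ := Nat.exists_eq_succ_of_ne_zero hi.ne'
  have : Projective (ModuleCat.of R P) := ModuleCat.projective_of_categoryTheory_projective _
  exact ξ.eq_zero_of_projective


open Abelian in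
lemma Van.step [IsNoetherianRing R] {J' : Ideal R} (a : R) {r : ℕ}
    (H : ∀ (N : ModuleCat.{u} R) (i : ℕ), r < i → Van J' i N) (N : ModuleCat.{u} R) (i : ℕ)
    (hi : r + 1 < i) : Van (J' ⊔ Ideal.span {a}) i N := by
  intro L t ht ξ
  have h1 : J' ^ t ≤ L := (Ideal.pow_right_mono le_sup_left t).trans ht
  have h2 : a ^ t ∈ L := ht (Ideal.pow_mem_pow
    ((le_sup_right : _ ≤ J' ⊔ Ideal.span {a}) (Ideal.mem_span_singleton_self a)) t)
  obtain ⟨t1, ht1, hξ⟩ := H N i (by omega) L t h1 ξ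
  have hKL : J' ^ t1 ⊔ Ideal.span {a ^ t} ≤ L :=
    sup_le ht1 ((Ideal.span_singleton_le_iff_mem L).2 h2)
  obtain ⟨j, rfl⟩ : ∃ j, i = 1 + j := ⟨i - 1, by omega⟩
  obtain ⟨η, hη⟩ := Ext.contravariant_sequence_exact₃ (colonSC_shortExact (J' ^ t1) (a ^ t)) N
    ((Ext.mk₀ (qmap hKL)).comp ξ (zero_add _)) (by
      refine Eq.trans ?_ hξ
      exact qmap_pull (le_sup_left) hKL ξ) rfl
  obtain ⟨t2, ht2, hη2⟩ := H N j (by omega) (colonEl (J' ^ t1) (a ^ t)) t1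
    (fun x hx => Ideal.mul_mem_left _ _ hx) η
  obtain ⟨v', u', hu, har⟩ := artin_rees_aux J' a t (max t1 t2)
  have hK : J' ^ u' ≤ J' ^ t1 := Ideal.pow_le_pow_right (by omega)
  let f := colonSCMap hK (a ^ t) (a ^ v')
  have hnat := ShortComplex.ShortExact.extClass_naturality
    (colonSC_shortExact (J' ^ u') (a ^ t * a ^ v')) (colonSC_shortExact (J' ^ t1) (a ^ t)) f
  have hm : ∀ x ∈ colonEl (J' ^ u') (a ^ t * a ^ v'), a ^ v' * x ∈ J' ^ t2 := fun x hx =>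
    Ideal.pow_le_pow_right (le_max_right t1 t2) (har x hx)
  have hτ : f.τ₁ = mulq (a ^ v') hm ≫ qmap ht2 := (mulq_comp_qmap _ _ _).symm
  have hz : (Ext.mk₀ f.τ₁).comp η (zero_add j) = 0 := by
    rw [hτ]
    refine (Ext.mk₀_comp_mk₀_assoc _ _ _).symm.trans ?_
    rw [hη2, Ext.comp_zero]
  have hle : J' ^ u' ⊔ Ideal.span {a ^ t * a ^ v'} ≤ J' ^ t1 ⊔ Ideal.span {a ^ t} :=
    sup_le_sup hK (by rw [Ideal.span_singleton_le_span_singleton]; exact dvd_mul_right _ _)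
  refine Van.mk_of (hle.trans hKL) (t := u' + (t + v')) ?_ ξ ?_
  · rw [← pow_add, ← Ideal.span_singleton_pow]
    exact Ideal.sup_pow_add_le_pow_sup_pow
  · rw [← qmap_pull hle hKL]
    change (Ext.mk₀ f.τ₃).comp _ _ = 0
    rw [← hη, ← Ext.comp_assoc (a₁₂ := 1) _ _ _ (by lia) (by lia) (by lia), ← hnat,
      Ext.comp_assoc (a₁₂ := 1) (a₂₃ := j) _ _ _ (by lia) (by lia) (by lia), hz, Ext.comp_zero]

lemma Van.bound [IsNoetherianRing R] (J : Ideal R) :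
    ∃ r, ∀ (N : ModuleCat.{u} R) (i : ℕ), r < i → Van J i N := by
  classical
  have key : ∀ s : Finset R, ∃ r, ∀ (N : ModuleCat.{u} R) (i : ℕ), r < i →
      Van (Ideal.span (s : Set R)) i N := by
    intro s
    induction s using Finset.induction_on with
    | empty =>
      refine ⟨0, ?_⟩
      intro N i hi L t ht ξ
      have hb : Ideal.span ((∅ : Finset R) : Set R) = ⊥ := by simp
      rw [hb]
      refine ⟨1, by simp, ?_⟩
      have : Module.Projective R (R ⧸ (⊥ : Ideal R) ^ 1) :=
        Module.Projective.of_equiv (Submodule.quotEquivOfEqBot ((⊥ : Ideal R) ^ 1) (by simp)).symm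
      exact ext_R_zero N i hi _ _
    | insert a s _ ih =>
      obtain ⟨r, hr⟩ := ih
      refine ⟨r + 1, fun N i hi => ?_⟩
      rw [Finset.coe_insert, Ideal.span_insert, sup_comm]
      exact Van.step a hr N i hi
  obtain ⟨s, hs⟩ := IsNoetherian.noetherian J
  obtain ⟨r, hr⟩ := key s
  refine ⟨r, fun N i hi => ?_⟩
  rw [← hs]
  exact hr N i hi

open Abelian in
lemma Van.pi {J : Ideal R} {i : ℕ} (H : Van J i (ModuleCat.of R R)) (k : ℕ) :
    Van J i (ModuleCat.of R (Fin k → R)) := by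
  intro L t ht ξ
  let p : Fin k → (ModuleCat.of R (Fin k → R) ⟶ ModuleCat.of R R) :=
    fun l => ModuleCat.ofHom (LinearMap.proj l)
  let s : Fin k → (ModuleCat.of R R ⟶ ModuleCat.of R (Fin k → R)) :=
    fun l => ModuleCat.ofHom (LinearMap.single R (fun _ => R) l)
  have hid : ∑ l, p l ≫ s l = 𝟙 _ := by
    ext x m
    simp [p, s, ModuleCat.hom_sum]
  choose n hn h using fun l => H L t ht (ξ.comp (Ext.mk₀ (p l)) (add_zero i))
  have hN : J ^ (t + ∑ l, n l) ≤ L := (Ideal.pow_le_pow_right (by omega)).trans ht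
  refine ⟨t + ∑ l, n l, hN, ?_⟩
  have h2 : ∀ l, ((Ext.mk₀ (qmap hN)).comp ξ (zero_add i)).comp (Ext.mk₀ (p l)) (add_zero i) = 0 := by
    intro l
    have hle : J ^ (t + ∑ l, n l) ≤ J ^ (n l) := Ideal.pow_le_pow_right
      ((Finset.single_le_sum (fun _ _ => Nat.zero_le _) (Finset.mem_univ l)).trans (by omega))
    rw [Ext.comp_assoc (a₂₃ := i) _ _ _ (by lia) (by lia) (by lia), ← qmap_pull hle (hn l), h l,
      Ext.comp_zero]
  rw [← Ext.comp_mk₀_id ((Ext.mk₀ (qmap hN)).comp ξ (zero_add i)), ← hid, Ext.mk₀_sum, Ext.comp_sum]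
  refine Finset.sum_eq_zero fun l _ => ?_
  rw [← Ext.mk₀_comp_mk₀, ← Ext.comp_assoc (a₁₂ := i) _ _ _ (by lia) (by lia) (by lia), h2, Ext.zero_comp]

/-- presentation -/
abbrev presSC {N : Type u} [AddCommGroup N] [Module R N] {k : ℕ} (p : (Fin k → R) →ₗ[R] N) :
    ShortComplex (ModuleCat.{u} R) := LinearMap.shortComplexKer p

lemma presSC_shortExact {N : Type u} [AddCommGroup N] [Module R N] {k : ℕ} (p : (Fin k → R) →ₗ[R] N)
    (hp : Function.Surjective p) : (presSC p).ShortExact :=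
  LinearMap.shortExact_shortComplexKer hp

open Abelian in
lemma Van.fg [IsNoetherianRing R] {J : Ideal R}
    (H : ∀ i, 2 ≤ i → Van J i (ModuleCat.of R R)) (N : Type u) [AddCommGroup N] [Module R N]
    [Module.Finite R N] (i : ℕ) (hi : 2 ≤ i) : Van J i (ModuleCat.of R N) := by
  obtain ⟨r, hr⟩ := Van.bound J
  suffices h : ∀ d, ∀ (N : Type u) [AddCommGroup N] [Module R N] [Module.Finite R N] (i : ℕ),
      2 ≤ i → r < i + d → Van J i (ModuleCat.of R N) from h (r + 1) N i hi (by omega)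
  intro d
  induction d with
  | zero => intro N _ _ _ i _ h; exact hr _ _ h
  | succ d ih =>
    intro N _ _ _ i hi h
    obtain ⟨k, p, hp⟩ := Module.Finite.exists_fin' R N
    intro L t ht ξ
    have hS := presSC_shortExact p hp
    obtain ⟨n, hn, h0⟩ := ih (LinearMap.ker p) (i + 1) (by omega) (by omega) L t ht
      (ξ.comp hS.extClass rfl)
    obtain ⟨ζ, hζ⟩ := Ext.covariant_sequence_exact₃ _ hS
      ((Ext.mk₀ (qmap hn)).comp ξ (zero_add i)) rfl (by
        rw [Ext.comp_assoc (a₂₃ := i + 1) _ _ _ (by lia) (by lia) (by lia)]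
        exact h0)
    obtain ⟨m, hm, h1⟩ := Van.pi (H i hi) k (J ^ n) n le_rfl ζ
    refine ⟨m, hm.trans hn, ?_⟩
    rw [← qmap_pull hm hn, ← hζ, ← Ext.comp_assoc (a₁₂ := i) _ _ _ (by lia) (by lia) (by lia)]
    erw [h1]
    exact Ext.zero_comp ..

/-- `0 → L → R → R/L → 0` -/
abbrev idealSC (L : Ideal R) : ShortComplex (ModuleCat.{u} R) where
  X₁ := ModuleCat.of R L
  X₂ := ModuleCat.of R R
  X₃ := ModuleCat.of R (R ⧸ L)
  f := ModuleCat.ofHom L.subtype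
  g := ModuleCat.ofHom (Submodule.mkQ L)
  zero := by
    ext x
    exact (Submodule.Quotient.mk_eq_zero L).2 x.2

lemma idealSC_shortExact (L : Ideal R) : (idealSC L).ShortExact := by
  apply ModuleCat.shortComplex_shortExact
  · exact LinearMap.exact_subtype_mkQ L
  · exact Subtype.val_injective
  · exact Submodule.mkQ_surjective L

def inclHom {L' L : Ideal R} (h : L' ≤ L) : ModuleCat.of R L' ⟶ ModuleCat.of R L :=
  ModuleCat.ofHom (Submodule.inclusion h)

def idealSCMap {L' L : Ideal R} (h : L' ≤ L) : idealSC L' ⟶ idealSC L where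
  τ₁ := inclHom h
  τ₂ := 𝟙 _
  τ₃ := qmap h
  comm₁₂ := by ext; rfl
  comm₂₃ := by ext; rfl

open Abelian in
lemma idealSC_nat {L' L : Ideal R} (h : L' ≤ L) :
    (Ext.mk₀ (qmap h)).comp (idealSC_shortExact L).extClass (zero_add 1) =
    (idealSC_shortExact L').extClass.comp (Ext.mk₀ (inclHom h)) (add_zero 1) :=
  (ShortComplex.ShortExact.extClass_naturality (idealSC_shortExact L') (idealSC_shortExact L)
    (idealSCMap h)).symm

open Abelian in
lemma exists_star [IsNoetherianRing R] {J : Ideal R}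
    (H : ∀ i, 2 ≤ i → Van J i (ModuleCat.of R R)) :
    ∃ (n k : ℕ) (a : Fin k → R) (s : Fin k → ((J ^ n : Ideal R) →ₗ[R] R)), (∀ l, a l ∈ J) ∧
      ∀ x : (J ^ n : Ideal R), ∑ l, a l * s l x = x := by
  obtain ⟨k, p, hp⟩ := Module.Finite.exists_fin' R J
  have hS := presSC_shortExact p hp
  obtain ⟨n, hn, h0⟩ := Van.fg H (LinearMap.ker p) 2 le_rfl J 1 (by simp)
    ((idealSC_shortExact J).extClass.comp hS.extClass rfl)
  rw [← Ext.comp_assoc (a₁₂ := 1) _ _ _ (by lia) (by lia) (by lia), idealSC_nat hn,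
    Ext.comp_assoc (a₂₃ := 1) _ _ _ (by lia) (by lia) (by lia)] at h0
  obtain ⟨z, hz⟩ := Ext.contravariant_sequence_exact₁ (idealSC_shortExact (J ^ n)) _ _ _ h0
  have hz0 : z = 0 := ext_R_zero _ 1 one_pos R z
  rw [hz0, Ext.comp_zero] at hz
  obtain ⟨σ, hσ⟩ := Ext.covariant_sequence_exact₃ _ hS (Ext.mk₀ (inclHom hn)) (zero_add 1) hz.symm
  obtain ⟨σ, rfl⟩ := (Ext.mk₀_bijective _ _).2 σ
  rw [Ext.mk₀_comp_mk₀] at hσ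
  have hσ := (Ext.mk₀_bijective _ _).1 hσ
  refine ⟨n, k, fun l => (p (Pi.single l 1) : J), fun l => LinearMap.proj l ∘ₗ σ.hom, fun l =>
    (p (Pi.single l 1)).2, fun x => ?_⟩
  have hx : ((p (σ.hom x) : J) : R) = x := congrArg Subtype.val (ConcreteCategory.congr_hom hσ x)
  conv_rhs => rw [← hx, LinearMap.pi_apply_eq_sum_univ p (σ.hom x)]
  simp only [AddSubmonoidClass.coe_finsetSum, Submodule.coe_smul, smul_eq_mul]
  refine Finset.sum_congr rfl fun l _ => ?_
  rw [mul_comm]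
  have hl : (Pi.single l 1 : Fin k → R) = fun j => if l = j then 1 else 0 := by
    ext j; simp [Pi.single_apply, eq_comm]
  rw [hl]
  rfl


/-- the `t`-th structure map of local cohomology -/
def lcι (I : Ideal R) (i : ℕ) (M : ModuleCat.{u} R) (t : ℕ) :
    ExtMod R i (ModuleCat.of R (R ⧸ I ^ t)) M ⟶ (localCohomology I i).obj M :=
  (Limits.colimit.ι (localCohomology.diagram (localCohomology.idealPowersDiagram I) i)
    (Opposite.op (Opposite.op t))).app M

/-- colimit cocone evaluated at `M` -/
def lcCol (I : Ideal R) (i : ℕ) (M : ModuleCat.{u} R) :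
    Limits.IsColimit (((evaluation (ModuleCat.{u} R) (ModuleCat.{u} R)).obj M).mapCocone
      (Limits.colimit.cocone
        (localCohomology.diagram (localCohomology.idealPowersDiagram I) i))) :=
  Limits.isColimitOfPreserves ((evaluation _ _).obj M) (Limits.colimit.isColimit _)

lemma lcι_w (I : Ideal R) (i : ℕ) (M : ModuleCat.{u} R) {t t' : ℕ} (h : t ≤ t') :
    ExtMod.pull i (qmap (Ideal.pow_le_pow_right h : I ^ t' ≤ I ^ t)) M ≫ lcι I i M t' =
      lcι I i M t :=
  (((evaluation (ModuleCat.{u} R) (ModuleCat.{u} R)).obj M).mapCocone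
      (Limits.colimit.cocone
        (localCohomology.diagram (localCohomology.idealPowersDiagram I) i))).w
    (homOfLE h).op.op

lemma lc_hom_ext (I : Ideal R) (i : ℕ) (M : ModuleCat.{u} R) {X : ModuleCat.{u} R}
    (f g : (localCohomology I i).obj M ⟶ X) (h : ∀ t, lcι I i M t ≫ f = lcι I i M t ≫ g) :
    f = g :=
  (lcCol I i M).hom_ext fun t => h t.unop.unop

lemma lc_desc (I : Ideal R) (i : ℕ) (M : ModuleCat.{u} R) {X : ModuleCat.{u} R}
    (f : ∀ t, ExtMod R i (ModuleCat.of R (R ⧸ I ^ t)) M ⟶ X)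
    (hf : ∀ t t' (h : t ≤ t'),
      ExtMod.pull i (qmap (Ideal.pow_le_pow_right h : I ^ t' ≤ I ^ t)) M ≫ f t' = f t) :
    ∃ g : (localCohomology I i).obj M ⟶ X, ∀ t, lcι I i M t ≫ g = f t := by
  let c : Limits.Cocone (localCohomology.diagram (localCohomology.idealPowersDiagram I) i ⋙
      (evaluation (ModuleCat.{u} R) (ModuleCat.{u} R)).obj M) :=
    { pt := X
      ι := 
        { app := fun t => f t.unop.unop
          naturality := fun s t φ => by
            refine Eq.trans ?_ (Category.comp_id _).symm
            exact hf s.unop.unop t.unop.unop (leOfHom φ.unop.unop) } }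
  exact ⟨(lcCol I i M).desc c, fun t => (lcCol I i M).fac c (Opposite.op (Opposite.op t))⟩

/-- the diagram evaluated at `M` -/
abbrev lcDiag (I : Ideal R) (i : ℕ) (M : ModuleCat.{u} R) : (ℕᵒᵖ)ᵒᵖ ⥤ ModuleCat.{u} R :=
  localCohomology.diagram (localCohomology.idealPowersDiagram I) i ⋙
      (evaluation (ModuleCat.{u} R) (ModuleCat.{u} R)).obj M

lemma conc_zero {K : Type} [SmallCategory K] [IsFiltered K] (F : K ⥤ ModuleCat.{u} R)
    {c : Limits.Cocone F} (hc : Limits.IsColimit c) (k : K) (x : F.obj k) (hx : c.ι.app k x = 0) :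
    ∃ (k' : K) (f : k ⟶ k'), F.map f x = 0 := by
  have := Limits.preservesSmallestFilteredColimits_of_preservesFilteredColimits
    (forget (ModuleCat.{u} R))
  have h0 : c.ι.app k x = c.ι.app k 0 := by rw [hx, map_zero]
  obtain ⟨k', f, g, h⟩ := Limits.Concrete.isColimit_exists_of_rep_eq F hc x 0 h0
  exact ⟨k', f, h.trans (map_zero _)⟩

lemma lc_zero (I : Ideal R) (i : ℕ) (M : ModuleCat.{u} R) (t : ℕ)
    (x : ExtMod R i (ModuleCat.of R (R ⧸ I ^ t)) M) (hx : lcι I i M t x = 0) :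
    ∃ t', ∃ h : t ≤ t', ExtMod.pull i (qmap (Ideal.pow_le_pow_right h : I ^ t' ≤ I ^ t)) M x = 0 := by
  obtain ⟨k, f, h⟩ := conc_zero (lcDiag I i M) (lcCol I i M) (Opposite.op (Opposite.op t)) x hx
  exact ⟨k.unop.unop, leOfHom f.unop.unop, h⟩

open Abelian in
lemma Van.of_lc {J : Ideal R} {N : ModuleCat.{u} R} {i : ℕ}
    (H : Subsingleton ((localCohomology J (i + 1)).obj N)) : Van J (i + 1) N := by
  intro L t ht ξ
  obtain ⟨t', h, h0⟩ := lc_zero J (i + 1) N t (extCmp _ _ i ((Ext.mk₀ (qmap ht)).comp ξ (zero_add _)))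
    (Subsingleton.elim _ _)
  have h2 : J ^ t' ≤ J ^ t := Ideal.pow_le_pow_right h
  refine ⟨t', h2.trans ht, ?_⟩
  rw [← extCmp_nat] at h0
  rw [← qmap_pull h2 ht]
  exact (LinearEquiv.map_eq_zero_iff _).1 h0


open Abelian in
/-- connecting isomorphism -/
def deltaEquiv (L : Ideal R) (M : ModuleCat.{u} R) (m : ℕ) :
    Ext.{u} (ModuleCat.of R L) M (m + 1) ≃ₗ[R] Ext.{u} (ModuleCat.of R (R ⧸ L)) M (m + 2) :=
  LinearEquiv.ofBijective
    (Ext.precompOfLinear (idealSC_shortExact L).extClass R M (by lia : 1 + (m + 1) = m + 2)) <| by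
    constructor
    · rw [injective_iff_map_eq_zero]
      intro ξ hξ
      obtain ⟨z, hz⟩ := Ext.contravariant_sequence_exact₁ (idealSC_shortExact L) _ ξ
        (by lia : 1 + (m + 1) = m + 2) hξ
      have hz0 : z = 0 := ext_R_zero _ _ (Nat.succ_pos m) R z
      rw [← hz, hz0, Ext.comp_zero]
    · intro ξ
      obtain ⟨z, hz⟩ := Ext.contravariant_sequence_exact₃ (idealSC_shortExact L) M ξ
        (ext_R_zero _ _ (by lia) R _) (by lia : 1 + (m + 1) = m + 2)
      exact ⟨z, hz⟩

open Abelian in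
lemma delta_nat {L' L : Ideal R} (h : L' ≤ L) (M : ModuleCat.{u} R) (m : ℕ)
    (ξ : Ext.{u} (ModuleCat.of R L) M (m + 1)) :
    (Ext.mk₀ (qmap h)).comp (deltaEquiv L M m ξ) (zero_add _) =
      deltaEquiv L' M m ((Ext.mk₀ (inclHom h)).comp ξ (zero_add _)) := by
  have hd : ∀ (L : Ideal R) (ξ : Ext.{u} (ModuleCat.of R L) M (m + 1)), deltaEquiv L M m ξ =
    Ext.comp (X := ModuleCat.of R (R ⧸ L)) (Y := ModuleCat.of R L)
      (idealSC_shortExact L).extClass ξ (by lia : 1 + (m + 1) = m + 2) := fun _ _ => rfl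
  rw [hd, hd, ← Ext.comp_assoc (a₁₂ := 1) _ _ _ (by lia) (by lia) (by lia), idealSC_nat h,
    Ext.comp_assoc (a₂₃ := m + 1) _ _ _ (by lia) (by lia) (by lia)]

/-- `Ext^{m+1}(L, M) ≃ Ext^{m+2}(R/L, M)` -/
def phiEquiv (L : Ideal R) (M : ModuleCat.{u} R) (m : ℕ) :
    Abelian.Ext.{u} (ModuleCat.of R L) M (m + 1) ≃ₗ[R]
      ExtMod R (m + 2) (ModuleCat.of R (R ⧸ L)) M :=
  (deltaEquiv L M m).trans (extCmp _ _ (m + 1))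

lemma phi_apply (L : Ideal R) (M : ModuleCat.{u} R) (m : ℕ)
    (ξ : Abelian.Ext.{u} (ModuleCat.of R L) M (m + 1)) :
    phiEquiv L M m ξ = extCmp _ _ (m + 1) (deltaEquiv L M m ξ) := rfl

open Abelian in
lemma phi_nat {L' L : Ideal R} (h : L' ≤ L) (M : ModuleCat.{u} R) (m : ℕ)
    (ξ : Ext.{u} (ModuleCat.of R L) M (m + 1)) :
    ExtMod.pull (m + 2) (qmap h) M (phiEquiv L M m ξ) =
      phiEquiv L' M m ((Ext.mk₀ (inclHom h)).comp ξ (zero_add _)) := by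
  rw [phi_apply, phi_apply, ← delta_nat]
  exact (extCmp_nat (qmap h) (m + 1) _).symm

open Abelian in
/-- action of a linear map between ideals -/
def actMap {L' L : Ideal R} (g : L' →ₗ[R] L) (M : ModuleCat.{u} R) (m : ℕ) :
    ExtMod R (m + 2) (ModuleCat.of R (R ⧸ L)) M ⟶ ExtMod R (m + 2) (ModuleCat.of R (R ⧸ L')) M :=
  ModuleCat.ofHom ((phiEquiv L' M m).toLinearMap ∘ₗ
    (Ext.precompOfLinear (Ext.mk₀ (ModuleCat.ofHom g)) R M (zero_add (m + 1))) ∘ₗ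
    (phiEquiv L M m).symm.toLinearMap)

open Abelian in
lemma actMap_phi {L' L : Ideal R} (g : L' →ₗ[R] L) (M : ModuleCat.{u} R) (m : ℕ)
    (ξ : Ext.{u} (ModuleCat.of R L) M (m + 1)) :
    actMap g M m (phiEquiv L M m ξ) =
      phiEquiv L' M m ((Ext.mk₀ (ModuleCat.ofHom g)).comp ξ (zero_add _)) := by
  change phiEquiv L' M m ((Ext.mk₀ (ModuleCat.ofHom g)).comp
    ((phiEquiv L M m).symm (phiEquiv L M m ξ)) (zero_add _)) = _
  rw [LinearEquiv.symm_apply_apply]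

lemma act_ext {L' L : Ideal R} {M : ModuleCat.{u} R} {m : ℕ}
    {f g : ExtMod R (m + 2) (ModuleCat.of R (R ⧸ L)) M ⟶ ExtMod R (m + 2) (ModuleCat.of R (R ⧸ L')) M}
    (h : ∀ ξ, f (phiEquiv L M m ξ) = g (phiEquiv L M m ξ)) : f = g := by
  refine ModuleCat.hom_ext (LinearMap.ext fun y => ?_)
  obtain ⟨ξ, rfl⟩ := (phiEquiv L M m).surjective y
  exact h ξ

lemma actMap_incl {L' L : Ideal R} (h : L' ≤ L) (M : ModuleCat.{u} R) (m : ℕ) :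
    actMap (Submodule.inclusion h) M m = ExtMod.pull (m + 2) (qmap h) M :=
  act_ext fun ξ => (actMap_phi _ _ _ ξ).trans (phi_nat h M m ξ).symm

lemma actMap_comp {L'' L' L : Ideal R} (g' : L'' →ₗ[R] L') (g : L' →ₗ[R] L) (M : ModuleCat.{u} R)
    (m : ℕ) : actMap g M m ≫ actMap g' M m = actMap (g ∘ₗ g') M m := by
  refine act_ext fun ξ => ?_
  rw [ModuleCat.comp_apply, actMap_phi, actMap_phi, actMap_phi, Abelian.Ext.mk₀_comp_mk₀_assoc]
  rfl

lemma actMap_sum {L' L : Ideal R} {k : ℕ} (a : Fin k → R) (g : Fin k → (L' →ₗ[R] L))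
    (M : ModuleCat.{u} R) (m : ℕ) :
    actMap (∑ l, a l • g l) M m = ∑ l, a l • actMap (g l) M m := by
  refine act_ext fun ξ => ?_
  have h1 : ModuleCat.ofHom (∑ l, a l • g l) = ∑ l, a l • ModuleCat.ofHom (g l) := by
    ext x
    simp [ModuleCat.hom_sum]
  have h2 : (∑ l, a l • actMap (g l) M m) (phiEquiv L M m ξ) =
      ∑ l, a l • (actMap (g l) M m (phiEquiv L M m ξ)) := by
    change (∑ l, a l • actMap (g l) M m).hom _ = _
    rw [ModuleCat.hom_sum, LinearMap.sum_apply]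
    rfl
  rw [h2, actMap_phi, h1, Abelian.Ext.mk₀_sum, Abelian.Ext.sum_comp, map_sum]
  refine Finset.sum_congr rfl fun l _ => ?_
  rw [actMap_phi, Abelian.Ext.mk₀_smul, Abelian.Ext.smul_comp, map_smul]

/-- restriction of `s : J^n → R` to powers of `I` -/
def resMap {I J : Ideal R} (hIJ : I ≤ J) {n : ℕ} (s : (J ^ n : Ideal R) →ₗ[R] R) (t : ℕ) :
    (I ^ (t + n) : Ideal R) →ₗ[R] (I ^ t : Ideal R) :=
  LinearMap.codRestrict (I ^ t) (s ∘ₗ Submodule.inclusion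
    ((Ideal.pow_le_pow_right (Nat.le_add_left n t)).trans (Ideal.pow_right_mono hIJ n))) <| by
    intro x
    obtain ⟨x, hx⟩ := x
    have key : ∀ x, x ∈ I ^ (t + n) → ∃ h : x ∈ J ^ n, s ⟨x, h⟩ ∈ I ^ t := by
      intro x hx
      rw [pow_add] at hx
      induction hx using Submodule.mul_induction_on' with
      | mem_mul_mem y hy z hz =>
        have hz' : z ∈ J ^ n := Ideal.pow_right_mono hIJ n hz
        refine ⟨Ideal.mul_mem_left _ _ hz', ?_⟩
        have : (⟨y * z, Ideal.mul_mem_left _ _ hz'⟩ : (J ^ n : Ideal R)) = y • ⟨z, hz'⟩ := rfl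
        rw [this, map_smul, smul_eq_mul]
        exact Ideal.mul_mem_right _ _ hy
      | add y hy z hz h1 h2 =>
        obtain ⟨h1, h1'⟩ := h1
        obtain ⟨h2, h2'⟩ := h2
        refine ⟨Ideal.add_mem _ h1 h2, ?_⟩
        have : (⟨y + z, Ideal.add_mem _ h1 h2⟩ : (J ^ n : Ideal R)) = ⟨y, h1⟩ + ⟨z, h2⟩ := rfl
        rw [this, map_add]
        exact Ideal.add_mem _ h1' h2'
    exact (key x hx).2

lemma main_aux {I J : Ideal R} (hIJ : I ≤ J) {n k : ℕ} (a : Fin k → R)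
    (s : Fin k → ((J ^ n : Ideal R) →ₗ[R] R)) (ha : ∀ l, a l ∈ J)
    (h : ∀ x : (J ^ n : Ideal R), ∑ l, a l * s l x = x) (M : ModuleCat.{u} R) (m j : ℕ) :
    Subsingleton (ExtMod R j (ModuleCat.of R (R ⧸ J)) ((localCohomology I (m + 2)).obj M)) := by
  have ex : ∀ l, ∃ g : (localCohomology I (m + 2)).obj M ⟶ (localCohomology I (m + 2)).obj M,
      ∀ t, lcι I (m + 2) M t ≫ g = actMap (resMap hIJ (s l) t) M m ≫ lcι I (m + 2) M (t + n) := by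
    intro l
    refine lc_desc I (m + 2) M
      (fun t => actMap (resMap hIJ (s l) t) M m ≫ lcι I (m + 2) M (t + n)) ?_
    intro t t' h
    rw [← lcι_w I (m + 2) M (Nat.add_le_add_right h n), ← actMap_incl, ← actMap_incl,
      ← Category.assoc, ← Category.assoc, actMap_comp, actMap_comp]
    rfl
  choose g hg using ex
  refine ExtMod.subsingleton_of_endos _ a ha g ?_ j
  have h1 : ∀ t, Submodule.inclusion
      (Ideal.pow_le_pow_right (Nat.le_add_right t n) : I ^ (t + n) ≤ I ^ t)
      = ∑ l, a l • resMap hIJ (s l) t := by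
    intro t
    ext x
    have := h ⟨x.1, ((Ideal.pow_le_pow_right (Nat.le_add_left n t)).trans
      (Ideal.pow_right_mono hIJ n)) x.2⟩
    simp only [LinearMap.sum_apply, LinearMap.smul_apply, AddSubmonoidClass.coe_finsetSum,
      Submodule.coe_smul, smul_eq_mul]
    exact this.symm
  have h2 : ∀ t, lcι I (m + 2) M t =
      ∑ l, a l • (actMap (resMap hIJ (s l) t) M m ≫ lcι I (m + 2) M (t + n)) := by
    intro t
    rw [← lcι_w I (m + 2) M (Nat.le_add_right t n), ← actMap_incl, h1, actMap_sum,
      Preadditive.sum_comp]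
    exact Finset.sum_congr rfl fun l _ => Linear.smul_comp _ _ _ _ _ _
  refine lc_hom_ext I (m + 2) M _ _ fun t => ?_
  rw [Category.comp_id, Preadditive.comp_sum]
  refine Eq.trans (Finset.sum_congr rfl fun l _ => ?_) (h2 t).symm
  rw [Linear.comp_smul, hg l t]

theorem main_thm [IsNoetherianRing R] (I J : Ideal R) (hIJ : I ≤ J)
    (hJ : ∀ i : ℕ, 2 ≤ i → Subsingleton ((localCohomology J i).obj (ModuleCat.of R R)))
    (M : ModuleCat.{u} R) (i j : ℕ) (hi : 2 ≤ i) :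
    Subsingleton (ExtMod R j (ModuleCat.of R (R ⧸ J)) ((localCohomology I i).obj M)) := by
  obtain ⟨m, rfl⟩ : ∃ m, i = m + 2 := ⟨i - 2, by omega⟩
  have hV : ∀ i, 2 ≤ i → Van J i (ModuleCat.of R R) := by
    intro i hi
    obtain ⟨i, rfl⟩ : ∃ m, i = m + 1 := ⟨i - 1, by omega⟩
    exact Van.of_lc (hJ _ hi)
  obtain ⟨n, k, a, s, ha, h⟩ := exists_star hV
  exact main_aux hIJ a s ha h M m j

end Aux

theorem stmt15 (R : Type u) [CommRing R] [IsNoetherianRing R] (I J : Ideal R) (hIJ : I ≤ J)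
    (hJcd₁ : ¬ Subsingleton (LC R J 1 (ModuleCat.of R R)))
    (hJcd₂ : ∀ i : ℕ, 2 ≤ i → Subsingleton (LC R J i (ModuleCat.of R R)))
    (M : Type u) [AddCommGroup M] [Module R M] :
    ∀ i j : ℕ, 2 ≤ i →
      Subsingleton (ExtMod R j (ModuleCat.of R (R ⧸ J)) (LC R I i (ModuleCat.of R M))) := by
  intro i j hi
  exact main_thm I J hIJ hJcd₂ (ModuleCat.of R M) i j hi
end
end
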